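/- arXiv:1806.08656 — 2 statements merged into one kernel-verified Lean document; each statement's English description precedes it below -/
import Mathlib

section
/- For every X ⊆ ℝ^n with non-empty interior, sxdeg(M_{n,2d}(X)) ≥ C(n+d,n); that is, the moment cone M_{n,2d}(X) has no ((𝒮₊ᵏ)^m)-lift whenever k < C(n+d,n). -/
open MvPolynomial

/-- The cone of `m`-tuples of `k × k` real positive semidefinite matrices, `(𝒮₊ᵏ)^m`. -/
def PSDTuple (k m : ℕ) : Set (Fin m → Matrix (Fin k) (Fin k) ℝ) :=
  {A | ∀ i, (A i).PosSemidef}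

/-- The cone `𝒮₊ᵏ` of `k × k` real positive semidefinite matrices. -/
def PSDCone (k : ℕ) : Set (Matrix (Fin k) (Fin k) ℝ) :=
  {A | A.PosSemidef}

/-- `S ⊆ V` has a `K`-lift if `S = π(K ∩ H)` for an affine subspace `H` and a linear map `π`. -/
def HasLift {W V : Type*} [AddCommGroup W] [Module ℝ W] [AddCommGroup V] [Module ℝ V]
    (K : Set W) (S : Set V) : Prop :=
  ∃ (H : AffineSubspace ℝ W) (p : W →ₗ[ℝ] V), S = p '' (K ∩ (H : Set W))

/-- Semidefinite extension degree: the smallest `k` such that `S` has an `(𝒮₊ᵏ)^m`-lift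
for some finite `m` (`⊤` if there is no such `k`). -/
noncomputable def sxdeg {V : Type*} [AddCommGroup V] [Module ℝ V] (S : Set V) : ℕ∞ :=
  sInf {c : ℕ∞ | ∃ k m : ℕ, c = (k : ℕ∞) ∧ HasLift (PSDTuple k m) S}

/-- Semidefinite extension complexity: the smallest `k` such that `S` has an `𝒮₊ᵏ`-lift. -/
noncomputable def sxc {V : Type*} [AddCommGroup V] [Module ℝ V] (S : Set V) : ℕ∞ :=
  sInf {c : ℕ∞ | ∃ k : ℕ, c = (k : ℕ∞) ∧ HasLift (PSDCone k) S}

/-- Coefficient embedding of polynomials into the product space `(Fin n →₀ ℕ) → ℝ`;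
used to express topological notions (closedness) for sets of polynomials. -/
noncomputable def coeffMap (n : ℕ) : MvPolynomial (Fin n) ℝ →ₗ[ℝ] ((Fin n →₀ ℕ) → ℝ) where
  toFun f := fun a => coeff a f
  map_add' := by intros; funext; simp
  map_smul' := by intros; funext; simp

/-- `Σ_{n,2d}`: sums of squares of polynomials, of degree at most `2d`, in `n` variables. -/
def SOSCone (n d : ℕ) : Set (MvPolynomial (Fin n) ℝ) :=
  {f | f.totalDegree ≤ 2 * d ∧
    ∃ (r : ℕ) (g : Fin r → MvPolynomial (Fin n) ℝ), f = ∑ i, g i ^ 2}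

/-- `P_{n,2d}(X)`: polynomials of degree at most `2d` that are nonnegative on `X`. -/
def PosCone (n d : ℕ) (X : Set (Fin n → ℝ)) : Set (MvPolynomial (Fin n) ℝ) :=
  {f | f.totalDegree ≤ 2 * d ∧ ∀ x ∈ X, 0 ≤ MvPolynomial.eval x f}

/-- The vector `v_{n,d}(x) = (x^α)_{|α| ≤ d}` of all monomials of degree at most `d`
evaluated at `x`, regarded inside the coordinate space `(Fin n →₀ ℕ) → ℝ`. -/
noncomputable def monVec (n d : ℕ) (x : Fin n → ℝ) : (Fin n →₀ ℕ) → ℝ :=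
  fun a => if (a.sum fun _ e => e) ≤ d then ∏ i, x i ^ a i else 0

/-- The convex conic hull: all finite nonnegative combinations of elements of `s`. -/
def coneHull {V : Type*} [AddCommGroup V] [Module ℝ V] (s : Set V) : Set V :=
  {y | ∃ (r : ℕ) (c : Fin r → ℝ) (v : Fin r → V),
    (∀ i, 0 ≤ c i) ∧ (∀ i, v i ∈ s) ∧ y = ∑ i, c i • v i}

open Topology

open scoped MatrixOrder in
/-- If `ker B ⊆ ker A` for positive semidefinite `A`, `B`, then `B - ε A` is positive
semidefinite for all small `ε > 0`. -/
lemma Matrix.PosSemidef.eventually_sub_smul {k : ℕ} {A B : Matrix (Fin k) (Fin k) ℝ}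
    (hA : A.PosSemidef) (hB : B.PosSemidef)
    (h : LinearMap.ker B.mulVecLin ≤ LinearMap.ker A.mulVecLin) :
    ∀ᶠ ε : ℝ in 𝓝[>] 0, (B - ε • A).PosSemidef := by
  obtain ⟨D, hD⟩ := CStarAlgebra.nonneg_iff_eq_star_mul_self.mp hA.nonneg
  obtain ⟨C, hC⟩ := CStarAlgebra.nonneg_iff_eq_star_mul_self.mp hB.nonneg
  rw [Matrix.star_eq_conjTranspose] at hC hD
  have quad (M : Matrix (Fin k) (Fin k) ℝ) (v : Fin k → ℝ) :
      star v ⬝ᵥ (M.conjTranspose * M).mulVec v = ∑ i, (M.mulVec v i) ^ 2 := by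
    rw [← Matrix.mulVec_mulVec, Matrix.dotProduct_mulVec, Matrix.vecMul_conjTranspose, star_star]
    simp [dotProduct, sq]
  rw [hC, hD, Matrix.ker_mulVecLin_conjTranspose_mul_self,
    Matrix.ker_mulVecLin_conjTranspose_mul_self] at h
  have row (i : Fin k) : ∃ c : Fin k → ℝ, ∀ v, D.mulVec v i = ∑ l, c l * C.mulVec v l := by
    have hmem := mem_span_of_iInf_ker_le_ker (L := fun l => LinearMap.proj l ∘ₗ C.mulVecLin)
      (K := LinearMap.proj i ∘ₗ D.mulVecLin) (by
        intro v hv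
        have hv' : v ∈ LinearMap.ker C.mulVecLin := by
          rw [LinearMap.mem_ker]
          ext l
          simpa using (Submodule.mem_iInf _).1 hv l
        have := h hv'
        rw [LinearMap.mem_ker] at this
        simpa using congrFun this i)
    obtain ⟨c, hc⟩ := (Submodule.mem_span_range_iff_exists_fun ℝ).1 hmem
    refine ⟨c, fun v => ?_⟩
    simpa using (LinearMap.congr_fun hc v).symm
  choose T hT using row
  set K : ℝ := ∑ i, ∑ l, T i l ^ 2 with hK
  have hK0 : 0 ≤ K := by positivity
  have bound (v : Fin k → ℝ) : ∑ i, (D.mulVec v i) ^ 2 ≤ K * ∑ l, (C.mulVec v l) ^ 2 := by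
    rw [hK, Finset.sum_mul]
    refine Finset.sum_le_sum fun i _ => ?_
    rw [hT]
    exact Finset.sum_mul_sq_le_sq_mul_sq _ _ _
  have hlt : (0 : ℝ) < 1 / (K + 1) := by positivity
  filter_upwards [Ioo_mem_nhdsGT hlt] with ε hε
  refine Matrix.PosSemidef.of_dotProduct_mulVec_nonneg
    (hB.isHermitian.sub (by
      rw [Matrix.IsHermitian, Matrix.conjTranspose_smul, hA.isHermitian.eq]; simp)) fun v => ?_
  rw [Matrix.sub_mulVec, Matrix.smul_mulVec, dotProduct_sub, dotProduct_smul, hC, hD, quad, quad,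
    smul_eq_mul, sub_nonneg]
  have h1 : ε * K ≤ 1 := by
    have := (lt_div_iff₀ (by positivity)).1 hε.2
    nlinarith [hε.1]
  have h2 : 0 ≤ ∑ l, (C.mulVec v l) ^ 2 := by positivity
  nlinarith [mul_le_mul_of_nonneg_left (bound v) hε.1.le]

lemma Matrix.PosSemidef.ker_mulVecLin_add {k : ℕ} {A B : Matrix (Fin k) (Fin k) ℝ}
    (hA : A.PosSemidef) (hB : B.PosSemidef) :
    LinearMap.ker (A + B).mulVecLin =
      LinearMap.ker A.mulVecLin ⊓ LinearMap.ker B.mulVecLin := by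
  ext v
  simp only [Submodule.mem_inf, LinearMap.mem_ker, Matrix.mulVecLin_apply]
  constructor
  · intro h
    have h0 : star v ⬝ᵥ A.mulVec v + star v ⬝ᵥ B.mulVec v = 0 := by
      rw [← dotProduct_add, ← Matrix.add_mulVec, h, dotProduct_zero]
    have hA' := hA.dotProduct_mulVec_nonneg v
    have hB' := hB.dotProduct_mulVec_nonneg v
    exact ⟨(hA.dotProduct_mulVec_zero_iff v).1 (by linarith),
      (hB.dotProduct_mulVec_zero_iff v).1 (by linarith)⟩
  · rintro ⟨h1, h2⟩
    rw [Matrix.add_mulVec, h1, h2, add_zero]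

lemma Matrix.ker_mulVecLin_smul {k : ℕ} (A : Matrix (Fin k) (Fin k) ℝ) {c : ℝ} (hc : c ≠ 0) :
    LinearMap.ker (c • A).mulVecLin = LinearMap.ker A.mulVecLin := by
  ext v
  simp [hc]

/-- A set with nonempty interior belongs to an ultrafilter along which every nonzero polynomial
is eventually nonzero. -/
lemma exists_ultrafilter_eval_ne_zero {n : ℕ} {X : Set (Fin n → ℝ)}
    (hX : (interior X).Nonempty) :
    ∃ U : Ultrafilter (Fin n → ℝ), X ∈ U ∧
      ∀ q : MvPolynomial (Fin n) ℝ, q ≠ 0 → ∀ᶠ x in (U : Filter (Fin n → ℝ)), eval x q ≠ 0 := by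
  let F : Filter (Fin n → ℝ) :=
    { sets := {T | ∃ q : MvPolynomial (Fin n) ℝ, q ≠ 0 ∧ ∀ x ∈ X, eval x q ≠ 0 → x ∈ T}
      univ_sets := ⟨1, one_ne_zero, fun _ _ _ => Set.mem_univ _⟩
      sets_of_superset := fun ⟨q, hq, h⟩ hST => ⟨q, hq, fun x hx hxq => hST (h x hx hxq)⟩
      inter_sets := fun ⟨p, hp, h⟩ ⟨q, hq, h'⟩ => ⟨p * q, mul_ne_zero hp hq, fun x hx hxpq => by
        rw [map_mul] at hxpq
        exact ⟨h x hx (left_ne_zero_of_mul hxpq), h' x hx (right_ne_zero_of_mul hxpq)⟩⟩ }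
  have hF : F.NeBot := by
    rw [Filter.neBot_iff, Ne, ← Filter.empty_mem_iff_bot]
    rintro ⟨q, hq, h⟩
    obtain ⟨c, hc⟩ := hX
    obtain ⟨r, hr, hball⟩ := Metric.isOpen_iff.1 isOpen_interior c hc
    refine hq (MvPolynomial.funext_set (fun i => Metric.ball (c i) r) (fun i => ?_) fun x hx => ?_)
    · rw [Real.ball_eq_Ioo]
      exact Set.Ioo_infinite (by linarith)
    · rw [← ball_pi c hr] at hx
      rw [map_zero]
      by_contra hne
      exact h x (interior_subset (hball hx)) hne
  refine ⟨Ultrafilter.of F, Ultrafilter.of_le F ⟨1, one_ne_zero, fun _ hx _ => hx⟩, fun q hq => ?_⟩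
  exact Ultrafilter.of_le F ⟨q, hq, fun _ _ hx => hx⟩

/-- The space of polynomials of degree at most `d` in `n` variables has dimension at least
`C(n+d,n)`. -/
lemma choose_le_finrank_restrictTotalDegree (n d : ℕ) :
    (n + d).choose n ≤ Module.finrank ℝ (restrictTotalDegree (Fin n) ℝ d) := by
  classical
  have hcard : Nat.card (Sym (Fin (n + 1)) d) = (n + d).choose n := by
    rw [Nat.card_eq_fintype_card, Sym.card_sym_eq_choose, Fintype.card_fin,
      show n + 1 + d - 1 = n + d by omega, Nat.choose_symm_add]
  let e := Sym.equivNatSumOfFintype (Fin (n + 1)) d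
  let tail : Sym (Fin (n + 1)) d → (Fin n →₀ ℕ) := fun s =>
    Finsupp.equivFunOnFinite.symm fun i => (e s).1 i.succ
  have htail (s) : (tail s).sum (fun _ e => e) = ∑ i : Fin n, (e s).1 i.succ := by
    rw [Finsupp.sum_fintype _ _ (fun _ => rfl)]
    rfl
  have hsum (s) : (e s).1 0 + ∑ i : Fin n, (e s).1 i.succ = d := by
    rw [← Fin.sum_univ_succ]
    exact (e s).2
  have hinj : Function.Injective tail := by
    intro s t hst
    have hsucc : ∀ i : Fin n, (e s).1 i.succ = (e t).1 i.succ := fun i => DFunLike.congr_fun hst i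
    have hzero : (e s).1 0 = (e t).1 0 := by
      have h1 := hsum s
      have h2 := hsum t
      simp only [hsucc] at h1
      omega
    apply e.injective
    apply Subtype.ext
    funext i
    exact Fin.cases hzero hsucc i
  let f : Sym (Fin (n + 1)) d → restrictTotalDegree (Fin n) ℝ d := fun s =>
    ⟨monomial (tail s) 1, by
      rw [mem_restrictTotalDegree]
      refine (totalDegree_monomial_le _ _).trans ?_
      exact (htail s).trans_le ((Nat.le_add_left _ _).trans_eq (hsum s))⟩
  have hf : LinearIndependent ℝ f := by
    apply LinearIndependent.of_comp (restrictTotalDegree (Fin n) ℝ d).subtype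
    have := (basisMonomials (Fin n) ℝ).linearIndependent.comp tail hinj
    simpa [Function.comp_def, f] using this
  rw [← hcard, Nat.card_eq_fintype_card]
  exact hf.fintype_card_le_finrank

/-- Fewer than `C(n+d,n)` points lie on the zero set of a nonzero polynomial of degree at most
`d`. -/
lemma exists_eval_eq_zero_of_card_lt {n d : ℕ} (S : Finset (Fin n → ℝ))
    (hS : S.card < (n + d).choose n) :
    ∃ q : MvPolynomial (Fin n) ℝ, q ≠ 0 ∧ q.totalDegree ≤ d ∧ ∀ x ∈ S, eval x q = 0 := by
  let ev : restrictTotalDegree (Fin n) ℝ d →ₗ[ℝ] (S → ℝ) :=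
    LinearMap.pi fun x => (aeval x.1).toLinearMap ∘ₗ (restrictTotalDegree (Fin n) ℝ d).subtype
  have hker : LinearMap.ker ev ≠ ⊥ := by
    apply LinearMap.ker_ne_bot_of_finrank_lt
    simpa using hS.trans_le (choose_le_finrank_restrictTotalDegree n d)
  obtain ⟨q, hq, hq0⟩ := Submodule.exists_mem_ne_zero_of_ne_bot hker
  refine ⟨q, by simpa using hq0, (mem_restrictTotalDegree _ _ _).1 q.2, fun x hx => ?_⟩
  simpa [ev, aeval_eq_eval] using congrFun (LinearMap.mem_ker.1 hq) ⟨x, hx⟩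

/-- The functional on moment sequences given by integration against `q ^ 2`. -/
noncomputable def squareFunctional {n : ℕ} (q : MvPolynomial (Fin n) ℝ) :
    ((Fin n →₀ ℕ) → ℝ) →L[ℝ] ℝ :=
  ∑ a ∈ q.support, ∑ b ∈ q.support, (coeff a q * coeff b q) • ContinuousLinearMap.proj (a + b)

lemma squareFunctional_monVec {n d : ℕ} {q : MvPolynomial (Fin n) ℝ} (hq : q.totalDegree ≤ d)
    (x : Fin n → ℝ) : squareFunctional q (monVec n (2 * d) x) = eval x q ^ 2 := by
  rw [sq, eval_eq', Finset.sum_mul_sum]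
  simp only [squareFunctional, FunLike.coe_sum, Finset.sum_apply, FunLike.coe_smul,
    Pi.smul_apply, ContinuousLinearMap.proj_apply, smul_eq_mul]
  refine Finset.sum_congr rfl fun a ha => Finset.sum_congr rfl fun b hb => ?_
  have hab : (a + b).sum (fun _ e => e) ≤ 2 * d := by
    rw [Finsupp.sum_add_index' (fun _ => rfl) (fun _ _ _ => rfl)]
    have := (le_totalDegree ha).trans hq
    have := (le_totalDegree hb).trans hq
    omega
  rw [monVec, if_pos hab]
  simp only [Finsupp.add_apply, pow_add, Finset.prod_mul_distrib]
  ring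

lemma squareFunctional_nonneg {n d : ℕ} {q : MvPolynomial (Fin n) ℝ} (hq : q.totalDegree ≤ d)
    {X : Set (Fin n → ℝ)} {y : (Fin n →₀ ℕ) → ℝ}
    (hy : y ∈ closure (coneHull (monVec n (2 * d) '' X))) : 0 ≤ squareFunctional q y := by
  refine closure_minimal ?_ (isClosed_Ici.preimage (squareFunctional q).continuous) hy
  rintro _ ⟨r, c, v, hc, hv, rfl⟩
  simp only [Set.mem_preimage, Set.mem_Ici, map_sum, map_smul, smul_eq_mul]
  refine Finset.sum_nonneg fun i _ => mul_nonneg (hc i) ?_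
  obtain ⟨x, -, hx⟩ := hv i
  rw [← hx, squareFunctional_monVec hq]
  positivity

/-- Let `A x` be tuples of positive semidefinite matrices in an affine subspace `H`, for `x ∈ X`.
Along an ultrafilter containing `X`, after averaging `k` many of the `A x` with a given point, the
kernels are eventually contained in those of `A x`. -/
lemma exists_psdTuple_ker_le {α V : Type*} [AddCommGroup V] [Module ℝ V] {k m : ℕ}
    {H : AffineSubspace ℝ (Fin m → Matrix (Fin k) (Fin k) ℝ)}
    (p : (Fin m → Matrix (Fin k) (Fin k) ℝ) →ₗ[ℝ] V) {X : Set α} (v : α → V)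
    {A : α → Fin m → Matrix (Fin k) (Fin k) ℝ}
    (hA : ∀ x ∈ X, A x ∈ PSDTuple k m ∩ (H : Set _) ∧ p (A x) = v x)
    {A₀ : Fin m → Matrix (Fin k) (Fin k) ℝ} (hA₀ : A₀ ∈ PSDTuple k m ∩ (H : Set _))
    (hpA₀ : p A₀ = 0) (U : Ultrafilter α) (hU : X ∈ U) :
    ∃ (S : Finset α) (B : Fin m → Matrix (Fin k) (Fin k) ℝ), S.card ≤ k ∧
      B ∈ PSDTuple k m ∩ (H : Set _) ∧
      (∀ L : V →ₗ[ℝ] ℝ, (∀ s ∈ S, L (v s) = 0) → L (p B) = 0) ∧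
      ∀ᶠ x in (U : Filter α), ∀ j,
        LinearMap.ker (B j).mulVecLin ≤ LinearMap.ker (A x j).mulVecLin := by
  classical
  suffices key : ∀ r : ℕ, ∃ (S : Finset α) (B : Fin m → Matrix (Fin k) (Fin k) ℝ), S.card ≤ r ∧
      B ∈ PSDTuple k m ∩ (H : Set _) ∧
      (∀ L : V →ₗ[ℝ] ℝ, (∀ s ∈ S, L (v s) = 0) → L (p B) = 0) ∧
      ∀ j, (∀ᶠ x in (U : Filter α),
          LinearMap.ker (B j).mulVecLin ≤ LinearMap.ker (A x j).mulVecLin) ∨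
        Module.finrank ℝ (LinearMap.ker (B j).mulVecLin) + r ≤ k by
    obtain ⟨S, B, hS, hB, hL, hJ⟩ := key k
    refine ⟨S, B, hS, hB, hL, Filter.eventually_all.2 fun j => (hJ j).elim id fun h => ?_⟩
    have : LinearMap.ker (B j).mulVecLin = ⊥ := Submodule.finrank_eq_zero.1 (by omega)
    simp [this]
  intro r
  induction r with
  | zero =>
    refine ⟨∅, A₀, le_rfl, hA₀, fun L _ => by rw [hpA₀, map_zero], fun j => Or.inr ?_⟩
    simpa using Submodule.finrank_le (LinearMap.ker (A₀ j).mulVecLin)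
  | succ r ih =>
    obtain ⟨S, B, hS, hB, hL, hJ⟩ := ih
    have hev : ∀ᶠ x in (U : Filter α), x ∈ X ∧ ∀ j,
        (∀ᶠ y in (U : Filter α),
          LinearMap.ker (B j).mulVecLin ≤ LinearMap.ker (A y j).mulVecLin) ∨
        ¬ LinearMap.ker (B j).mulVecLin ≤ LinearMap.ker (A x j).mulVecLin := by
      refine Filter.Eventually.and hU (Filter.eventually_all.2 fun j => ?_)
      by_cases h : ∀ᶠ y in (U : Filter α),
          LinearMap.ker (B j).mulVecLin ≤ LinearMap.ker (A y j).mulVecLin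
      · exact .of_forall fun _ => Or.inl h
      · exact (Ultrafilter.eventually_not.2 h).mono fun _ => Or.inr
    obtain ⟨x, hxX, hx⟩ := hev.exists
    obtain ⟨hAx, hpx⟩ := hA x hxX
    have hker (j : Fin m) : LinearMap.ker (midpoint ℝ B (A x) j).mulVecLin =
        LinearMap.ker (B j).mulVecLin ⊓ LinearMap.ker (A x j).mulVecLin := by
      rw [midpoint_eq_smul_add, Pi.smul_apply, Pi.add_apply,
        Matrix.ker_mulVecLin_smul _ (by simp), (hB.1 j).ker_mulVecLin_add (hAx.1 j)]
    refine ⟨insert x S, midpoint ℝ B (A x), (Finset.card_insert_le _ _).trans (by omega),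
      ⟨fun j => ?_, ?_⟩, fun L hLS => ?_, fun j => ?_⟩
    · rw [midpoint_eq_smul_add, Pi.smul_apply, Pi.add_apply]
      exact ((hB.1 j).add (hAx.1 j)).smul (by simp)
    · exact AffineMap.lineMap_mem _ hB.2 hAx.2
    · rw [midpoint_eq_smul_add, map_smul, map_add, map_smul, map_add, hpx,
        hL L fun s hs => hLS s (Finset.mem_insert_of_mem hs), hLS x (Finset.mem_insert_self _ _)]
      simp
    · rw [hker]
      by_cases h : ∀ᶠ y in (U : Filter α),
          LinearMap.ker (B j).mulVecLin ≤ LinearMap.ker (A y j).mulVecLin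
      · exact Or.inl (h.mono fun y hy => inf_le_left.trans hy)
      · right
        have hlt : LinearMap.ker (B j).mulVecLin ⊓ LinearMap.ker (A x j).mulVecLin <
            LinearMap.ker (B j).mulVecLin := inf_lt_left.2 ((hx j).resolve_left h)
        have h1 := Submodule.finrank_lt_finrank_of_lt hlt
        have h2 := (hJ j).resolve_left h
        omega

lemma not_hasLift_momentCone {n d k m : ℕ} {X : Set (Fin n → ℝ)} (hX : (interior X).Nonempty)
    (hk : k < (n + d).choose n) :
    ¬ HasLift (PSDTuple k m) (closure (coneHull (monVec n (2 * d) '' X))) := by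
  rintro ⟨H, p, hM⟩
  have hzero : (0 : (Fin n →₀ ℕ) → ℝ) ∈ closure (coneHull (monVec n (2 * d) '' X)) :=
    subset_closure ⟨0, Fin.elim0, Fin.elim0, fun i => i.elim0, fun i => i.elim0, by simp⟩
  have hmem (x) (hx : x ∈ X) :
      monVec n (2 * d) x ∈ closure (coneHull (monVec n (2 * d) '' X)) :=
    subset_closure ⟨1, fun _ => 1, fun _ => monVec n (2 * d) x, fun _ => zero_le_one,
      fun _ => ⟨x, hx, rfl⟩, by simp⟩
  obtain ⟨A₀, hA₀, hpA₀⟩ := hM.subset hzero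
  have hlift (x) : ∃ A, x ∈ X → A ∈ PSDTuple k m ∩ (H : Set _) ∧ p A = monVec n (2 * d) x := by
    by_cases hx : x ∈ X
    · obtain ⟨A, hA⟩ := hM.subset (hmem x hx)
      exact ⟨A, fun _ => hA⟩
    · exact ⟨0, fun h => absurd h hx⟩
  choose A hA using hlift
  obtain ⟨U, hUX, hU⟩ := exists_ultrafilter_eval_ne_zero hX
  obtain ⟨S, B, hS, hB, hL, hker⟩ :=
    exists_psdTuple_ker_le p (monVec n (2 * d)) hA hA₀ hpA₀ U hUX
  obtain ⟨q, hq0, hqd, hqS⟩ := exists_eval_eq_zero_of_card_lt S (hS.trans_lt hk)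
  have hqB : squareFunctional q (p B) = 0 :=
    hL (squareFunctional q).toLinearMap fun s hs => by
      simp [squareFunctional_monVec hqd, hqS s hs]
  obtain ⟨x, hxker, hxX, hxq⟩ := (hker.and (Filter.Eventually.and hUX (hU q hq0))).exists
  obtain ⟨⟨hAx, hAxH⟩, hpx⟩ := hA x hxX
  have hev : ∀ᶠ ε : ℝ in 𝓝[>] 0, ∀ j, (B j - ε • A x j).PosSemidef :=
    Filter.eventually_all.2 fun j => (hAx j).eventually_sub_smul (hB.1 j) (hxker j)
  obtain ⟨ε, hε, hε0⟩ := (hev.and self_mem_nhdsWithin).exists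
  have hC : B + ε • (B - A x) ∈ PSDTuple k m ∩ (H : Set _) := by
    constructor
    · intro j
      have : (B + ε • (B - A x)) j = (B j - ε • A x j) + ε • B j := by
        simp only [Pi.add_apply, Pi.smul_apply, Pi.sub_apply, smul_sub]
        abel
      rw [this]
      exact (hε j).add ((hB.1 j).smul hε0.le)
    · have := AffineMap.lineMap_mem (-ε) hB.2 hAxH
      rw [AffineMap.lineMap_apply_module'] at this
      rwa [show B + ε • (B - A x) = -ε • (A x - B) + B by module]
  have hnonneg := squareFunctional_nonneg hqd (hM.superset ⟨_, hC, rfl⟩)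
  rw [map_add, map_smul, map_sub, map_add, map_smul, map_sub, hqB, hpx,
    squareFunctional_monVec hqd, smul_eq_mul] at hnonneg
  have : 0 < ε * eval x q ^ 2 := by positivity
  linarith

/-- Corollary 2.11: for `X ⊆ ℝⁿ` with nonempty interior, the moment cone
`M_{n,2d}(X) = cl(cone{v_{n,2d}(x) : x ∈ X})` satisfies `sxdeg(M_{n,2d}(X)) ≥ C(n+d,n)`. -/
theorem stmt_6 (n d : ℕ) (hn : 1 ≤ n)
    (X : Set (Fin n → ℝ)) (hX : (interior X).Nonempty) :
    (Nat.choose (n + d) n : ℕ∞) ≤ sxdeg (closure (coneHull (monVec n (2 * d) '' X))) ∧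
    ∀ k m : ℕ, k < Nat.choose (n + d) n →
      ¬ HasLift (PSDTuple k m) (closure (coneHull (monVec n (2 * d) '' X))) := by
  refine ⟨le_sInf ?_, fun k m hk => not_hasLift_momentCone hX hk⟩
  rintro _ ⟨k, m, rfl, h⟩
  by_contra hlt
  exact not_hasLift_momentCone hX (by exact_mod_cast not_le.1 hlt) h
end

section
/- For all n,d ∈ ℕ: if n ≥ 2, d ≥ 2 and (n,d) ≠ (2,2), then the moment cone M_{n,2d} has no ((𝒮₊ᵏ)^m)-lift for any k,m ∈ ℕ (i.e. sxdeg(M_{n,2d}) = sxc(M_{n,2d}) = ∞); otherwise, sxdeg(M_{n,2d}) = sxc(M_{n,2d}) = C(n+d,n). -/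
open MvPolynomial

/-- The linear functional on moment sequences given by a polynomial. -/
noncomputable def momentEval {n : ℕ} (p : MvPolynomial (Fin n) ℝ) :
    ((Fin n →₀ ℕ) → ℝ) →ₗ[ℝ] ℝ :=
  ∑ a ∈ p.support, coeff a p • LinearMap.proj a

section MomentEval

variable {n : ℕ}

theorem momentEval_apply (p : MvPolynomial (Fin n) ℝ) (y : (Fin n →₀ ℕ) → ℝ) :
    momentEval p y = ∑ a ∈ p.support, coeff a p * y a := by
  simp [momentEval, LinearMap.sum_apply]

theorem continuous_momentEval (p : MvPolynomial (Fin n) ℝ) : Continuous (momentEval p) := by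
  have : (momentEval p : ((Fin n →₀ ℕ) → ℝ) → ℝ) =
      fun y => ∑ a ∈ p.support, coeff a p * y a := funext (momentEval_apply p)
  rw [this]
  fun_prop

theorem momentEval_monVec {p : MvPolynomial (Fin n) ℝ} {D : ℕ} (hp : p.totalDegree ≤ D)
    (x : Fin n → ℝ) : momentEval p (monVec n D x) = eval x p := by
  rw [momentEval_apply, eval_eq']
  refine Finset.sum_congr rfl fun a ha => ?_
  rw [monVec, if_pos ((le_totalDegree ha).trans hp)]

theorem momentEval_nonneg {p : MvPolynomial (Fin n) ℝ} {D : ℕ} (hp : p.totalDegree ≤ D)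
    (hpos : ∀ x, 0 ≤ eval x p) {y : (Fin n →₀ ℕ) → ℝ}
    (hy : y ∈ closure (coneHull (Set.range (monVec n D)))) : 0 ≤ momentEval p y := by
  have hcl : IsClosed {y | 0 ≤ momentEval p y} :=
    isClosed_le continuous_const (continuous_momentEval p)
  refine closure_minimal ?_ hcl hy
  rintro _ ⟨r, c, v, hc, hv, rfl⟩
  simp only [Set.mem_ofPred_eq, map_sum, map_smul, smul_eq_mul]
  refine Finset.sum_nonneg fun i _ => mul_nonneg (hc i) ?_
  obtain ⟨x, hx⟩ := hv i
  rw [← hx, momentEval_monVec hp]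
  exact hpos x

theorem monVec_mem_closure (D : ℕ) (x : Fin n → ℝ) :
    monVec n D x ∈ closure (coneHull (Set.range (monVec n D))) :=
  subset_closure ⟨1, fun _ => 1, fun _ => monVec n D x, fun _ => zero_le_one,
    fun _ => ⟨x, rfl⟩, by simp⟩

theorem zero_mem_closure_coneHull (D : ℕ) :
    (0 : (Fin n →₀ ℕ) → ℝ) ∈ closure (coneHull (Set.range (monVec n D))) :=
  subset_closure ⟨0, fun _ => 0, fun _ => 0, fun i => i.elim0, fun i => i.elim0, by simp⟩

end MomentEval

/-- The exponents of the monomials of degree at most `d` in `n` variables. -/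
def lowExponents (n d : ℕ) : Finset (Fin n →₀ ℕ) :=
  (Finset.range (d + 1)).biUnion fun m => Finset.finsuppAntidiag Finset.univ m

theorem mem_lowExponents {n d : ℕ} {a : Fin n →₀ ℕ} :
    a ∈ lowExponents n d ↔ (a.sum fun _ e => e) ≤ d := by
  simp [lowExponents, Finset.mem_finsuppAntidiag, Finsupp.sum_fintype]

theorem card_lowExponents (n d : ℕ) : (lowExponents n d).card = (n + d).choose n := by
  have h : (lowExponents n d).card = Nat.multichoose (n + 1) d := by
    rw [lowExponents, Finset.card_biUnion]
    · induction d with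
      | zero => simp [Finset.card_finsuppAntidiag_nat_eq_multichoose]
      | succ d ih =>
        rw [Finset.sum_range_succ, ih, Finset.card_finsuppAntidiag_nat_eq_multichoose,
          Nat.multichoose_succ_succ, add_comm]
        simp
    · intro i _ j _ hij
      rw [Function.onFun, Finset.disjoint_left]
      intro a ha hb
      rw [Finset.mem_finsuppAntidiag] at ha hb
      exact hij (ha.1.symm.trans hb.1)
  rw [h, Nat.multichoose_eq, show n + 1 + d - 1 = n + d by omega]
  exact (Nat.choose_symm_of_eq_add (by omega)).symm

section PosSemidef

open Matrix
open scoped MatrixOrder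

theorem Matrix.PosSemidef.exists_eq_transpose_mul {ι : Type*} [Fintype ι]
    {A : Matrix ι ι ℝ} (hA : A.PosSemidef) : ∃ G : Matrix ι ι ℝ, A = Gᵀ * G := by
  classical
  obtain ⟨G, hG⟩ := CStarAlgebra.nonneg_iff_eq_star_mul_self.1 (nonneg_iff_posSemidef.2 hA)
  exact ⟨G, by rw [hG, star_eq_conjTranspose, conjTranspose_eq_transpose_of_trivial]⟩

theorem Matrix.posSemidef_iff_real {ι : Type*} [Fintype ι] {A : Matrix ι ι ℝ} :
    A.PosSemidef ↔ Aᵀ = A ∧ ∀ v, 0 ≤ v ⬝ᵥ A *ᵥ v := by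
  constructor
  · intro h
    exact ⟨by simpa [IsHermitian, conjTranspose_eq_transpose_of_trivial] using h.1,
      fun v => by simpa using h.dotProduct_mulVec_nonneg v⟩
  · rintro ⟨h1, h2⟩
    exact PosSemidef.of_dotProduct_mulVec_nonneg
      (by simpa [IsHermitian, conjTranspose_eq_transpose_of_trivial] using h1)
      (fun v => by simpa using h2 v)

theorem LinearMap.exists_comp_eq_of_ker_le {V W X : Type*} [AddCommGroup V] [Module ℝ V]
    [AddCommGroup W] [Module ℝ W] [AddCommGroup X] [Module ℝ X] (g : V →ₗ[ℝ] W) (r : V →ₗ[ℝ] X)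
    (h : LinearMap.ker g ≤ LinearMap.ker r) : ∃ t : W →ₗ[ℝ] X, t ∘ₗ g = r := by
  obtain ⟨t, ht⟩ := LinearMap.exists_extend
    ((LinearMap.ker g).liftQ r h ∘ₗ g.quotKerEquivRange.symm.toLinearMap)
  refine ⟨t, LinearMap.ext fun v => ?_⟩
  have h1 : t (g v) = (t ∘ₗ (LinearMap.range g).subtype) ⟨g v, v, rfl⟩ := rfl
  have h2 : g.quotKerEquivRange.symm ⟨g v, v, rfl⟩ = (LinearMap.ker g).mkQ v := by
    rw [LinearEquiv.symm_apply_eq]; rfl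
  rw [LinearMap.comp_apply, h1, ht, LinearMap.comp_apply, LinearEquiv.coe_coe, h2]
  rfl

theorem Matrix.dotProduct_mulVec_self_le {ι κ : Type*} [Fintype ι] [Fintype κ]
    (T : Matrix ι κ ℝ) (w : κ → ℝ) :
    (T *ᵥ w) ⬝ᵥ (T *ᵥ w) ≤ (∑ i, ∑ j, T i j ^ 2) * (w ⬝ᵥ w) := by
  rw [Finset.sum_mul]
  refine Finset.sum_le_sum fun i _ => ?_
  have := Finset.sum_mul_sq_le_sq_mul_sq Finset.univ (T i) w
  simpa [mulVec, dotProduct, pow_two] using this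

theorem Matrix.dotProduct_transpose_mul_self {ι κ : Type*} [Fintype ι] [Fintype κ]
    (G : Matrix ι κ ℝ) (v : κ → ℝ) : v ⬝ᵥ (Gᵀ * G) *ᵥ v = (G *ᵥ v) ⬝ᵥ (G *ᵥ v) := by
  rw [← mulVec_mulVec, dotProduct_mulVec, vecMul_transpose]

/-- If `ker P ⊆ ker Q` for positive semidefinite `P, Q` then `P - δ Q` is positive semidefinite
for all small `δ > 0`. -/
theorem Matrix.PosSemidef.exists_sub_smul {k : ℕ} {P Q : Matrix (Fin k) (Fin k) ℝ}
    (hP : P.PosSemidef) (hQ : Q.PosSemidef) (h : ∀ v, P *ᵥ v = 0 → Q *ᵥ v = 0) :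
    ∃ ε > (0 : ℝ), ∀ δ : ℝ, 0 ≤ δ → δ ≤ ε → (P - δ • Q).PosSemidef := by
  obtain ⟨G, rfl⟩ := hP.exists_eq_transpose_mul
  obtain ⟨R, rfl⟩ := hQ.exists_eq_transpose_mul
  have hker : LinearMap.ker (Matrix.toLin' G) ≤ LinearMap.ker (Matrix.toLin' R) := by
    intro v hv
    simp only [LinearMap.mem_ker, Matrix.toLin'_apply] at hv ⊢
    have h1 := h v (by rw [← Matrix.mulVec_mulVec, hv, Matrix.mulVec_zero])
    have h2 := dotProduct_transpose_mul_self R v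
    rw [h1, dotProduct_zero] at h2
    exact dotProduct_self_eq_zero.1 h2.symm
  obtain ⟨t, ht⟩ := LinearMap.exists_comp_eq_of_ker_le _ _ hker
  have hT : ∀ v, R *ᵥ v = LinearMap.toMatrix' t *ᵥ (G *ᵥ v) := by
    intro v
    have := LinearMap.congr_fun ht v
    rw [LinearMap.toMatrix'_mulVec]
    simpa using this.symm
  set T := LinearMap.toMatrix' t
  set c := ∑ i, ∑ j, T i j ^ 2
  have hc : 0 ≤ c := Finset.sum_nonneg fun i _ => Finset.sum_nonneg fun j _ => sq_nonneg _
  refine ⟨(c + 1)⁻¹, by positivity, fun δ h0 hδ => posSemidef_iff_real.2 ⟨?_, fun v => ?_⟩⟩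
  · simp
  · rw [sub_mulVec, smul_mulVec, dotProduct_sub, dotProduct_smul, dotProduct_transpose_mul_self,
      dotProduct_transpose_mul_self, hT, smul_eq_mul, sub_nonneg]
    have h1 := dotProduct_mulVec_self_le T (G *ᵥ v)
    have h2 : 0 ≤ (G *ᵥ v) ⬝ᵥ (G *ᵥ v) :=
      Finset.sum_nonneg fun i _ => mul_self_nonneg _
    have h3 : δ * (c + 1) ≤ 1 := by
      calc δ * (c + 1) ≤ (c + 1)⁻¹ * (c + 1) := by gcongr
        _ = 1 := inv_mul_cancel₀ (by positivity)
    calc _ ≤ δ * (c * ((G *ᵥ v) ⬝ᵥ (G *ᵥ v))) := by gcongr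
      _ ≤ δ * ((c + 1) * ((G *ᵥ v) ⬝ᵥ (G *ᵥ v))) := by gcongr; linarith
      _ = (δ * (c + 1)) * ((G *ᵥ v) ⬝ᵥ (G *ᵥ v)) := by ring
      _ ≤ 1 * ((G *ᵥ v) ⬝ᵥ (G *ᵥ v)) := by gcongr
      _ = _ := one_mul _

end PosSemidef

section LowerBound

/-- A set of points is polynomially dense if only the zero polynomial vanishes on it. -/
def PolyDense {n : ℕ} (S : Set (Fin n → ℝ)) : Prop :=
  ∀ p : MvPolynomial (Fin n) ℝ, (∀ x ∈ S, eval x p = 0) → p = 0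

theorem PolyDense.univ {n : ℕ} : PolyDense (Set.univ : Set (Fin n → ℝ)) := fun p hp =>
  MvPolynomial.funext fun x => by simpa using hp x trivial

theorem not_polyDense_iUnion {n : ℕ} {ι : Type*} [Fintype ι] {S : ι → Set (Fin n → ℝ)}
    (h : ∀ i, ¬ PolyDense (S i)) : ¬ PolyDense (⋃ i, S i) := by
  simp only [PolyDense, not_forall] at h
  choose p hp hp0 using h
  intro hd
  refine Finset.prod_ne_zero_iff.2 (fun i _ => hp0 i) (hd (∏ i, p i) fun x hx => ?_)
  obtain ⟨i, hi⟩ := Set.mem_iUnion.1 hx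
  rw [map_prod]
  exact Finset.prod_eq_zero (Finset.mem_univ i) (hp i x hi)

theorem PolyDense.exists_mem_forall_notMem {n : ℕ} {ι : Type*} [Fintype ι]
    {S : Set (Fin n → ℝ)} (hS : PolyDense S) {B : ι → Set (Fin n → ℝ)}
    (h : ∀ i, ¬ PolyDense (B i)) : ∃ x ∈ S, ∀ i, x ∉ B i := by
  by_contra! hc
  refine not_polyDense_iUnion h fun p hp => hS p fun x hx => ?_
  obtain ⟨i, hi⟩ := hc x hx
  exact hp x (Set.mem_iUnion.2 ⟨i, hi⟩)

/-- A family of subspaces of `ℝᵏ` indexed by points of `ℝⁿ` has a polynomially dense set `S`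
and at most `k` points of `S` whose subspaces have an intersection contained in all subspaces
indexed by `S`. -/
theorem exists_polyDense_finset {n k m : ℕ}
    (κ : (Fin n → ℝ) → Fin m → Submodule ℝ (Fin k → ℝ)) :
    ∃ (S : Set (Fin n → ℝ)) (T : Finset (Fin n → ℝ)), PolyDense S ∧ T.card ≤ k ∧
      ∀ x ∈ S, ∀ l, ⨅ z ∈ T, κ z l ≤ κ x l := by
  classical
  set W : Set (Fin n → ℝ) → Fin m → Submodule ℝ (Fin k → ℝ) := fun S l => ⨅ x ∈ S, κ x l
  have hbound : ∀ S, ∑ l, Module.finrank ℝ (W S l) ≤ m * k := fun S => by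
    refine (Finset.sum_le_card_nsmul _ _ k fun l _ => ?_).trans (by simp)
    exact (Submodule.finrank_le _).trans (by simp)
  obtain ⟨S, hS, hmax⟩ : ∃ S, PolyDense S ∧ ∀ S', PolyDense S' →
      ∑ l, Module.finrank ℝ (W S' l) ≤ ∑ l, Module.finrank ℝ (W S l) := by
    have hne : ({c | ∃ S, PolyDense S ∧ ∑ l, Module.finrank ℝ (W S l) = c} : Set ℕ).Nonempty :=
      ⟨_, Set.univ, PolyDense.univ, rfl⟩
    have hbdd : BddAbove {c | ∃ S, PolyDense S ∧ ∑ l, Module.finrank ℝ (W S l) = c} :=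
      ⟨m * k, by rintro _ ⟨S, -, rfl⟩; exact hbound S⟩
    obtain ⟨S, hS, hc⟩ := Nat.sSup_mem hne hbdd
    exact ⟨S, hS, fun S' hS' => hc ▸ le_csSup hbdd ⟨S', hS', rfl⟩⟩
  have hstable : ∀ S' ⊆ S, PolyDense S' → ∀ l, W S' l = W S l := by
    intro S' hsub hd l
    have hle : ∀ l, W S l ≤ W S' l := fun l => biInf_mono hsub
    have hle' : ∀ l ∈ Finset.univ, Module.finrank ℝ (W S l) ≤ Module.finrank ℝ (W S' l) :=
      fun l _ => Submodule.finrank_mono (hle l)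
    have := (Finset.sum_eq_sum_iff_of_le hle').1
      (le_antisymm (Finset.sum_le_sum hle') (hmax S' hd)) l (Finset.mem_univ l)
    exact (Submodule.eq_of_le_of_finrank_eq (hle l) this).symm
  have hgreedy : ∀ j : ℕ, ∃ T : Finset (Fin n → ℝ), T.card ≤ j ∧
      ∀ l, ⨅ z ∈ T, κ z l ≤ W S l ∨ Module.finrank ℝ (⨅ z ∈ T, κ z l : Submodule ℝ _) + j ≤ k := by
    intro j
    induction j with
    | zero =>
      refine ⟨∅, by simp, fun l => Or.inr ?_⟩
      exact (Submodule.finrank_le _).trans (by simp)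
    | succ j ih =>
      obtain ⟨T, hT, hl⟩ := ih
      obtain ⟨x, hx, hxB⟩ := hS.exists_mem_forall_notMem
        (B := fun l => {x ∈ S | ¬ (⨅ z ∈ T, κ z l) ≤ W S l ∧ (⨅ z ∈ T, κ z l) ≤ κ x l}) (by
          intro l hd
          have hW := hstable _ (Set.sep_subset _ _) hd l
          by_cases hle : (⨅ z ∈ T, κ z l) ≤ W S l
          · exact one_ne_zero (hd 1 fun x hx => absurd hle hx.2.1)
          · exact hle (hW ▸ le_iInf₂ fun x hx => hx.2.2))
      refine ⟨insert x T, (Finset.card_insert_le _ _).trans (by omega), fun l => ?_⟩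
      rw [Finset.iInf_insert]
      rcases hl l with h | h
      · exact Or.inl (inf_le_right.trans h)
      · by_cases hle : (⨅ z ∈ T, κ z l) ≤ W S l
        · exact Or.inl (inf_le_right.trans hle)
        · right
          have hlt : κ x l ⊓ (⨅ z ∈ T, κ z l) < ⨅ z ∈ T, κ z l :=
            lt_of_le_of_ne inf_le_right fun heq => hxB l ⟨hx, hle, inf_eq_right.1 heq⟩
          have := Submodule.finrank_lt_finrank_of_lt hlt
          omega
  obtain ⟨T, hT, hl⟩ := hgreedy k
  refine ⟨S, T, hS, hT, fun x hx l => ?_⟩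
  have hW : W S l ≤ κ x l := biInf_le (fun x => κ x l) hx
  rcases hl l with h | h
  · exact h.trans hW
  · have : Module.finrank ℝ (⨅ z ∈ T, κ z l : Submodule ℝ _) = 0 := by omega
    rw [Submodule.finrank_eq_zero.1 this]
    exact bot_le

end LowerBound

section LowPoly

variable {n : ℕ}

/-- The polynomial of degree at most `d` with given coefficients. -/
noncomputable def lowPoly (n d : ℕ) : (lowExponents n d → ℝ) →ₗ[ℝ] MvPolynomial (Fin n) ℝ :=
  Fintype.linearCombination ℝ fun a => monomial a.1 1

theorem lowPoly_apply (d : ℕ) (c : lowExponents n d → ℝ) :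
    lowPoly n d c = ∑ a, monomial a.1 (c a) := by
  simp [lowPoly, Fintype.linearCombination_apply, smul_monomial]

theorem coeff_lowPoly (d : ℕ) (c : lowExponents n d → ℝ) (a : lowExponents n d) :
    coeff a.1 (lowPoly n d c) = c a := by
  classical
  simp [lowPoly_apply, coeff_sum, coeff_monomial]

theorem totalDegree_lowPoly_le (d : ℕ) (c : lowExponents n d → ℝ) :
    (lowPoly n d c).totalDegree ≤ d := by
  rw [lowPoly_apply]
  refine (totalDegree_finsetSum _ _).trans (Finset.sup_le fun a _ => ?_)
  exact (totalDegree_monomial_le _ _).trans (mem_lowExponents.1 a.2)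

theorem lowPoly_coeff {d : ℕ} {p : MvPolynomial (Fin n) ℝ} (hp : p.totalDegree ≤ d) :
    lowPoly n d (fun a => coeff a.1 p) = p := by
  classical
  rw [lowPoly_apply, Finset.sum_coe_sort (lowExponents n d) fun a => monomial a (coeff a p)]
  conv_rhs => rw [p.as_sum]
  symm
  refine Finset.sum_subset (fun a ha => mem_lowExponents.2 ((le_totalDegree ha).trans hp)) ?_
  intro a _ ha
  rw [notMem_support_iff.1 ha, monomial_zero]

theorem lowPoly_injective (d : ℕ) : Function.Injective (lowPoly n d) := fun c c' h => by
  funext a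
  rw [← coeff_lowPoly d c a, h, coeff_lowPoly]

theorem exists_ne_zero_eval_eq_zero {d : ℕ} {T : Finset (Fin n → ℝ)}
    (hT : T.card < (n + d).choose n) :
    ∃ f : MvPolynomial (Fin n) ℝ, f ≠ 0 ∧ f.totalDegree ≤ d ∧ ∀ x ∈ T, eval x f = 0 := by
  let Φ : (lowExponents n d → ℝ) →ₗ[ℝ] (T → ℝ) :=
    LinearMap.pi fun x => (aeval x.1).toLinearMap ∘ₗ lowPoly n d
  obtain ⟨c, hc, hc0⟩ := (Submodule.ne_bot_iff _).1
    (LinearMap.ker_ne_bot_of_finrank_lt (f := Φ) (by simpa [card_lowExponents] using hT))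
  refine ⟨lowPoly n d c, fun h => hc0 (lowPoly_injective d (by simpa using h)),
    totalDegree_lowPoly_le d c, fun x hx => ?_⟩
  simpa [Φ, coe_aeval_eq_eval] using congrFun (LinearMap.mem_ker.1 hc) ⟨x, hx⟩

end LowPoly

section LowerBound

open Matrix

/-- Every lift of the moment cone of degree `2 * d` by tuples of `k × k` positive semidefinite
matrices has `k ≥ (n + d).choose n`. -/
theorem choose_le_of_hasLift {n d k m : ℕ}
    (h : HasLift (PSDTuple k m) (closure (coneHull (Set.range (monVec n (2 * d)))))) :
    (n + d).choose n ≤ k := by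
  classical
  obtain ⟨H, p, hM⟩ := h
  have hpre : ∀ y ∈ closure (coneHull (Set.range (monVec n (2 * d)))),
      ∃ Z, Z ∈ PSDTuple k m ∧ Z ∈ H ∧ p Z = y := by
    intro y hy
    rw [hM] at hy
    obtain ⟨Z, hZ, rfl⟩ := hy
    exact ⟨Z, hZ.1, hZ.2, rfl⟩
  choose A hA hAH hpA using fun x => hpre _ (monVec_mem_closure (n := n) (2 * d) x)
  obtain ⟨A₀, hA₀, hA₀H, hpA₀⟩ := hpre _ (zero_mem_closure_coneHull (n := n) (2 * d))
  by_contra! hk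
  obtain ⟨S, T, hS, hT, hST⟩ :=
    exists_polyDense_finset fun x l => LinearMap.ker (Matrix.toLin' (A x l))
  obtain ⟨f, hf0, hfd, hfT⟩ := exists_ne_zero_eval_eq_zero (hT.trans_lt hk)
  obtain ⟨j, hj, hfj⟩ : ∃ j ∈ S, eval j f ≠ 0 := by
    by_contra! hc
    exact hf0 (hS f hc)
  have hf2 : (f ^ 2).totalDegree ≤ 2 * d := (totalDegree_pow _ _).trans (by omega)
  have heval : ∀ x, momentEval (f ^ 2) (p (A x)) = eval x f ^ 2 := fun x => by
    rw [hpA, momentEval_monVec hf2, map_pow]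
  have hpsum : ∀ l, (∑ x ∈ T, A x l).PosSemidef := fun l =>
    Matrix.posSemidef_sum _ fun x _ => hA x l
  have hev : ∀ᶠ δ in nhdsWithin (0 : ℝ) (Set.Ioi 0), ∀ l : Fin m,
      ((∑ x ∈ T, A x l) - δ • A j l).PosSemidef := by
    refine Filter.eventually_all.2 fun l => ?_
    obtain ⟨ε, hε, hεl⟩ := (hpsum l).exists_sub_smul (hA j l) (by
      intro v hv
      have hmem : v ∈ ⨅ z ∈ T, LinearMap.ker (Matrix.toLin' (A z l)) := by
        simp only [Submodule.mem_iInf, LinearMap.mem_ker, Matrix.toLin'_apply]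
        intro z hz
        have h0 : ∑ x ∈ T, v ⬝ᵥ A x l *ᵥ v = 0 := by
          rw [← dotProduct_sum, ← Matrix.sum_mulVec, hv, dotProduct_zero]
        have h1 := (Finset.sum_eq_zero_iff_of_nonneg fun x _ =>
          (Matrix.posSemidef_iff_real.1 (hA x l)).2 v).1 h0 z hz
        exact (hA z l).dotProduct_mulVec_zero_iff v |>.1 (by simpa using h1)
      simpa using hST j hj l hmem)
    filter_upwards [Ioc_mem_nhdsGT hε] with δ hδ using hεl δ hδ.1.le hδ.2
  obtain ⟨δ, hδ, hδ0⟩ := (hev.and self_mem_nhdsWithin).exists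
  have hδ0 : 0 < δ := hδ0
  set c : ℝ := ((T.card : ℝ) + 1)⁻¹
  have hc : 0 < c := by positivity
  have hcT : c * T.card ≤ 1 := by
    rw [inv_mul_le_iff₀ (by positivity)]; linarith
  set Z : Fin m → Matrix (Fin k) (Fin k) ℝ :=
    c • (∑ x ∈ T, (A x - A₀) - δ • (A j - A₀)) + A₀ with hZ
  have hZH : Z ∈ H := by
    refine AffineSubspace.vadd_mem_of_mem_direction (s := H) ?_ hA₀H
    refine H.direction.smul_mem _ (H.direction.sub_mem (H.direction.sum_mem fun x _ => ?_)
      (H.direction.smul_mem _ ?_))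
    · exact AffineSubspace.vsub_mem_direction (hAH x) hA₀H
    · exact AffineSubspace.vsub_mem_direction (hAH j) hA₀H
  have hZp : Z ∈ PSDTuple k m := by
    intro l
    have : Z l = c • ((∑ x ∈ T, A x l) - δ • A j l) + ((1 - c * T.card) + c * δ) • A₀ l := by
      rw [hZ]
      simp only [Finset.sum_sub_distrib, Finset.sum_const, Pi.add_apply, Pi.smul_apply,
        Pi.sub_apply, Finset.sum_apply, ← Nat.cast_smul_eq_nsmul ℝ]
      module
    rw [this]
    exact ((hδ l).smul hc.le).add ((hA₀ l).smul (by nlinarith [mul_pos hc hδ0]))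
  have hpos := momentEval_nonneg hf2 (fun x => by rw [map_pow]; positivity)
    (y := p Z) (by rw [hM]; exact ⟨Z, ⟨hZp, hZH⟩, rfl⟩)
  have h0 : ∑ x ∈ T, eval x f ^ 2 = 0 := Finset.sum_eq_zero fun x hx => by rw [hfT x hx]; simp
  rw [hZ] at hpos
  simp only [map_add, map_smul, map_sub, map_sum, hpA₀, heval, sub_zero, h0,
    smul_eq_mul, zero_sub, add_zero] at hpos
  have : 0 < eval j f ^ 2 := by positivity
  nlinarith [mul_pos hc (mul_pos hδ0 this)]

end LowerBound

section TaylorHom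

open scoped IntermediateField.algebraAdjoinAdjoin

theorem Algebra.FormallySmooth.exists_ringHom_extend {R A S : Type*} [CommRing R] [CommRing A]
    [CommRing S] [Algebra R A] [Algebra.FormallySmooth R A] (I : Ideal S) [IsAdicComplete I S]
    (g : R →+* S) (h : A →+* S ⧸ I)
    (hgh : h.comp (algebraMap R A) = (Ideal.Quotient.mk I).comp g) :
    ∃ τ : A →+* S, τ.comp (algebraMap R A) = g := by
  let _ : Algebra R S := g.toAlgebra
  let f : A →ₐ[R] S ⧸ I := { h with commutes' := fun r => DFunLike.congr_fun hgh r }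
  obtain ⟨τ, -⟩ := Algebra.FormallySmooth.exists_mkₐ_comp_eq_of_isAdicComplete f
  exact ⟨τ, RingHom.ext fun r => τ.commutes r⟩

theorem IsTranscendenceBasis.infinite_real {k₀ : Subfield ℝ} [Countable k₀] {ι : Type}
    {v : ι → ℝ} (hv : IsTranscendenceBasis k₀ v) : Infinite ι := by
  by_contra hfin
  rw [not_infinite_iff_finite] at hfin
  have h1 : Countable (MvPolynomial ι k₀) := by
    rw [← Cardinal.mk_le_aleph0_iff]
    exact MvPolynomial.cardinalMk_le_max.trans
      (max_le (max_le (Cardinal.mk_le_aleph0) Cardinal.mk_le_aleph0) le_rfl)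
  have h2 : Countable (Algebra.adjoin k₀ (Set.range v)) :=
    hv.1.aevalEquiv.toEquiv.countable_iff.1 h1
  have h3 : Algebra.IsAlgebraic (Algebra.adjoin k₀ (Set.range v)) ℝ := hv.isAlgebraic
  have h4 := Algebra.IsAlgebraic.cardinalMk_le_max (Algebra.adjoin k₀ (Set.range v)) ℝ
  have h5 : Cardinal.mk ℝ ≤ Cardinal.aleph0 := h4.trans (max_le Cardinal.mk_le_aleph0 le_rfl)
  exact not_countable (α := ℝ) (Cardinal.mk_le_aleph0_iff.1 h5)

/-- There are a point `x` and a ring homomorphism from `ℝ` to formal power series which is the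
identity on a given countable subfield and which maps the coordinates of `x` to their
translates by the variables. -/
theorem exists_taylorHom (n : ℕ) (k₀ : Subfield ℝ) [Countable k₀] :
    ∃ (x : Fin n → ℝ) (τ : ℝ →+* MvPowerSeries (Fin n) ℝ),
      (∀ c ∈ k₀, τ c = MvPowerSeries.C c) ∧
      ∀ i, τ (x i) = MvPowerSeries.C (x i) + MvPowerSeries.X i := by
  classical
  obtain ⟨s, hs⟩ := exists_isTranscendenceBasis k₀ ℝ
  have hinf := hs.infinite_real
  set v : s → ℝ := (↑)
  let e : Fin n ↪ s := (Fin.valEmbedding).trans (Infinite.natEmbedding s)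
  have hsm : Algebra.FormallySmooth (Algebra.adjoin k₀ (Set.range v)) ℝ := by
    have h0 : Algebra.FormallySmooth (Algebra.adjoin k₀ (Set.range v))
        (IntermediateField.adjoin k₀ (Set.range v)) := .of_isLocalization (nonZeroDivisors _)
    have hsep : Algebra.IsAlgebraic (IntermediateField.adjoin k₀ (Set.range v)) ℝ :=
      hs.isAlgebraic_field
    have h1 : Algebra.FormallyEtale (IntermediateField.adjoin k₀ (Set.range v)) ℝ :=
      Algebra.FormallyEtale.of_isSeparable _ ℝ
    exact .comp _ (IntermediateField.adjoin k₀ (Set.range v)) _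
  let w : s → MvPowerSeries (Fin n) ℝ := fun j => MvPowerSeries.C (v j) +
    ∑ i, if e i = j then MvPowerSeries.X i else 0
  let g₀ : MvPolynomial s k₀ →+* MvPowerSeries (Fin n) ℝ :=
    eval₂Hom ((MvPowerSeries.C).comp k₀.subtype) w
  let g : Algebra.adjoin k₀ (Set.range v) →+* MvPowerSeries (Fin n) ℝ :=
    g₀.comp (hs.1.aevalEquiv.symm : _ ≃+* MvPolynomial s k₀).toRingHom
  let I : Ideal (MvPowerSeries (Fin n) ℝ) := .span (.range MvPowerSeries.X)
  obtain ⟨τ, hτ⟩ := Algebra.FormallySmooth.exists_ringHom_extend (A := ℝ) I g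
    ((Ideal.Quotient.mk I).comp MvPowerSeries.C) (by
      have key : ((Ideal.Quotient.mk I).comp MvPowerSeries.C).comp
          (aeval v : MvPolynomial s k₀ →ₐ[k₀] ℝ).toRingHom = (Ideal.Quotient.mk I).comp g₀ := by
        refine MvPolynomial.ringHom_ext (fun c => ?_) fun j => ?_
        · simp [g₀]; rfl
        · have : Ideal.Quotient.mk I (∑ i, if e i = j then MvPowerSeries.X i else 0) = 0 := by
            refine Ideal.Quotient.eq_zero_iff_mem.2 (Ideal.sum_mem _ fun i _ => ?_)
            split_ifs
            · exact Ideal.subset_span ⟨i, rfl⟩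
            · exact zero_mem _
          rw [map_sum] at this
          simp [g₀, w, this]
      refine RingHom.ext fun b => ?_
      obtain ⟨p, rfl⟩ := hs.1.aevalEquiv.surjective b
      have := DFunLike.congr_fun key p
      simpa [g] using this)
  have hτ' : ∀ p : MvPolynomial s k₀, τ (aeval v p) = g₀ p := fun p => by
    have := DFunLike.congr_fun hτ (hs.1.aevalEquiv p)
    simpa [g] using this
  refine ⟨fun i => v (e i), τ, fun c hc => ?_, fun i => ?_⟩
  · have := hτ' (C ⟨c, hc⟩)
    rw [MvPolynomial.algHom_C] at this
    simpa [g₀] using! this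
  · have := hτ' (X (e i))
    simpa [g₀, w] using this

end TaylorHom

section SosLimit

open Filter Topology

variable {n : ℕ}

theorem continuous_coeff_lowPoly_sq (D : ℕ) (a : Fin n →₀ ℕ) :
    Continuous fun c : lowExponents n D → ℝ => coeff a (lowPoly n D c ^ 2) := by
  classical
  simp only [pow_two, coeff_mul]
  have hc : ∀ b, Continuous fun c : lowExponents n D → ℝ => coeff b (lowPoly n D c) := fun b =>
    ((lcoeff ℝ b) ∘ₗ lowPoly n D).continuous_of_finiteDimensional
  exact continuous_finsetSum _ fun x _ => (hc x.1).mul (hc x.2)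

theorem eq_zero_of_sum_sq_eq_zero {J : Type*} [Fintype J] {q : J → MvPolynomial (Fin n) ℝ}
    (h : ∑ j, q j ^ 2 = 0) (j : J) : q j = 0 := by
  refine MvPolynomial.funext fun x => ?_
  have h1 := congrArg (eval x) h
  simp only [map_sum, map_pow, map_zero] at h1 ⊢
  exact pow_eq_zero_iff two_ne_zero |>.1
    ((Finset.sum_eq_zero_iff_of_nonneg fun j _ => sq_nonneg _).1 h1 j (Finset.mem_univ j))

/-- A polynomial whose coefficients are approximated by those of sums of squares of a fixed
number of polynomials of degree at most `2 * s`, with negligible part in degrees larger than `s`,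
is a sum of squares. -/
theorem exists_eq_sum_sq_of_tendsto {s : ℕ} {J : Type*} [Fintype J]
    {p : MvPolynomial (Fin n) ℝ} (hp : p.totalDegree ≤ 2 * s)
    (g : ℕ → J → lowExponents n (2 * s) → ℝ) (ε : ℕ → ℝ) (hε : Tendsto ε atTop (𝓝 0))
    (htail : ∀ N j b, s < (b.1.sum fun _ e => e) → |g N j b| ≤ ε N * ‖g N‖)
    (hlim : ∀ a ∈ lowExponents n (2 * s),
      Tendsto (fun N => ∑ j, coeff a (lowPoly n (2 * s) (g N j) ^ 2)) atTop (𝓝 (coeff a p))) :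
    ∃ q : J → MvPolynomial (Fin n) ℝ, p = ∑ j, q j ^ 2 := by
  classical
  set L : ℕ → ℝ := fun N => max 1 ‖g N‖
  have hL : ∀ N, 1 ≤ L N := fun N => le_max_left _ _
  have hL0 : ∀ N, 0 < L N := fun N => one_pos.trans_le (hL N)
  set u : ℕ → J → lowExponents n (2 * s) → ℝ := fun N => (L N)⁻¹ • g N
  have hnorm : ∀ N, ‖u N‖ = (L N)⁻¹ * ‖g N‖ := fun N => by
    rw [norm_smul, Real.norm_of_nonneg (inv_nonneg.2 (hL0 N).le)]
  have hu : ∀ N, ‖u N‖ ≤ 1 := fun N => by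
    rw [hnorm, inv_mul_le_iff₀ (hL0 N), mul_one]
    exact le_max_right _ _
  have hcomp : IsCompact (Metric.closedBall (0 : J → lowExponents n (2 * s) → ℝ) 1 ×ˢ
      Set.Icc (0 : ℝ) 1) := (isCompact_closedBall _ _).prod isCompact_Icc
  obtain ⟨⟨v, θ⟩, hv, φ, hφ, hconv⟩ := hcomp.tendsto_subseq
    (x := fun N => (u N, (L N)⁻¹)) fun N =>
      ⟨by simpa using hu N, inv_nonneg.2 (hL0 N).le, inv_le_one_of_one_le₀ (hL N)⟩
  have hconvu : Tendsto (fun N => u (φ N)) atTop (𝓝 v) := (continuous_fst.tendsto _).comp hconv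
  have hconvuj : ∀ j, Tendsto (fun N => u (φ N) j) atTop (𝓝 (v j)) := tendsto_pi_nhds.1 hconvu
  have hconvθ : Tendsto (fun N => (L (φ N))⁻¹) atTop (𝓝 θ) :=
    (continuous_snd.tendsto _).comp hconv
  have hvtail : ∀ j b, s < (b.1.sum fun _ e => e) → v j b = 0 := by
    intro j b hb
    have h1 : Tendsto (fun N => |u (φ N) j b|) atTop (𝓝 |v j b|) :=
      (tendsto_pi_nhds.1 (hconvuj j) b).abs
    have h2 : Tendsto (fun N => ‖ε (φ N)‖) atTop (𝓝 0) := by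
      simpa using (hε.comp hφ.tendsto_atTop).norm
    refine abs_eq_zero.1 (le_antisymm (le_of_tendsto_of_tendsto' h1 h2 fun N => ?_)
      (abs_nonneg _))
    have h3 := htail (φ N) j b hb
    have h4 : |u (φ N) j b| = (L (φ N))⁻¹ * |g (φ N) j b| := by
      simp only [u, Pi.smul_apply, smul_eq_mul, abs_mul, abs_of_pos (inv_pos.2 (hL0 (φ N)))]
    calc |u (φ N) j b| ≤ (L (φ N))⁻¹ * (ε (φ N) * ‖g (φ N)‖) := by
          rw [h4]; exact mul_le_mul_of_nonneg_left h3 (inv_nonneg.2 (hL0 _).le)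
      _ = ε (φ N) * ‖u (φ N)‖ := by rw [hnorm]; ring
      _ ≤ ‖ε (φ N)‖ * ‖u (φ N)‖ := by gcongr; exact Real.le_norm_self _
      _ ≤ ‖ε (φ N)‖ * 1 := by gcongr; exact hu _
      _ = _ := mul_one _
  set q : J → MvPolynomial (Fin n) ℝ := fun j => lowPoly n (2 * s) (v j)
  have hq : ∀ j, (q j).totalDegree ≤ s := by
    intro j
    rw [totalDegree]
    refine Finset.sup_le fun a ha => ?_
    by_contra! hb
    have ha' := ha
    rw [mem_support_iff] at ha
    have haD : a ∈ lowExponents n (2 * s) :=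
      mem_lowExponents.2 ((le_totalDegree ha').trans (totalDegree_lowPoly_le _ _))
    exact ha ((coeff_lowPoly _ (v j) ⟨a, haD⟩).trans (hvtail j ⟨a, haD⟩ hb))
  have hsum : ∑ j, q j ^ 2 = C (θ ^ 2) * p := by
    ext a
    rw [coeff_C_mul]
    by_cases ha : a ∈ lowExponents n (2 * s)
    · have h1 : Tendsto (fun N => ∑ j, coeff a (lowPoly n (2 * s) (u (φ N) j) ^ 2)) atTop
          (𝓝 (∑ j, coeff a (q j ^ 2))) :=
        tendsto_finsetSum _ fun j _ =>
          ((continuous_coeff_lowPoly_sq (2 * s) a).tendsto (v j)).comp (hconvuj j)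
      have h2 : Tendsto (fun N => ((L (φ N))⁻¹) ^ 2 *
          ∑ j, coeff a (lowPoly n (2 * s) (g (φ N) j) ^ 2)) atTop (𝓝 (θ ^ 2 * coeff a p)) :=
        (hconvθ.pow 2).mul ((hlim a ha).comp hφ.tendsto_atTop)
      rw [coeff_sum]
      refine tendsto_nhds_unique h1 (h2.congr fun N => ?_)
      rw [Finset.mul_sum]
      refine Finset.sum_congr rfl fun j _ => ?_
      simp only [u, Pi.smul_apply, map_smul, smul_pow, coeff_smul, smul_eq_mul]
    · rw [mem_lowExponents, not_le] at ha
      rw [coeff_eq_zero_of_totalDegree_lt (hp.trans_lt ha), mul_zero]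
      refine coeff_eq_zero_of_totalDegree_lt (lt_of_le_of_lt ?_ ha)
      refine (totalDegree_finsetSum _ _).trans (Finset.sup_le fun j _ => ?_)
      exact (totalDegree_pow _ _).trans (by have := hq j; omega)
  have hθ : θ ≠ 0 := by
    rintro rfl
    rw [zero_pow two_ne_zero, C_0, zero_mul] at hsum
    have hv0 : v = 0 := by
      funext j
      exact lowPoly_injective _ (by simpa using eq_zero_of_sum_sq_eq_zero hsum j)
    have h1 : Tendsto (fun N => ‖u (φ N)‖) atTop (𝓝 0) := by simpa [hv0] using hconvu.norm
    have h2 := (h1.eventually (gt_mem_nhds one_pos)).and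
      (hconvθ.eventually (gt_mem_nhds one_pos))
    obtain ⟨N, hN1, hN2⟩ := h2.exists
    have h3 : 1 < L (φ N) := by
      by_contra! h
      rw [le_antisymm h (hL _)] at hN2
      norm_num at hN2
    have h4 : L (φ N) = ‖g (φ N)‖ := by
      rcases max_choice 1 ‖g (φ N)‖ with h | h
      · exact absurd h h3.ne'
      · exact h
    rw [hnorm, ← h4, inv_mul_cancel₀ (hL0 _).ne'] at hN1
    exact lt_irrefl _ hN1
  refine ⟨fun j => C θ⁻¹ * q j, ?_⟩
  simp only [mul_pow, ← Finset.mul_sum, hsum, ← C_pow, ← mul_assoc, ← C_mul]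
  rw [← mul_pow, inv_mul_cancel₀ hθ, one_pow, C_1, one_mul]

end SosLimit

section Farkas

open Matrix

theorem exists_clm_neg_of_notMem_closure {E : Type*} [AddCommGroup E] [Module ℝ E]
    [TopologicalSpace E] [IsTopologicalAddGroup E] [ContinuousSMul ℝ E] [LocallyConvexSpace ℝ E]
    {K : Set E} (hadd : ∀ x ∈ K, ∀ y ∈ K, x + y ∈ K)
    (hsmul : ∀ c : ℝ, 0 ≤ c → ∀ x ∈ K, c • x ∈ K) (hne : K.Nonempty) {x : E}
    (hx : x ∉ closure K) : ∃ f : E →L[ℝ] ℝ, f x < 0 ∧ ∀ b ∈ K, 0 ≤ f b := by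
  have hconv : Convex ℝ K := fun x hx y hy a b ha hb _ =>
    hadd _ (hsmul a ha x hx) _ (hsmul b hb y hy)
  obtain ⟨f, u, hfx, hfK⟩ :=
    geometric_hahn_banach_point_closed hconv.closure isClosed_closure hx
  have hK : ∀ b ∈ K, u < f b := fun b hb => hfK b (subset_closure hb)
  obtain ⟨z, hz⟩ := hne
  have hu : u < 0 := by simpa using hK _ (hsmul 0 le_rfl z hz)
  refine ⟨f, hfx.trans hu, fun b hb => ?_⟩
  by_contra! hneg
  have h1 := hK _ (hsmul (u / f b) (div_nonneg_of_nonpos hu.le hneg.le) b hb)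
  rw [map_smul, smul_eq_mul, div_mul_cancel₀ _ hneg.ne] at h1
  exact lt_irrefl _ h1

/-- A set with a lift by positive semidefinite tuples that contains the origin is
parametrized by a spectrahedron through a linear map. -/
theorem HasLift.exists_parametrization {V : Type*} [AddCommGroup V] [Module ℝ V] {M : Set V}
    {k m : ℕ} (h : HasLift (PSDTuple k m) M) (h0 : 0 ∈ M) :
    ∃ (e : ℕ) (Z₀ : Fin m → Matrix (Fin k) (Fin k) ℝ)
      (D : Fin e → Fin m → Matrix (Fin k) (Fin k) ℝ) (y : Fin e → V),
      Z₀ ∈ PSDTuple k m ∧ (∀ i l, (D i l)ᵀ = D i l) ∧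
      M = {z | ∃ t : Fin e → ℝ, Z₀ + ∑ i, t i • D i ∈ PSDTuple k m ∧ z = ∑ i, t i • y i} := by
  obtain ⟨H, p, rfl⟩ := h
  obtain ⟨Z₀, ⟨hZ₀, hZ₀H⟩, hpZ₀⟩ := h0
  let Sym : Submodule ℝ (Fin m → Matrix (Fin k) (Fin k) ℝ) :=
    { carrier := {A | ∀ l, (A l)ᵀ = A l}
      add_mem' := fun {a b} ha hb l => by simp [ha l, hb l]
      zero_mem' := fun l => by simp
      smul_mem' := fun c a ha l => by simp [ha l] }
  let W := H.direction ⊓ Sym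
  let b := Module.finBasis ℝ W
  have hsymm : ∀ A ∈ PSDTuple k m, A ∈ Sym := fun A hA l =>
    (Matrix.posSemidef_iff_real.1 (hA l)).1
  refine ⟨_, Z₀, fun i => (b i : Fin m → Matrix (Fin k) (Fin k) ℝ), fun i => p (b i), hZ₀,
    fun i => (b i).2.2, Set.ext fun z => ⟨?_, ?_⟩⟩
  · rintro ⟨Z, ⟨hZ, hZH⟩, rfl⟩
    have hmem : Z - Z₀ ∈ W := ⟨AffineSubspace.vsub_mem_direction hZH hZ₀H,
      Sym.sub_mem (hsymm Z hZ) (hsymm Z₀ hZ₀)⟩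
    have hrepr : ∑ i, b.repr ⟨_, hmem⟩ i • (b i : Fin m → Matrix (Fin k) (Fin k) ℝ) = Z - Z₀ := by
      have := congrArg Subtype.val (b.sum_repr ⟨_, hmem⟩)
      rwa [AddSubmonoidClass.coe_finsetSum] at this
    refine ⟨fun i => b.repr ⟨_, hmem⟩ i, by rw [hrepr]; simpa using hZ, ?_⟩
    simp only [← map_smul, ← map_sum, hrepr, map_sub, hpZ₀, sub_zero]
  · rintro ⟨t, ht, rfl⟩
    refine ⟨_, ⟨ht, ?_⟩, by simp [hpZ₀]⟩
    rw [add_comm]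
    exact AffineSubspace.vadd_mem_of_mem_direction
      (Submodule.sum_mem _ fun i _ => Submodule.smul_mem _ _ (b i).2.1) hZ₀H

theorem Matrix.posSemidef_vecMulVec_real {k : ℕ} (v : Fin k → ℝ) :
    (vecMulVec v v).PosSemidef := by
  simpa using posSemidef_vecMulVec_self_star v

/-- An approximate Farkas lemma for spectrahedra through a positive semidefinite tuple. -/
theorem exists_psdTuple_approx {k m e : ℕ} {Z₀ : Fin m → Matrix (Fin k) (Fin k) ℝ}
    {D : Fin e → Fin m → Matrix (Fin k) (Fin k) ℝ} (hZ₀ : Z₀ ∈ PSDTuple k m)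
    (hD : ∀ i l, (D i l)ᵀ = D i l) (ℓ : Fin e → ℝ)
    (hℓ : ∀ t : Fin e → ℝ, Z₀ + ∑ i, t i • D i ∈ PSDTuple k m → 0 ≤ ∑ i, t i * ℓ i)
    {η : ℝ} (hη : 0 < η) :
    ∃ B ∈ PSDTuple k m, ∃ s : ℝ, 0 ≤ s ∧ |∑ l, (B l * Z₀ l).trace + s| ≤ η ∧
      ∀ i, |∑ l, (B l * D i l).trace - ℓ i| ≤ η := by
  let Φ : (Fin m → Matrix (Fin k) (Fin k) ℝ) → ℝ → (Fin e → ℝ) × ℝ := fun B s =>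
    (fun i => ∑ l, (B l * D i l).trace, ∑ l, (B l * Z₀ l).trace + s)
  let K : Set ((Fin e → ℝ) × ℝ) := {z | ∃ B ∈ PSDTuple k m, ∃ s : ℝ, 0 ≤ s ∧ z = Φ B s}
  have hmem : ((ℓ, 0) : (Fin e → ℝ) × ℝ) ∈ closure K := by
    by_contra hx
    obtain ⟨f, hfx, hfK⟩ := exists_clm_neg_of_notMem_closure (K := K) (by
        rintro _ ⟨B, hB, s, hs, rfl⟩ _ ⟨B', hB', s', hs', rfl⟩
        refine ⟨B + B', fun l => (hB l).add (hB' l), s + s', add_nonneg hs hs', ?_⟩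
        ext <;> simp [Φ, add_mul, Finset.sum_add_distrib]
        ring) (by
        rintro c hc _ ⟨B, hB, s, hs, rfl⟩
        refine ⟨c • B, fun l => (hB l).smul hc, c * s, mul_nonneg hc hs, ?_⟩
        ext <;> simp [Φ, Finset.mul_sum, mul_add])
      ⟨_, 0, fun l => PosSemidef.zero, 0, le_rfl, rfl⟩ hx
    set u : Fin e → ℝ := fun i => f (Pi.single i 1, 0)
    set u₀ : ℝ := f (0, 1)
    have hf : ∀ z, f z = ∑ i, z.1 i * u i + z.2 * u₀ := by
      intro z
      have h1 : z = ∑ i, z.1 i • ((Pi.single i 1, 0) : (Fin e → ℝ) × ℝ) + z.2 • (0, 1) := by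
        ext i
        · simp [Prod.fst_sum, Finset.sum_apply, Pi.single_apply]
        · simp [Prod.snd_sum]
      conv_lhs => rw [h1]
      simp only [map_add, map_sum, map_smul, smul_eq_mul, u, u₀]
    have hu₀ : 0 ≤ u₀ := by
      have := hfK _ ⟨0, fun l => PosSemidef.zero, 1, zero_le_one, rfl⟩
      rw [hf] at this
      simpa [Φ] using this
    have hpsd : ∀ l, (u₀ • Z₀ l + ∑ i, u i • D i l).PosSemidef := by
      intro l
      refine posSemidef_iff_real.2 ⟨?_, fun v => ?_⟩
      · simp [transpose_sum, hD, (posSemidef_iff_real.1 (hZ₀ l)).1]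
      · have := hfK _ ⟨Pi.single l (vecMulVec v v), fun l' => by
          by_cases h : l' = l
          · subst h; simpa using posSemidef_vecMulVec_real v
          · simpa [h] using PosSemidef.zero, 0, le_rfl, rfl⟩
        have htr : ∀ N : Fin m → Matrix (Fin k) (Fin k) ℝ,
            ∑ l', ((Pi.single l (vecMulVec v v) : Fin m → Matrix (Fin k) (Fin k) ℝ) l' *
              N l').trace = v ⬝ᵥ N l *ᵥ v := by
          intro N
          rw [Finset.sum_eq_single l]
          · rw [Pi.single_eq_same, vecMulVec_mul, trace_vecMulVec, dotProduct_mulVec,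
              dotProduct_comm]
          · intro l' _ h
            simp [Pi.single_eq_of_ne h]
          · simp
        rw [hf] at this
        simp only [Φ, htr, add_zero] at this
        rw [add_mulVec, dotProduct_add, sum_mulVec, dotProduct_sum, smul_mulVec, dotProduct_smul]
        simp only [smul_mulVec, dotProduct_smul, smul_eq_mul]
        simp only [mul_comm (u _), mul_comm u₀]
        linarith
    rw [hf] at hfx
    simp only [zero_mul, add_zero] at hfx
    rcases hu₀.eq_or_lt with h | h
    · have := hℓ u fun l => by
        have := (hZ₀ l).add (hpsd l)
        simpa [← h, Finset.sum_apply] using this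
      simp only [mul_comm (u _)] at this
      linarith
    · have := hℓ (u₀⁻¹ • u) fun l => by
        have := (hpsd l).smul (inv_nonneg.2 hu₀)
        simpa [smul_add, smul_smul, inv_mul_cancel₀ h.ne', Finset.smul_sum,
          Finset.sum_apply] using this
      have h2 : ∑ i, (u₀⁻¹ • u) i * ℓ i = u₀⁻¹ * ∑ i, ℓ i * u i := by
        rw [Finset.mul_sum]
        exact Finset.sum_congr rfl fun i _ => by simp; ring
      rw [h2] at this
      have := mul_neg_of_pos_of_neg (inv_pos.2 h) hfx
      linarith
  obtain ⟨_, ⟨B, hB, s, hs, rfl⟩, hdist⟩ := Metric.mem_closure_iff.1 hmem η hη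
  rw [Prod.dist_eq, max_lt_iff] at hdist
  refine ⟨B, hB, s, hs, ?_, fun i => ?_⟩
  · have := hdist.2.le
    rwa [dist_comm, Real.dist_eq, sub_zero] at this
  · have := (dist_pi_lt_iff hη).1 hdist.1 i
    rw [dist_comm, Real.dist_eq] at this
    exact this.le

end Farkas

section TaylorApprox

open Matrix

theorem MvPolynomial.totalDegree_aeval_le_of_le_one {σ τ R : Type*} [CommRing R]
    {f : σ → MvPolynomial τ R} (hf : ∀ i, (f i).totalDegree ≤ 1) (p : MvPolynomial σ R) :
    (aeval f p).totalDegree ≤ p.totalDegree := by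
  conv_lhs => rw [p.as_sum, map_sum]
  refine (totalDegree_finsetSum _ _).trans (Finset.sup_le fun a ha => ?_)
  rw [aeval_monomial, algebraMap_eq]
  refine (totalDegree_mul _ _).trans ?_
  rw [totalDegree_C, zero_add]
  refine (totalDegree_finsetProd _ _).trans ((Finset.sum_le_sum fun i _ => ?_).trans
    (le_totalDegree ha))
  exact (totalDegree_pow _ _).trans (by nlinarith [hf i])

theorem MvPolynomial.totalDegree_X_le_one {σ R : Type*} [CommRing R] (i : σ) :
    (X i : MvPolynomial σ R).totalDegree ≤ 1 :=
  (totalDegree_monomial_le _ _).trans (by simp)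

theorem MvPolynomial.eval_aeval_eq {σ τ : Type*} (z : τ → ℝ) (f : σ → MvPolynomial τ ℝ)
    (p : MvPolynomial σ ℝ) : eval z (aeval f p) = eval (fun i => eval z (f i)) p := by
  rw [map_aeval, algebraMap_eq, coe_eval₂Hom, ← eval₂_id]
  congr 1
  ext c
  simp

theorem MvPolynomial.coeff_aeval_C_mul_X {σ R : Type*} [CommRing R] (r : R)
    (p : MvPolynomial σ R) (a : σ →₀ ℕ) :
    coeff a (aeval (fun i => C r * X i) p) = r ^ (a.sum fun _ e => e) * coeff a p := by
  classical
  induction p using MvPolynomial.induction_on' with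
  | monomial b c =>
    have : aeval (fun i => C r * X i) (monomial b c) =
        monomial b (r ^ (b.sum fun _ e => e) * c) := by
      rw [aeval_monomial, algebraMap_eq]
      simp only [mul_pow, Finsupp.prod_mul]
      rw [mul_left_comm, ← monomial_eq, Finsupp.prod, Finset.prod_pow_eq_pow_sum, ← C_pow,
        C_mul_monomial]
      rfl
    rw [this, coeff_monomial, coeff_monomial]
    split_ifs with h
    · rw [h]
    · simp
  | add p q hp hq => rw [map_add, coeff_add, hp, hq, coeff_add, mul_add]

theorem Matrix.sum_sum_sq_eq_trace {ι κ R : Type*} [Fintype ι] [Fintype κ] [CommRing R]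
    (A : Matrix ι κ R) : ∑ i, ∑ j, A i j ^ 2 = (Aᵀ * A).trace := by
  simp only [trace, diag_apply, mul_apply, transpose_apply, pow_two]
  exact Finset.sum_comm

theorem MvPolynomial.aeval_C_add_X_aeval {σ : Type*} (x : σ → ℝ) (r : ℝ)
    (p : MvPolynomial σ ℝ) :
    (aeval (fun i => MvPowerSeries.C (x i) + MvPowerSeries.X i)
      (aeval (fun i => C r * (X i - C (x i))) p) : MvPowerSeries σ ℝ) =
      (aeval (fun i => C r * X i) p : MvPolynomial σ ℝ) := by
  have hC : ∀ c : ℝ, algebraMap ℝ (MvPowerSeries σ ℝ) c = MvPowerSeries.C c := fun c => rfl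
  induction p using MvPolynomial.induction_on with
  | C c => simp [hC]
  | add p q hp hq => simp only [map_add, hp, hq, coe_add]
  | mul_X p i hp =>
    rw [map_mul, map_mul, map_mul, hp, coe_mul]
    congr 1
    simp [hC]

/-- If the moment cone has a positive semidefinite lift then all rescalings of a nonnegative
polynomial are approximated by sums of squares from a fixed finite-dimensional space of power
series. -/
theorem HasLift.exists_sum_sq_approx {n D k m : ℕ}
    (h : HasLift (PSDTuple k m) (closure (coneHull (Set.range (monVec n D))))) :
    ∃ U : Submodule ℝ (MvPowerSeries (Fin n) ℝ), FiniteDimensional ℝ U ∧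
      ∀ p : MvPolynomial (Fin n) ℝ, p.totalDegree ≤ D → (∀ x, 0 ≤ eval x p) →
      ∀ ε > (0 : ℝ), ∀ ρ > (0 : ℝ), ∀ E : Finset (Fin n →₀ ℕ),
      ∃ f : Option (Fin m × Fin k × Fin k) → MvPowerSeries (Fin n) ℝ, (∀ j, f j ∈ U) ∧
        ∀ a ∈ E, |MvPowerSeries.coeff a (∑ j, f j ^ 2) -
          ε⁻¹ ^ (a.sum fun _ e => e) * coeff a p| ≤ ρ := by
  classical
  obtain ⟨e, Z₀, D', y, hZ₀, hD', hM⟩ := h.exists_parametrization (zero_mem_closure_coneHull D)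
  set T : Set ℝ := (Set.range fun i : Fin m × Fin k × Fin k => Z₀ i.1 i.2.1 i.2.2) ∪
    (Set.range fun i : Fin e × Fin m × Fin k × Fin k => D' i.1 i.2.1 i.2.2.1 i.2.2.2) ∪
    (Set.range fun i : Fin e × (Fin n →₀ ℕ) => y i.1 i.2)
  have hT : T.Countable := ((Set.countable_range _).union (Set.countable_range _)).union
    (Set.countable_range _)
  have hk₀ : Countable (Subfield.closure T) := by
    rw [← Cardinal.mk_le_aleph0_iff]
    exact (Subfield.cardinalMk_closure_le_max T).trans
      (max_le (Cardinal.mk_le_aleph0_iff.2 hT.to_subtype) le_rfl)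
  obtain ⟨x, τ, hτC, hτx⟩ := exists_taylorHom n (Subfield.closure T)
  have hτZ : ∀ l a b, τ (Z₀ l a b) = MvPowerSeries.C (Z₀ l a b) := fun l a b =>
    hτC _ (Subfield.subset_closure (Or.inl (Or.inl ⟨(l, a, b), rfl⟩)))
  have hτD : ∀ i l a b, τ (D' i l a b) = MvPowerSeries.C (D' i l a b) := fun i l a b =>
    hτC _ (Subfield.subset_closure (Or.inl (Or.inr ⟨(i, l, a, b), rfl⟩)))
  have hτy : ∀ i a, τ (y i a) = MvPowerSeries.C (y i a) := fun i a =>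
    hτC _ (Subfield.subset_closure (Or.inr ⟨(i, a), rfl⟩))
  obtain ⟨t, htZ, hty⟩ : monVec n D x ∈ {z | ∃ t : Fin e → ℝ, Z₀ + ∑ i, t i • D' i ∈
    PSDTuple k m ∧ z = ∑ i, t i • y i} := hM ▸ monVec_mem_closure D x
  choose G hG using fun l => (htZ l).exists_eq_transpose_mul
  set w : Option (Fin m × Fin k × Fin k) → MvPowerSeries (Fin n) ℝ := fun j =>
    j.elim 1 fun j => τ (G j.1 j.2.1 j.2.2)
  refine ⟨Submodule.span ℝ (Set.range w), FiniteDimensional.span_of_finite ℝ (Set.finite_range w),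
    fun p hp hpos ε hε ρ hρ E => ?_⟩
  set q : MvPolynomial (Fin n) ℝ := aeval (fun i => C ε⁻¹ * (X i - C (x i))) p with hq
  have hqD : q.totalDegree ≤ D := (totalDegree_aeval_le_of_le_one (fun i => by
    refine (totalDegree_mul _ _).trans ?_
    rw [totalDegree_C, zero_add]
    exact (totalDegree_sub_C_le _ _).trans (totalDegree_X_le_one i)) p).trans hp
  have hqpos : ∀ z, 0 ≤ eval z q := fun z => by
    have : eval z q = eval (fun i => ε⁻¹ * (z i - x i)) p := by
      rw [hq, eval_aeval_eq]
      simp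
    rw [this]
    exact hpos _
  set ℓ : Fin e → ℝ := fun i => momentEval q (y i)
  have hℓ : ∀ t : Fin e → ℝ, Z₀ + ∑ i, t i • D' i ∈ PSDTuple k m → 0 ≤ ∑ i, t i * ℓ i := by
    intro t ht
    have hmem : ∑ i, t i • y i ∈ closure (coneHull (Set.range (monVec n D))) := by
      rw [hM]; exact ⟨t, ht, rfl⟩
    simpa [ℓ] using momentEval_nonneg hqD hqpos hmem
  set Λ : ℝ := 1 + ∑ a ∈ E, ∑ i, |MvPowerSeries.coeff a (τ (t i))| with hΛ
  have hΛ0 : 0 < Λ := by positivity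
  obtain ⟨B, hB, s, hs, hB0, hBℓ⟩ := exists_psdTuple_approx hZ₀ hD' ℓ hℓ (div_pos hρ hΛ0)
  choose R hR using fun l => (hB l).exists_eq_transpose_mul
  set f : Option (Fin m × Fin k × Fin k) → MvPowerSeries (Fin n) ℝ := fun j =>
    j.elim (MvPowerSeries.C (√s)) fun j => ∑ a, MvPowerSeries.C (R j.1 j.2.1 a) *
      τ (G j.1 j.2.2 a)
  have hfU : ∀ j, f j ∈ Submodule.span ℝ (Set.range w) := by
    rintro (_ | ⟨l, r, c⟩)
    · have : f none = √s • w none := by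
        rw [MvPowerSeries.smul_eq_C_mul]; simp [f, w]
      rw [this]
      exact Submodule.smul_mem _ _ (Submodule.subset_span ⟨_, rfl⟩)
    · refine Submodule.sum_mem _ fun a _ => ?_
      rw [← MvPowerSeries.smul_eq_C_mul]
      exact Submodule.smul_mem _ _ (Submodule.subset_span ⟨some (l, c, a), rfl⟩)
  have hAτ : ∀ l, ((G l).map τ)ᵀ * (G l).map τ =
      (Z₀ l).map MvPowerSeries.C + ∑ i, τ (t i) • (D' i l).map MvPowerSeries.C := by
    intro l
    rw [← transpose_map, ← Matrix.map_mul, ← hG]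
    ext1 a b
    simp [Finset.sum_apply, Matrix.sum_apply, hτZ, hτD]
  have htr : ∀ A N : Matrix (Fin k) (Fin k) ℝ, (A.map MvPowerSeries.C * N.map MvPowerSeries.C).trace
      = (MvPowerSeries.C (A * N).trace : MvPowerSeries (Fin n) ℝ) := by
    intro A N
    rw [← Matrix.map_mul]
    simp only [trace, diag_apply, map_apply, map_sum]
  have hblock : ∀ l, ∑ r, ∑ c, f (some (l, r, c)) ^ 2 =
      MvPowerSeries.C (B l * Z₀ l).trace +
        ∑ i, τ (t i) * MvPowerSeries.C (B l * D' i l).trace := by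
    intro l
    have h1 : ∀ r c, f (some (l, r, c)) =
        ((R l).map MvPowerSeries.C * ((G l).map τ)ᵀ :
          Matrix (Fin k) (Fin k) (MvPowerSeries (Fin n) ℝ)) r c := fun r c => by
      simp [f, mul_apply]
    simp only [h1, sum_sum_sq_eq_trace]
    rw [transpose_mul, transpose_transpose, Matrix.mul_assoc, trace_mul_comm,
      ← Matrix.mul_assoc, Matrix.mul_assoc _ _ ((G l).map τ), hAτ, ← transpose_map, ← Matrix.map_mul,
      ← hR, Matrix.mul_add, trace_add, htr, Matrix.mul_sum, trace_sum]
    simp only [Matrix.mul_smul, trace_smul, htr, smul_eq_mul]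
  have hq1 : ∑ i, τ (t i) * MvPowerSeries.C (ℓ i) =
      aeval (fun i => MvPowerSeries.C (x i) + MvPowerSeries.X i) q := by
    have h1 : ∀ a ∈ q.support, ∑ i, τ (t i) * τ (y i a) =
        ∏ i, (MvPowerSeries.C (x i) + MvPowerSeries.X i) ^ a i := by
      intro a ha
      have h2 := congrArg τ (congrFun hty a)
      rw [monVec, if_pos ((le_totalDegree ha).trans hqD), map_prod] at h2
      simp only [map_pow, hτx] at h2
      rw [h2]
      simp [Finset.sum_apply]
    rw [aeval_def, eval₂_eq']
    simp only [ℓ, momentEval_apply, map_sum, map_mul, Finset.mul_sum]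
    rw [Finset.sum_comm]
    refine Finset.sum_congr rfl fun a ha => ?_
    rw [← h1 a ha, Finset.mul_sum]
    refine Finset.sum_congr rfl fun i _ => ?_
    rw [hτy]
    change _ = MvPowerSeries.C _ * _
    ring
  have hq2 : (aeval (fun i => MvPowerSeries.C (x i) + MvPowerSeries.X i) q :
      MvPowerSeries (Fin n) ℝ) =
      (aeval (fun i => C ε⁻¹ * X i) p : MvPolynomial (Fin n) ℝ) := by
    exact aeval_C_add_X_aeval x ε⁻¹ p
  have hsum : ∑ j, f j ^ 2 - ((aeval (fun i => C ε⁻¹ * X i) p : MvPolynomial (Fin n) ℝ) :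
      MvPowerSeries (Fin n) ℝ) = MvPowerSeries.C (∑ l, (B l * Z₀ l).trace + s) +
      ∑ i, τ (t i) * MvPowerSeries.C (∑ l, (B l * D' i l).trace - ℓ i) := by
    rw [← hq2, ← hq1, Fintype.sum_option, Fintype.sum_prod_type]
    simp only [Fintype.sum_prod_type, hblock, map_add, map_sub, map_sum, mul_sub, Finset.mul_sum,
      Finset.sum_sub_distrib, Finset.sum_add_distrib]
    rw [Finset.sum_comm (s := (Finset.univ : Finset (Fin m)))]
    have : f none ^ 2 = MvPowerSeries.C s := by
      simp only [f, Option.elim]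
      rw [← map_pow, Real.sq_sqrt hs]
    rw [this]
    ring
  refine ⟨f, hfU, fun a ha => ?_⟩
  have hcoeff := congrArg (MvPowerSeries.coeff a) hsum
  rw [map_sub, MvPolynomial.coeff_coe, coeff_aeval_C_mul_X] at hcoeff
  rw [hcoeff, map_add, map_sum]
  simp only [MvPowerSeries.coeff_mul_C]
  have h1 : |MvPowerSeries.coeff a (MvPowerSeries.C (∑ l, (B l * Z₀ l).trace + s) :
      MvPowerSeries (Fin n) ℝ)| ≤ ρ / Λ := by
    rw [MvPowerSeries.coeff_C]
    split_ifs
    · exact hB0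
    · simpa using (div_pos hρ hΛ0).le
  have h2 : |∑ i, MvPowerSeries.coeff a (τ (t i)) * (∑ l, (B l * D' i l).trace - ℓ i)| ≤
      (∑ i, |MvPowerSeries.coeff a (τ (t i))|) * (ρ / Λ) := by
    refine (Finset.abs_sum_le_sum_abs _ _).trans ?_
    rw [Finset.sum_mul]
    refine Finset.sum_le_sum fun i _ => ?_
    rw [abs_mul]
    exact mul_le_mul_of_nonneg_left (hBℓ i) (abs_nonneg _)
  have h3 : ∑ i, |MvPowerSeries.coeff a (τ (t i))| ≤
      ∑ a ∈ E, ∑ i, |MvPowerSeries.coeff a (τ (t i))| :=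
    Finset.single_le_sum (f := fun a => ∑ i, |MvPowerSeries.coeff a (τ (t i))|)
      (fun b _ => Finset.sum_nonneg fun i _ => abs_nonneg _) ha
  calc _ ≤ ρ / Λ + (∑ i, |MvPowerSeries.coeff a (τ (t i))|) * (ρ / Λ) :=
        (abs_add_le _ _).trans (add_le_add h1 h2)
    _ ≤ Λ * (ρ / Λ) := by
        rw [hΛ] at *
        nlinarith [(div_pos hρ hΛ0).le]
    _ = ρ := mul_div_cancel₀ _ hΛ0.ne'

end TaylorApprox

section SumSqOfLift

open Filter Topology

variable {n : ℕ}

/-- Truncation of power series to the coefficients of total degree at most `d`. -/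
noncomputable def lowCoeff (n d : ℕ) : MvPowerSeries (Fin n) ℝ →ₗ[ℝ] (lowExponents n d → ℝ) :=
  LinearMap.pi fun a => MvPowerSeries.coeff a.1

theorem lowCoeff_apply (d : ℕ) (f : MvPowerSeries (Fin n) ℝ) (a : lowExponents n d) :
    lowCoeff n d f a = MvPowerSeries.coeff a.1 f := rfl

theorem exists_injOn_lowCoeff (U : Submodule ℝ (MvPowerSeries (Fin n) ℝ)) [FiniteDimensional ℝ U] :
    ∃ s₀ : ℕ, ∀ s, s₀ ≤ s → LinearMap.ker (lowCoeff n s ∘ₗ U.subtype) = ⊥ := by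
  have hmem : ∀ s (u : U), u ∈ LinearMap.ker (lowCoeff n s ∘ₗ U.subtype) ↔
      ∀ a : Fin n →₀ ℕ, (a.sum fun _ e => e) ≤ s → MvPowerSeries.coeff a u.1 = 0 := by
    intro s u
    rw [LinearMap.mem_ker, funext_iff]
    exact ⟨fun h a ha => h ⟨a, mem_lowExponents.2 ha⟩, fun h a => h a.1 (mem_lowExponents.1 a.2)⟩
  let K : ℕ →o (Submodule ℝ U)ᵒᵈ :=
    { toFun := fun s => OrderDual.toDual (LinearMap.ker (lowCoeff n s ∘ₗ U.subtype))
      monotone' := fun s t hst => by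
        refine OrderDual.toDual_le_toDual.2 fun u hu => ?_
        rw [hmem] at hu ⊢
        exact fun a ha => hu a (ha.trans hst) }
  obtain ⟨s₀, hs₀⟩ := IsArtinian.monotone_stabilizes K
  have hbot : LinearMap.ker (lowCoeff n s₀ ∘ₗ U.subtype) = ⊥ := by
    rw [eq_bot_iff]
    intro u hu
    rw [Submodule.mem_bot]
    ext a
    have h := hs₀ (max s₀ (a.sum fun _ e => e)) (le_max_left _ _)
    have h' : LinearMap.ker (lowCoeff n s₀ ∘ₗ U.subtype) =
      LinearMap.ker (lowCoeff n (max s₀ (a.sum fun _ e => e)) ∘ₗ U.subtype) := h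
    rw [h', hmem] at hu
    simpa using hu a (le_max_right _ _)
  exact ⟨s₀, fun s hs => (congrArg OrderDual.ofDual (hs₀ s hs)).symm.trans hbot⟩

theorem coeff_lowPoly_rescale_sq {d : ℕ} (r : ℝ) (f : MvPowerSeries (Fin n) ℝ)
    {a : Fin n →₀ ℕ} (ha : a ∈ lowExponents n d) :
    coeff a (lowPoly n d (fun b => r ^ (b.1.sum fun _ e => e) * MvPowerSeries.coeff b.1 f) ^ 2) =
      r ^ (a.sum fun _ e => e) * MvPowerSeries.coeff a (f ^ 2) := by
  classical
  have hadd : ∀ b c : Fin n →₀ ℕ, ((b + c).sum fun _ e => e) =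
      (b.sum fun _ e => e) + (c.sum fun _ e => e) := fun b c =>
    Finsupp.sum_add_index' (fun _ => rfl) fun _ _ _ => rfl
  rw [pow_two, pow_two, coeff_mul, MvPowerSeries.coeff_mul, Finset.mul_sum]
  refine Finset.sum_congr rfl fun x hx => ?_
  rw [Finset.HasAntidiagonal.mem_antidiagonal] at hx
  have hsum := hadd x.1 x.2
  rw [hx] at hsum
  have ha' := mem_lowExponents.1 ha
  have h1 := coeff_lowPoly d
    (fun b => r ^ (b.1.sum fun _ e => e) * MvPowerSeries.coeff b.1 f)
    ⟨x.1, mem_lowExponents.2 (by omega)⟩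
  have h2 := coeff_lowPoly d
    (fun b => r ^ (b.1.sum fun _ e => e) * MvPowerSeries.coeff b.1 f)
    ⟨x.2, mem_lowExponents.2 (by omega)⟩
  simp only at h1 h2
  rw [h1, h2, hsum, pow_add]
  ring

/-- If the moment cone has a positive semidefinite lift, then nonnegative polynomials are sums
of squares. -/
theorem HasLift.exists_eq_sum_sq {D k m : ℕ}
    (h : HasLift (PSDTuple k m) (closure (coneHull (Set.range (monVec n D)))))
    {p : MvPolynomial (Fin n) ℝ} (hp : p.totalDegree ≤ D) (hpos : ∀ x, 0 ≤ eval x p) :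
    ∃ q : Option (Fin m × Fin k × Fin k) → MvPolynomial (Fin n) ℝ, p = ∑ j, q j ^ 2 := by
  obtain ⟨U, hU, happ⟩ := h.exists_sum_sq_approx
  obtain ⟨s₀, hs₀⟩ := exists_injOn_lowCoeff U
  set s := max s₀ D
  obtain ⟨T, hT⟩ := LinearMap.exists_comp_eq_of_ker_le (lowCoeff n s ∘ₗ U.subtype)
    (lowCoeff n (2 * s) ∘ₗ U.subtype) (by rw [hs₀ s (le_max_left _ _)]; exact bot_le)
  set M : ℝ := ‖LinearMap.toContinuousLinearMap T‖
  have hTM : ∀ f ∈ U, ∀ b : lowExponents n (2 * s),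
      |MvPowerSeries.coeff b.1 f| ≤ M * ‖lowCoeff n s f‖ := fun f hf b => by
    have h1 : T (lowCoeff n s f) = lowCoeff n (2 * s) f := LinearMap.congr_fun hT ⟨f, hf⟩
    have h2 := (LinearMap.toContinuousLinearMap T).le_opNorm (lowCoeff n s f)
    rw [LinearMap.coe_toContinuousLinearMap', h1] at h2
    exact (norm_le_pi_norm (lowCoeff n (2 * s) f) b).trans h2
  set ε : ℕ → ℝ := fun N => 1 / ((N : ℝ) + 1)
  have hε0 : ∀ N, 0 < ε N := fun N => Nat.one_div_pos_of_nat
  have hε1 : ∀ N, ε N ≤ 1 := fun N => by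
    simp only [ε]
    rw [div_le_one (by positivity)]
    linarith [Nat.cast_nonneg (α := ℝ) N]
  have hε : Tendsto ε atTop (𝓝 0) := tendsto_one_div_add_atTop_nhds_zero_nat
  choose f hfU hf using fun N => happ p hp hpos (ε N) (hε0 N) (ε N) (hε0 N) (lowExponents n (2 * s))
  set g : ℕ → Option (Fin m × Fin k × Fin k) → lowExponents n (2 * s) → ℝ := fun N j b =>
    ε N ^ (b.1.sum fun _ e => e) * MvPowerSeries.coeff b.1 (f N j) with hg
  refine exists_eq_sum_sq_of_tendsto (s := s) (hp.trans (by omega)) g (fun N => M * ε N)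
    (by simpa using hε.const_mul M) (fun N j b hb => ?_) fun a ha => ?_
  · have h1 : ‖lowCoeff n s (f N j)‖ * ε N ^ s ≤ ‖g N‖ := by
      rw [← le_div_iff₀ (pow_pos (hε0 N) _)]
      refine (pi_norm_le_iff_of_nonneg (by have := hε0 N; positivity)).2 fun c => ?_
      rw [le_div_iff₀ (pow_pos (hε0 N) _), lowCoeff_apply]
      have hc := mem_lowExponents.1 c.2
      have h2 := (norm_le_pi_norm (g N j) ⟨c.1, mem_lowExponents.2 (by omega)⟩).trans
        (norm_le_pi_norm (g N) j)
      refine le_trans ?_ h2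
      rw [hg, norm_mul, norm_pow, Real.norm_of_nonneg (hε0 N).le, mul_comm]
      exact mul_le_mul_of_nonneg_right (pow_le_pow_of_le_one (hε0 N).le (hε1 N) hc) (norm_nonneg _)
    have h3 : ε N ^ (b.1.sum fun _ e => e) ≤ ε N ^ s * ε N := by
      rw [← pow_succ]
      exact pow_le_pow_of_le_one (hε0 N).le (hε1 N) hb
    calc |g N j b| = ε N ^ (b.1.sum fun _ e => e) * |MvPowerSeries.coeff b.1 (f N j)| := by
          rw [hg, abs_mul, abs_of_nonneg (pow_nonneg (hε0 N).le _)]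
      _ ≤ (ε N ^ s * ε N) * (M * ‖lowCoeff n s (f N j)‖) :=
          mul_le_mul h3 (hTM _ (hfU N j) b) (abs_nonneg _) (by have := hε0 N; positivity)
      _ = M * ε N * (‖lowCoeff n s (f N j)‖ * ε N ^ s) := by ring
      _ ≤ M * ε N * ‖g N‖ := mul_le_mul_of_nonneg_left h1
          (mul_nonneg (norm_nonneg _) (hε0 N).le)
  · rw [tendsto_iff_norm_sub_tendsto_zero]
    refine squeeze_zero (fun _ => norm_nonneg _) (fun N => ?_) hε
    have h1 : ∑ j, coeff a (lowPoly n (2 * s) (g N j) ^ 2) =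
        ε N ^ (a.sum fun _ e => e) * MvPowerSeries.coeff a (∑ j, f N j ^ 2) := by
      rw [map_sum, Finset.mul_sum]
      exact Finset.sum_congr rfl fun j _ => coeff_lowPoly_rescale_sq _ _ ha
    have h2 : ε N ^ (a.sum fun _ e => e) * ((ε N)⁻¹ ^ (a.sum fun _ e => e) * coeff a p) =
        coeff a p := by
      rw [← mul_assoc, ← mul_pow, mul_inv_cancel₀ (hε0 N).ne', one_pow, one_mul]
    rw [h1, ← h2, ← mul_sub, norm_mul, norm_pow, Real.norm_of_nonneg (hε0 N).le]
    calc _ ≤ 1 * ε N := mul_le_mul (pow_le_one₀ (hε0 N).le (hε1 N)) (hf N a ha) (abs_nonneg _)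
            zero_le_one
      _ = ε N := one_mul _

end SumSqOfLift

section NotSumSq

theorem totalDegree_le_of_eq_sum_sq {σ J : Type*} [Fintype σ] [LinearOrder σ] [Fintype J]
    {e : ℕ} {p : MvPolynomial σ ℝ} (hp : p.totalDegree ≤ 2 * e) {q : J → MvPolynomial σ ℝ}
    (h : p = ∑ j, q j ^ 2) (j : J) : (q j).totalDegree ≤ e := by
  classical
  obtain ⟨i, -, hi⟩ := Finset.exists_max_image Finset.univ
    (fun j => MonomialOrder.degLex.toSyn (MonomialOrder.degLex.degree (q j))) ⟨j, Finset.mem_univ j⟩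
  set a := MonomialOrder.degLex.degree (q i)
  have hle : (q j).totalDegree ≤ (q i).totalDegree :=
    MvPolynomial.degLex_totalDegree_monotone (hi j (Finset.mem_univ j))
  refine hle.trans ?_
  by_cases h0 : q i = 0
  · simp [h0]
  have hcoeff : coeff (a + a) p = ∑ j, coeff a (q j) ^ 2 := by
    rw [h, coeff_sum]
    refine Finset.sum_congr rfl fun j _ => ?_
    rw [pow_two, pow_two]
    exact MonomialOrder.coeff_mul_of_add_of_degree_le (hi j (Finset.mem_univ j))
      (hi j (Finset.mem_univ j))
  have hpos : 0 < coeff (a + a) p := by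
    rw [hcoeff]
    refine Finset.sum_pos' (fun j _ => sq_nonneg _) ⟨i, Finset.mem_univ i, ?_⟩
    exact sq_pos_iff.2 (MonomialOrder.leadingCoeff_ne_zero_iff.2 h0)
  have h1 := (le_totalDegree (mem_support_iff.2 hpos.ne')).trans hp
  have h2 : (a + a).degree ≤ 2 * e := h1
  rw [map_add, MvPolynomial.degree_degLexDegree] at h2
  omega

theorem sum_mul_eval_eq_zero {n e : ℕ} {ι : Type*} [Fintype ι] (w : ι → ℝ) (P : ι → Fin n → ℝ)
    (h : ∀ a : Fin n → ℕ, ∑ i, a i ≤ e → ∑ k, w k * ∏ i, P k i ^ a i = 0)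
    {g : MvPolynomial (Fin n) ℝ} (hg : g.totalDegree ≤ e) : ∑ k, w k * eval (P k) g = 0 := by
  simp only [eval_eq', Finset.mul_sum]
  rw [Finset.sum_comm]
  refine Finset.sum_eq_zero fun a ha => ?_
  have h1 := h a (by
    have := (le_totalDegree ha).trans hg
    rwa [Finsupp.sum_fintype _ _ fun _ => rfl] at this)
  calc _ = coeff a g * ∑ k, w k * ∏ i, P k i ^ a i := by
        rw [Finset.mul_sum]
        exact Finset.sum_congr rfl fun k _ => by ring
    _ = 0 := by rw [h1, mul_zero]

/-- The dehomogenized Robinson polynomial. -/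
noncomputable def robinsonPoly (n : ℕ) : MvPolynomial (Fin (n + 2)) ℝ :=
  X 0 ^ 6 + X 1 ^ 6 + 1 - X 0 ^ 4 * X 1 ^ 2 - X 0 ^ 2 * X 1 ^ 4 - X 0 ^ 4 - X 1 ^ 4 - X 0 ^ 2
    - X 1 ^ 2 + C 3 * (X 0 ^ 2 * X 1 ^ 2)

/-- A dehomogenized Choi–Lam polynomial. -/
noncomputable def choiLamPoly (n : ℕ) : MvPolynomial (Fin (n + 3)) ℝ :=
  1 + X 0 ^ 2 * X 1 ^ 2 + X 1 ^ 2 * X 2 ^ 2 + X 2 ^ 2 * X 0 ^ 2 - C 4 * (X 0 * X 1 * X 2)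

theorem totalDegree_robinsonPoly_le (n : ℕ) : (robinsonPoly n).totalDegree ≤ 6 := by
  have hadd : ∀ p q : MvPolynomial (Fin (n + 2)) ℝ, p.totalDegree ≤ 6 → q.totalDegree ≤ 6 →
      (p + q).totalDegree ≤ 6 := fun p q hp hq => (totalDegree_add p q).trans (max_le hp hq)
  have hsub : ∀ p q : MvPolynomial (Fin (n + 2)) ℝ, p.totalDegree ≤ 6 → q.totalDegree ≤ 6 →
      (p - q).totalDegree ≤ 6 := fun p q hp hq => (totalDegree_sub p q).trans (max_le hp hq)
  have hX : ∀ (i : Fin (n + 2)) a, a ≤ 6 →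
      (X i ^ a : MvPolynomial (Fin (n + 2)) ℝ).totalDegree ≤ 6 :=
    fun i a h => (totalDegree_X_pow i a).le.trans h
  have hXX : ∀ (i j : Fin (n + 2)) a b, a + b ≤ 6 →
      (X i ^ a * X j ^ b : MvPolynomial (Fin (n + 2)) ℝ).totalDegree ≤ 6 :=
    fun i j a b h => ((totalDegree_mul _ _).trans
      (add_le_add (totalDegree_X_pow i a).le (totalDegree_X_pow j b).le)).trans h
  have hC : (C 3 * (X 0 ^ 2 * X 1 ^ 2) : MvPolynomial (Fin (n + 2)) ℝ).totalDegree ≤ 6 :=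
    (totalDegree_mul _ _).trans (by rw [totalDegree_C, zero_add]; exact hXX 0 1 2 2 (by norm_num))
  have h1 : (1 : MvPolynomial (Fin (n + 2)) ℝ).totalDegree ≤ 6 := totalDegree_one.le.trans (by simp)
  exact hadd _ _ (hsub _ _ (hsub _ _ (hsub _ _ (hsub _ _ (hsub _ _ (hsub _ _ (hadd _ _
    (hadd _ _ (hX 0 6 le_rfl) (hX 1 6 le_rfl)) h1) (hXX 0 1 4 2 (by norm_num)))
    (hXX 0 1 2 4 (by norm_num))) (hX 0 4 (by norm_num))) (hX 1 4 (by norm_num)))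
    (hX 0 2 (by norm_num))) (hX 1 2 (by norm_num))) hC

theorem totalDegree_choiLamPoly_le (n : ℕ) : (choiLamPoly n).totalDegree ≤ 4 := by
  have hadd : ∀ p q : MvPolynomial (Fin (n + 3)) ℝ, p.totalDegree ≤ 4 → q.totalDegree ≤ 4 →
      (p + q).totalDegree ≤ 4 := fun p q hp hq => (totalDegree_add p q).trans (max_le hp hq)
  have hXX : ∀ i j : Fin (n + 3),
      (X i ^ 2 * X j ^ 2 : MvPolynomial (Fin (n + 3)) ℝ).totalDegree ≤ 4 :=
    fun i j => (totalDegree_mul _ _).trans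
      (add_le_add (totalDegree_X_pow i 2).le (totalDegree_X_pow j 2).le)
  have hC : (C 4 * (X 0 * X 1 * X 2) : MvPolynomial (Fin (n + 3)) ℝ).totalDegree ≤ 4 := by
    refine (totalDegree_mul _ _).trans ?_
    rw [totalDegree_C, zero_add]
    exact ((totalDegree_mul _ _).trans (add_le_add ((totalDegree_mul _ _).trans
      (add_le_add (totalDegree_X 0).le (totalDegree_X 1).le)) (totalDegree_X 2).le)).trans
      (by norm_num)
  have h1 : (1 : MvPolynomial (Fin (n + 3)) ℝ).totalDegree ≤ 4 := totalDegree_one.le.trans (by simp)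
  exact (totalDegree_sub _ _).trans (max_le
    (hadd _ _ (hadd _ _ (hadd _ _ h1 (hXX 0 1)) (hXX 1 2)) (hXX 2 0)) hC)

theorem eval_robinsonPoly {n : ℕ} (v : Fin (n + 2) → ℝ) : eval v (robinsonPoly n) =
    v 0 ^ 6 + v 1 ^ 6 + 1 - v 0 ^ 4 * v 1 ^ 2 - v 0 ^ 2 * v 1 ^ 4 - v 0 ^ 4 - v 1 ^ 4 - v 0 ^ 2
    - v 1 ^ 2 + 3 * (v 0 ^ 2 * v 1 ^ 2) := by
  simp [robinsonPoly]

theorem eval_choiLamPoly {n : ℕ} (v : Fin (n + 3) → ℝ) : eval v (choiLamPoly n) =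
    1 + v 0 ^ 2 * v 1 ^ 2 + v 1 ^ 2 * v 2 ^ 2 + v 2 ^ 2 * v 0 ^ 2 - 4 * (v 0 * v 1 * v 2) := by
  simp [choiLamPoly]

theorem eval_robinsonPoly_nonneg {n : ℕ} (v : Fin (n + 2) → ℝ) : 0 ≤ eval v (robinsonPoly n) := by
  rw [eval_robinsonPoly]
  generalize v 0 = x
  generalize v 1 = y
  rcases (by positivity : 0 ≤ x ^ 2 + y ^ 2).eq_or_lt with h | h
  · have hx : x = 0 := by nlinarith [sq_nonneg x, sq_nonneg y]
    have hy : y = 0 := by nlinarith [sq_nonneg x, sq_nonneg y]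
    simp [hx, hy]
  · refine nonneg_of_mul_nonneg_right ?_ h
    rw [show (x ^ 2 + y ^ 2) * (x ^ 6 + y ^ 6 + 1 - x ^ 4 * y ^ 2 - x ^ 2 * y ^ 4 - x ^ 4 - y ^ 4
      - x ^ 2 - y ^ 2 + 3 * (x ^ 2 * y ^ 2)) = ((x ^ 2 - y ^ 2) * (x ^ 2 + y ^ 2 - 1)) ^ 2 +
      (x * (x ^ 2 - 1)) ^ 2 + (y * (y ^ 2 - 1)) ^ 2 by ring]
    positivity

theorem eval_choiLamPoly_nonneg {n : ℕ} (v : Fin (n + 3) → ℝ) : 0 ≤ eval v (choiLamPoly n) := by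
  rw [eval_choiLamPoly]
  generalize v 0 = x
  generalize v 1 = y
  generalize v 2 = z
  rcases (by positivity : 0 ≤ x ^ 2 + y ^ 2).eq_or_lt with h | h
  · have hx : x = 0 := by nlinarith [sq_nonneg x, sq_nonneg y]
    have hy : y = 0 := by nlinarith [sq_nonneg x, sq_nonneg y]
    simp [hx, hy]
  · refine nonneg_of_mul_nonneg_right ?_ h
    rw [show (x ^ 2 + y ^ 2) * (1 + x ^ 2 * y ^ 2 + y ^ 2 * z ^ 2 + z ^ 2 * x ^ 2
      - 4 * (x * y * z)) = ((x ^ 2 + y ^ 2) * z - 2 * x * y) ^ 2 +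
      (x * (1 - y ^ 2)) ^ 2 + (y * (1 - x ^ 2)) ^ 2 by ring]
    positivity

theorem eval_sq_le_of_eq_sum_sq {σ J : Type*} [Fintype J] {p : MvPolynomial σ ℝ}
    {q : J → MvPolynomial σ ℝ} (h : p = ∑ j, q j ^ 2) (j : J) (v : σ → ℝ) :
    eval v (q j) ^ 2 ≤ eval v p := by
  rw [h, map_sum]
  simp only [map_pow]
  exact Finset.single_le_sum (f := fun j => eval v (q j) ^ 2) (fun _ _ => sq_nonneg _)
    (Finset.mem_univ j)

theorem robinsonPoly_ne_sum_sq {n : ℕ} {J : Type*} [Fintype J]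
    (q : J → MvPolynomial (Fin (n + 2)) ℝ) : robinsonPoly n ≠ ∑ j, q j ^ 2 := by
  intro h
  let s : Fin 3 → ℝ := ![-1, 0, 1]
  let w : Fin 3 → ℝ := ![1, -2, 1]
  let P : Fin 3 × Fin 3 → Fin (n + 2) → ℝ := fun k => Fin.cons (s k.1) (Fin.cons (s k.2) 0)
  have hP0 : ∀ k, P k 0 = s k.1 := fun k => rfl
  have hP1 : ∀ k, P k 1 = s k.2 := fun k => rfl
  have hq0 : ∀ j, eval (P (1, 1)) (q j) = 0 := by
    intro j
    have hrel := sum_mul_eval_eq_zero (e := 3) (fun k => w k.1 * w k.2) P (by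
      intro a ha
      rw [Fin.sum_univ_succ, Fin.sum_univ_succ] at ha
      have h0 : a 0 + a 1 ≤ 3 := by
        have : a (Fin.succ 0) = a 1 := rfl
        omega
      simp only [Fin.prod_univ_succ (n := n + 1), Fin.prod_univ_succ (n := n), P, Fin.cons_zero,
        Fin.cons_succ, Fintype.sum_prod_type]
      have h1 : a (Fin.succ 0) = a 1 := rfl
      rw [h1]
      generalize (∏ i : Fin n, (0 : Fin n → ℝ) i ^ a i.succ.succ) = c
      have hfac : ∑ i, ∑ j, w i * w j * (s i ^ a 0 * (s j ^ a 1 * c)) =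
          (∑ i, w i * s i ^ a 0) * (∑ j, w j * s j ^ a 1) * c := by
        rw [Finset.sum_mul_sum, Finset.sum_mul]
        refine Finset.sum_congr rfl fun i _ => ?_
        rw [Finset.sum_mul]
        exact Finset.sum_congr rfl fun j _ => by ring
      rw [hfac]
      have hsmall : ∀ b : ℕ, b ≤ 1 → ∑ i, w i * s i ^ b = 0 := by
        intro b hb
        interval_cases b <;> simp [w, s, Fin.sum_univ_succ] <;> norm_num
      rcases (by omega : a 0 ≤ 1 ∨ a 1 ≤ 1) with h | h
      · rw [hsmall _ h]; ring
      · rw [hsmall _ h]; ring)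
      (totalDegree_le_of_eq_sum_sq (e := 3) (totalDegree_robinsonPoly_le n) h j)
    have hzero : ∀ k, eval (P k) (robinsonPoly n) = 0 → eval (P k) (q j) = 0 := fun k hk => by
      have := eval_sq_le_of_eq_sum_sq h j (P k)
      rw [hk] at this
      exact pow_eq_zero_iff two_ne_zero |>.1 (le_antisymm this (sq_nonneg _))
    have hz : ∀ k, k ≠ (1, 1) → eval (P k) (q j) = 0 := fun k hk => hzero k (by
      rw [eval_robinsonPoly, hP0, hP1]
      obtain ⟨a, b⟩ := k
      fin_cases a <;> fin_cases b <;> simp [s] at hk ⊢ <;> norm_num)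
    rw [Finset.sum_eq_single (1, 1) (fun k _ hk => by rw [hz k hk, mul_zero]) (by simp)] at hrel
    simpa [w] using hrel
  have h1 : eval (P (1, 1)) (robinsonPoly n) = 0 := by
    rw [h, map_sum]
    simp [hq0]
  rw [eval_robinsonPoly, hP0, hP1] at h1
  simp [s] at h1

theorem choiLamPoly_ne_sum_sq {n : ℕ} {J : Type*} [Fintype J]
    (q : J → MvPolynomial (Fin (n + 3)) ℝ) : choiLamPoly n ≠ ∑ j, q j ^ 2 := by
  intro h
  let P : ℝ → ℝ → ℝ → Fin (n + 3) → ℝ := fun x y z => Fin.cons x (Fin.cons y (Fin.cons z 0))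
  have hP0 : ∀ x y z, P x y z 0 = x := fun x y z => rfl
  have hP1 : ∀ x y z, P x y z 1 = y := fun x y z => rfl
  have hP2 : ∀ x y z, P x y z 2 = z := fun x y z => rfl
  have hprod : ∀ x y z (a : Fin (n + 3) → ℕ), ∏ i, P x y z i ^ a i =
      x ^ a 0 * (y ^ a 1 * (z ^ a 2 * ∏ i : Fin n, (0 : ℝ) ^ a i.succ.succ.succ)) := by
    intro x y z a
    simp only [Fin.prod_univ_succ (n := n + 2), Fin.prod_univ_succ (n := n + 1),
      Fin.prod_univ_succ (n := n), P, Fin.cons_zero, Fin.cons_succ]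
    rfl
  have hsum : ∀ a : Fin (n + 3) → ℕ, ∑ i, a i ≤ 2 → a 0 + a 1 + a 2 ≤ 2 := by
    intro a ha
    rw [Fin.sum_univ_succ, Fin.sum_univ_succ, Fin.sum_univ_succ] at ha
    have h1 : a (Fin.succ 0) = a 1 := rfl
    have h2 : a (Fin.succ (Fin.succ 0)) = a 2 := rfl
    omega
  have hq0 : ∀ j, eval (P 0 0 0) (q j) = 0 := by
    intro j
    have hd := totalDegree_le_of_eq_sum_sq (e := 2) (totalDegree_choiLamPoly_le n) h j
    have hsq := eval_sq_le_of_eq_sum_sq h j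
    have haxis : ∀ x y z : ℝ, (∀ t : ℝ, eval (P (t * x) (t * y) (t * z)) (choiLamPoly n) = 1) →
        eval (P x y z) (q j) + eval (P (-x) (-y) (-z)) (q j) = 2 * eval (P 0 0 0) (q j) := by
      intro x y z hxyz
      have hb : ∀ t : ℝ, |eval (P (t * x) (t * y) (t * z)) (q j)| ≤ 1 := fun t => by
        have := hsq (P (t * x) (t * y) (t * z))
        rw [hxyz t] at this
        exact (sq_le_one_iff_abs_le_one _).1 this
      have hrel : ∀ t : ℝ, _ := fun t => sum_mul_eval_eq_zero (e := 2)
        ![1, 1, -2, -t ^ 2, -t ^ 2, 2 * t ^ 2]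
        ![P (t * x) (t * y) (t * z), P (-t * x) (-t * y) (-t * z), P 0 0 0,
          P x y z, P (-x) (-y) (-z), P 0 0 0] (by
        intro a ha
        have ha' := hsum a ha
        simp only [Fin.sum_univ_six, Matrix.cons_val]
        simp only [hprod]
        generalize (∏ i : Fin n, (0 : ℝ) ^ a i.succ.succ.succ) = c
        generalize a 0 = a0 at *
        generalize a 1 = a1 at *
        generalize a 2 = a2 at *
        have h0 : a0 ≤ 2 := by omega
        have h1 : a1 ≤ 2 := by omega
        have h2 : a2 ≤ 2 := by omega
        interval_cases a0 <;> interval_cases a1 <;> interval_cases a2 <;> first | omega | ring) hd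
      simp only [Fin.sum_univ_six, Matrix.cons_val] at hrel
      by_contra hne
      set c := eval (P x y z) (q j) + eval (P (-x) (-y) (-z)) (q j) - 2 * eval (P 0 0 0) (q j)
        with hc
      have hc0 : 0 < |c| := abs_pos.2 (sub_ne_zero.2 hne)
      have hb0 := abs_le.1 (hb 0)
      simp only [zero_mul] at hb0
      have hkey : ∀ t : ℝ, t ^ 2 * |c| ≤ 4 := fun t => by
        have h1 := abs_le.1 (hb t)
        have h2 := abs_le.1 (hb (-t))
        have h3 := hrel t
        rw [← abs_of_nonneg (sq_nonneg t), ← abs_mul, abs_le]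
        constructor <;> (rw [hc]; linarith)
      have h5 := hkey (3 / √|c|)
      rw [div_pow, Real.sq_sqrt hc0.le, div_mul_cancel₀ _ hc0.ne'] at h5
      norm_num at h5
    have hx := haxis 1 0 0 (fun t => by simp [eval_choiLamPoly, hP0, hP1, hP2])
    have hy := haxis 0 1 0 (fun t => by simp [eval_choiLamPoly, hP0, hP1, hP2])
    have hz := haxis 0 0 1 (fun t => by simp [eval_choiLamPoly, hP0, hP1, hP2])
    have hzero : ∀ x y z, eval (P x y z) (choiLamPoly n) = 0 → eval (P x y z) (q j) = 0 :=
      fun x y z hk => by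
        have := hsq (P x y z)
        rw [hk] at this
        exact pow_eq_zero_iff two_ne_zero |>.1 (le_antisymm this (sq_nonneg _))
    have z1 := hzero 1 1 1 (by rw [eval_choiLamPoly, hP0, hP1, hP2]; norm_num)
    have z2 := hzero 1 (-1) (-1) (by rw [eval_choiLamPoly, hP0, hP1, hP2]; norm_num)
    have z3 := hzero (-1) 1 (-1) (by rw [eval_choiLamPoly, hP0, hP1, hP2]; norm_num)
    have z4 := hzero (-1) (-1) 1 (by rw [eval_choiLamPoly, hP0, hP1, hP2]; norm_num)
    have hrel := sum_mul_eval_eq_zero (e := 2) (Sum.elim ![1, 1, 1, 1, 8] ![-2, -2, -2, -2, -2, -2])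
      (Sum.elim ![P 1 1 1, P 1 (-1) (-1), P (-1) 1 (-1), P (-1) (-1) 1, P 0 0 0]
        ![P 1 0 0, P (-1) (-0) (-0), P 0 1 0, P (-0) (-1) (-0), P 0 0 1, P (-0) (-0) (-1)]) (by
        intro a ha
        have ha' := hsum a ha
        simp only [Fintype.sum_sum_type, Sum.elim_inl, Sum.elim_inr, Fin.sum_univ_six,
          Fin.sum_univ_five, Matrix.cons_val]
        simp only [hprod]
        generalize (∏ i : Fin n, (0 : ℝ) ^ a i.succ.succ.succ) = c
        generalize a 0 = a0 at *
        generalize a 1 = a1 at *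
        generalize a 2 = a2 at *
        have h0 : a0 ≤ 2 := by omega
        have h1 : a1 ≤ 2 := by omega
        have h2 : a2 ≤ 2 := by omega
        interval_cases a0 <;> interval_cases a1 <;> interval_cases a2 <;> first | omega | ring) hd
    simp only [Fintype.sum_sum_type, Sum.elim_inl, Sum.elim_inr, Fin.sum_univ_six,
      Fin.sum_univ_five, Matrix.cons_val] at hrel
    linarith
  have h1 : eval (P 0 0 0) (choiLamPoly n) = 0 := by
    rw [h, map_sum]
    simp [hq0]
  rw [eval_choiLamPoly, hP0, hP1, hP2] at h1
  norm_num at h1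

theorem not_hasLift {n d : ℕ} (h : 2 ≤ n ∧ 2 ≤ d ∧ (n, d) ≠ (2, 2)) (k m : ℕ) :
    ¬ HasLift (PSDTuple k m) (closure (coneHull (Set.range (monVec n (2 * d))))) := by
  intro hl
  obtain ⟨hn, hd, hnd⟩ := h
  by_cases hd3 : 3 ≤ d
  · obtain ⟨n, rfl⟩ := Nat.exists_eq_add_of_le' hn
    obtain ⟨q, hq⟩ := hl.exists_eq_sum_sq
      ((totalDegree_robinsonPoly_le n).trans (by omega)) eval_robinsonPoly_nonneg
    exact robinsonPoly_ne_sum_sq q hq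
  · have hn3 : 3 ≤ n := by
      by_contra hn3
      exact hnd (by rw [show n = 2 by omega, show d = 2 by omega])
    obtain ⟨n, rfl⟩ := Nat.exists_eq_add_of_le' hn3
    obtain ⟨q, hq⟩ := hl.exists_eq_sum_sq
      ((totalDegree_choiLamPoly_le n).trans (by omega)) eval_choiLamPoly_nonneg
    exact choiLamPoly_ne_sum_sq q hq

end NotSumSq

section UpperBound

open Filter Topology Matrix

variable {n d : ℕ}

/-- Every nonzero nonnegative polynomial of degree at most `2 * d` dominates a nonzero square. -/
def HasSquareMinorants (n d : ℕ) : Prop :=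
  ∀ p : MvPolynomial (Fin n) ℝ, p.totalDegree ≤ 2 * d → (∀ x, 0 ≤ eval x p) → p ≠ 0 →
    ∃ q : MvPolynomial (Fin n) ℝ, q ≠ 0 ∧ q.totalDegree ≤ d ∧ ∀ x, eval x q ^ 2 ≤ eval x p

theorem exists_finset_eval_eq_zero (n D : ℕ) : ∃ T : Finset (Fin n → ℝ),
    ∀ p : MvPolynomial (Fin n) ℝ, p.totalDegree ≤ D → (∀ x ∈ T, eval x p = 0) → p = 0 := by
  classical
  let S : Finset ℝ := (Finset.range (D + 1)).image (fun i : ℕ => (i : ℝ))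
  refine ⟨Fintype.piFinset fun _ => S, fun p hp h => ?_⟩
  refine eq_zero_of_eval_zero_at_prod_finset p (fun _ => S) (fun i => ?_)
    fun x hx => h x (Fintype.mem_piFinset.2 hx)
  rw [Finset.card_image_of_injective _ Nat.cast_injective, Finset.card_range]
  exact Nat.lt_succ_of_le ((degreeOf_le_totalDegree p i).trans hp)

theorem HasSquareMinorants.nonneg_of_nonneg_sq (hc : HasSquareMinorants n d)
    (L : MvPolynomial (Fin n) ℝ →ₗ[ℝ] ℝ) (hL : ∀ q, q.totalDegree ≤ d → 0 ≤ L (q ^ 2))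
    {p : MvPolynomial (Fin n) ℝ} (hp : p.totalDegree ≤ 2 * d) (hpos : ∀ x, 0 ≤ eval x p) :
    0 ≤ L p := by
  obtain ⟨T, hT⟩ := exists_finset_eval_eq_zero n (2 * d)
  set Λ : MvPolynomial (Fin n) ℝ →ₗ[ℝ] ℝ := ∑ x ∈ T, (aeval x).toLinearMap with hΛ
  have hΛapply : ∀ q, Λ q = ∑ x ∈ T, eval x q := fun q => by
    simp [hΛ, LinearMap.sum_apply, aeval_eq_eval]
  have hΛpos : ∀ q : MvPolynomial (Fin n) ℝ, q.totalDegree ≤ 2 * d → (∀ x, 0 ≤ eval x q) →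
      q ≠ 0 → 0 < Λ q := fun q hq hq0 hne => by
    rw [hΛapply]
    refine lt_of_le_of_ne (Finset.sum_nonneg fun x _ => hq0 x) fun h => hne (hT q hq fun x hx => ?_)
    exact (Finset.sum_eq_zero_iff_of_nonneg fun x _ => hq0 x).1 h.symm x hx
  by_contra! hneg
  have hp0 : p ≠ 0 := fun h => by simp [h] at hneg
  let B : Set (lowExponents n (2 * d) → ℝ) :=
    {c | (∀ x, 0 ≤ eval x (lowPoly n (2 * d) c)) ∧ Λ (lowPoly n (2 * d) c) = 1}
  have hcont : ∀ f : MvPolynomial (Fin n) ℝ →ₗ[ℝ] ℝ,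
      Continuous fun c => f (lowPoly n (2 * d) c) := fun f =>
    LinearMap.continuous_of_finiteDimensional (f ∘ₗ lowPoly n (2 * d))
  have hBclosed : IsClosed B := by
    have h1 : IsClosed {c : lowExponents n (2 * d) → ℝ |
        ∀ x, 0 ≤ eval x (lowPoly n (2 * d) c)} := by
      have : {c : lowExponents n (2 * d) → ℝ | ∀ x, 0 ≤ eval x (lowPoly n (2 * d) c)} =
          ⋂ x : Fin n → ℝ, {c | 0 ≤ (aeval x : MvPolynomial (Fin n) ℝ →ₐ[ℝ] ℝ).toLinearMap
            (lowPoly n (2 * d) c)} := by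
        ext c; simp [aeval_eq_eval]
      rw [this]
      exact isClosed_iInter fun x => isClosed_le continuous_const (hcont _)
    exact h1.inter (isClosed_eq (hcont Λ) continuous_const)
  let ev : (lowExponents n (2 * d) → ℝ) →ₗ[ℝ] (T → ℝ) :=
    LinearMap.pi fun x => (aeval x.1).toLinearMap ∘ₗ lowPoly n (2 * d)
  have hev : ∀ c x, ev c x = eval x.1 (lowPoly n (2 * d) c) := fun c x => by
    simp [ev, aeval_eq_eval]
  have hker : LinearMap.ker ev = ⊥ := by
    rw [LinearMap.ker_eq_bot']
    intro c h0
    refine lowPoly_injective (2 * d) ?_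
    rw [map_zero]
    exact hT _ (totalDegree_lowPoly_le _ _) fun x hx => by
      rw [← hev c ⟨x, hx⟩, h0]; rfl
  obtain ⟨K, -, hK⟩ := ev.exists_antilipschitzWith hker
  have hBbdd : Bornology.IsBounded B := by
    refine (Metric.isBounded_closedBall (x := 0) (r := (K : ℝ) * 1)).subset fun c hcB => ?_
    rw [mem_closedBall_zero_iff]
    refine (ZeroHomClass.bound_of_antilipschitz ev hK c).trans
      (mul_le_mul_of_nonneg_left ?_ K.2)
    refine (pi_norm_le_iff_of_nonneg zero_le_one).2 fun x => ?_
    rw [hev, Real.norm_of_nonneg (hcB.1 _), ← hcB.2, hΛapply]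
    exact Finset.single_le_sum (f := fun x => eval x (lowPoly n (2 * d) c)) (fun x _ => hcB.1 x) x.2
  have hBcomp : IsCompact B := Metric.isCompact_of_isClosed_isBounded hBclosed hBbdd
  have hmemB : ∀ q : MvPolynomial (Fin n) ℝ, q.totalDegree ≤ 2 * d → (∀ x, 0 ≤ eval x q) →
      q ≠ 0 → ∃ c ∈ B, lowPoly n (2 * d) c = (Λ q)⁻¹ • q := fun q hq hq0 hne => by
    have hpos := hΛpos q hq hq0 hne
    have hdeg : ((Λ q)⁻¹ • q).totalDegree ≤ 2 * d := (totalDegree_smul_le _ _).trans hq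
    refine ⟨fun a => coeff a.1 ((Λ q)⁻¹ • q), ⟨fun x => ?_, ?_⟩, lowPoly_coeff hdeg⟩
    · rw [lowPoly_coeff hdeg, smul_eval]
      exact mul_nonneg (inv_nonneg.2 hpos.le) (hq0 x)
    · rw [lowPoly_coeff hdeg, map_smul, smul_eq_mul, inv_mul_cancel₀ hpos.ne']
  obtain ⟨c₀, hc₀, hc₀p⟩ := hmemB p hp hpos hp0
  obtain ⟨c₁, hc₁, hmin⟩ := hBcomp.exists_isMinOn ⟨c₀, hc₀⟩ (hcont L).continuousOn
  set F := lowPoly n (2 * d) c₁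
  have hLF : L F < 0 := by
    have h1 : L F ≤ L (lowPoly n (2 * d) c₀) := hmin hc₀
    refine h1.trans_lt ?_
    rw [hc₀p, map_smul, smul_eq_mul]
    exact mul_neg_of_pos_of_neg (inv_pos.2 (hΛpos p hp hpos hp0)) hneg
  have hminq : ∀ q : MvPolynomial (Fin n) ℝ, q.totalDegree ≤ 2 * d → (∀ x, 0 ≤ eval x q) →
      Λ q * L F ≤ L q := fun q hq hq0 => by
    rcases eq_or_ne q 0 with rfl | hne
    · simp
    obtain ⟨c, hcB, hcq⟩ := hmemB q hq hq0 hne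
    have h1 : L F ≤ L (lowPoly n (2 * d) c) := hmin hcB
    have h2 := hΛpos q hq hq0 hne
    rw [hcq, map_smul, smul_eq_mul] at h1
    calc Λ q * L F ≤ Λ q * ((Λ q)⁻¹ * L q) := mul_le_mul_of_nonneg_left h1 h2.le
      _ = L q := mul_inv_cancel_left₀ h2.ne' _
  have hF0 : F ≠ 0 := fun h => by simp [h] at hLF
  have hFdeg : F.totalDegree ≤ 2 * d := totalDegree_lowPoly_le _ _
  obtain ⟨q, hq0, hqd, hqF⟩ := hc F hFdeg hc₁.1 hF0
  have hq2deg : (q ^ 2).totalDegree ≤ 2 * d :=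
    (totalDegree_pow _ _).trans (Nat.mul_le_mul_left 2 hqd)
  have h1 := hminq (F - q ^ 2) ((totalDegree_sub _ _).trans (max_le hFdeg hq2deg)) fun x => by
    rw [map_sub, map_pow]; exact sub_nonneg.2 (hqF x)
  have h2 := hΛpos (q ^ 2) hq2deg (fun x => by rw [map_pow]; exact sq_nonneg _)
    (pow_ne_zero 2 hq0)
  have h3 : Λ F = 1 := hc₁.2
  rw [map_sub, map_sub, h3] at h1
  nlinarith [hL q hqd]

theorem coneHull_add_mem {V : Type*} [AddCommGroup V] [Module ℝ V] {s : Set V} {x y : V}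
    (hx : x ∈ coneHull s) (hy : y ∈ coneHull s) : x + y ∈ coneHull s := by
  obtain ⟨r, c, v, hc, hv, rfl⟩ := hx
  obtain ⟨r', c', v', hc', hv', rfl⟩ := hy
  refine ⟨r + r', Fin.append c c', Fin.append v v', fun i => ?_, fun i => ?_, ?_⟩
  · refine Fin.addCases (fun i => ?_) (fun i => ?_) i <;> simp [hc, hc']
  · refine Fin.addCases (fun i => ?_) (fun i => ?_) i <;> simp [hv, hv']
  · simp [Fin.sum_univ_add]

theorem coneHull_smul_mem {V : Type*} [AddCommGroup V] [Module ℝ V] {s : Set V} {x : V} {t : ℝ}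
    (ht : 0 ≤ t) (hx : x ∈ coneHull s) : t • x ∈ coneHull s := by
  obtain ⟨r, c, v, hc, hv, rfl⟩ := hx
  refine ⟨r, fun i => t * c i, v, fun i => mul_nonneg ht (hc i), hv, ?_⟩
  rw [Finset.smul_sum]
  simp only [mul_smul]

/-- The Riesz functional of a sequence of moments. -/
noncomputable def rieszFunctional (y : (Fin n →₀ ℕ) → ℝ) : MvPolynomial (Fin n) ℝ →ₗ[ℝ] ℝ :=
  (basisMonomials (Fin n) ℝ).constr ℝ y

theorem rieszFunctional_monomial (y : (Fin n →₀ ℕ) → ℝ) (a : Fin n →₀ ℕ) (r : ℝ) :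
    rieszFunctional y (monomial a r) = r * y a := by
  have h := (basisMonomials (Fin n) ℝ).constr_basis ℝ y a
  rw [coe_basisMonomials] at h
  rw [show (monomial a r : MvPolynomial (Fin n) ℝ) = r • monomial a 1 by simp [smul_monomial],
    map_smul, smul_eq_mul]
  exact congrArg _ h

theorem rieszFunctional_lowPoly (y : (Fin n →₀ ℕ) → ℝ) (c : lowExponents n d → ℝ) :
    rieszFunctional y (lowPoly n d c) = ∑ a, c a * y a.1 := by
  rw [lowPoly_apply, map_sum]
  simp only [rieszFunctional_monomial]

theorem rieszFunctional_lowPoly_sq (y : (Fin n →₀ ℕ) → ℝ) (c : lowExponents n d → ℝ) :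
    rieszFunctional y (lowPoly n d c ^ 2) = ∑ a, ∑ b, c a * c b * y (a.1 + b.1) := by
  rw [lowPoly_apply, pow_two, Finset.sum_mul_sum, map_sum]
  simp only [map_sum, monomial_mul, rieszFunctional_monomial]

theorem eval_lowPoly (x : Fin n → ℝ) (c : lowExponents n d → ℝ) :
    eval x (lowPoly n d c) = ∑ a, c a * monVec n d x a.1 := by
  rw [lowPoly_apply, map_sum]
  refine Finset.sum_congr rfl fun a _ => ?_
  rw [eval_monomial, monVec, if_pos (mem_lowExponents.1 a.2), Finsupp.prod_fintype _ _ (by simp)]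

theorem add_mem_lowExponents {a b : Fin n →₀ ℕ} {e : ℕ} (ha : a ∈ lowExponents n d)
    (hb : b ∈ lowExponents n e) : a + b ∈ lowExponents n (d + e) := by
  rw [mem_lowExponents] at *
  rw [Finsupp.sum_add_index' (fun _ => rfl) fun _ _ _ => rfl]
  omega

theorem exists_add_eq_of_mem_lowExponents {a : Fin n →₀ ℕ} (ha : a ∈ lowExponents n (2 * d)) :
    ∃ b ∈ lowExponents n d, ∃ c ∈ lowExponents n d, b + c = a := by
  have ha' : a.degree ≤ 2 * d := mem_lowExponents.1 ha
  obtain ⟨b, hba, hb⟩ := a.exists_le_degree_eq (min a.degree d) (min_le_left _ _)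
  have hadd : b + (a - b) = a := add_tsub_cancel_of_le hba
  have h := congrArg Finsupp.degree hadd
  rw [map_add] at h
  refine ⟨b, mem_lowExponents.2 ?_, a - b, mem_lowExponents.2 ?_, hadd⟩
  · change b.degree ≤ d
    omega
  · change (a - b).degree ≤ d
    omega

/-- Under the minorant property the moment cone is cut out by its moment matrix. -/
theorem HasSquareMinorants.mem_momentCone_iff (hc : HasSquareMinorants n d)
    (y : (Fin n →₀ ℕ) → ℝ) : y ∈ closure (coneHull (Set.range (monVec n (2 * d)))) ↔
      (∀ a ∉ lowExponents n (2 * d), y a = 0) ∧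
        ∀ c : lowExponents n d → ℝ, 0 ≤ ∑ a, ∑ b, c a * c b * y (a.1 + b.1) := by
  constructor
  · intro hy
    refine closure_minimal (s := coneHull (Set.range (monVec n (2 * d))))
      (t := {y | (∀ a ∉ lowExponents n (2 * d), y a = 0) ∧
        ∀ c : lowExponents n d → ℝ, 0 ≤ ∑ a, ∑ b, c a * c b * y (a.1 + b.1)}) ?_ ?_ hy
    · rintro _ ⟨r, t, v, ht, hv, rfl⟩
      choose x hx using hv
      refine ⟨fun a ha => ?_, fun c => ?_⟩
      · rw [Finset.sum_apply]
        refine Finset.sum_eq_zero fun i _ => ?_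
        rw [Pi.smul_apply, ← hx, monVec, if_neg (fun h => ha (mem_lowExponents.2 h)), smul_zero]
      · have h1 : ∀ i, ∑ a, ∑ b, c a * c b * v i (a.1 + b.1) = eval (x i) (lowPoly n d c) ^ 2 := by
          intro i
          rw [eval_lowPoly, pow_two, Finset.sum_mul_sum]
          refine Finset.sum_congr rfl fun a _ => Finset.sum_congr rfl fun b _ => ?_
          have h2 := mem_lowExponents.1 (two_mul d ▸ add_mem_lowExponents a.2 b.2)
          rw [← hx, monVec, if_pos h2, monVec, monVec, if_pos (mem_lowExponents.1 a.2),
            if_pos (mem_lowExponents.1 b.2)]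
          simp only [Finsupp.add_apply, pow_add, Finset.prod_mul_distrib]
          ring
        have h3 : ∑ a, ∑ b, c a * c b * (∑ i, t i • v i) (a.1 + b.1) =
            ∑ i, t i * ∑ a, ∑ b, c a * c b * v i (a.1 + b.1) := by
          simp only [Finset.sum_apply, Pi.smul_apply, smul_eq_mul, Finset.mul_sum]
          symm
          rw [Finset.sum_comm]
          refine Finset.sum_congr rfl fun a _ => ?_
          rw [Finset.sum_comm]
          exact Finset.sum_congr rfl fun b _ => Finset.sum_congr rfl fun i _ => by ring
        rw [h3]
        exact Finset.sum_nonneg fun i _ => mul_nonneg (ht i) (by rw [h1]; exact sq_nonneg _)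
    · have h1 : IsClosed {y : (Fin n →₀ ℕ) → ℝ | ∀ a ∉ lowExponents n (2 * d), y a = 0} := by
        simp only [Set.ofPred_forall]
        exact isClosed_iInter fun a => isClosed_iInter fun _ =>
          isClosed_eq (continuous_apply a) continuous_const
      have h2 : IsClosed {y : (Fin n →₀ ℕ) → ℝ | ∀ c : lowExponents n d → ℝ,
          0 ≤ ∑ a, ∑ b, c a * c b * y (a.1 + b.1)} := by
        simp only [Set.ofPred_forall]
        exact isClosed_iInter fun c => isClosed_le continuous_const (by fun_prop)
      exact h1.inter h2
  · rintro ⟨hsupp, hpsd⟩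
    by_contra hy
    classical
    obtain ⟨f, hfy, hf⟩ := exists_clm_neg_of_notMem_closure
      (fun _ hx _ hy => coneHull_add_mem hx hy) (fun t ht _ hx => coneHull_smul_mem ht hx)
      ⟨0, 0, 0, 0, by simp, by simp, by simp⟩ hy
    have hsum : ∀ z : (Fin n →₀ ℕ) → ℝ, (∀ a ∉ lowExponents n (2 * d), z a = 0) →
        f z = ∑ a : lowExponents n (2 * d), f (Pi.single a.1 1) * z a.1 := fun z hz => by
      have h1 : z = ∑ a : lowExponents n (2 * d), z a.1 • Pi.single a.1 (1 : ℝ) := by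
        rw [Finset.sum_coe_sort (lowExponents n (2 * d)) fun a => z a • Pi.single a (1 : ℝ)]
        funext b
        rw [Finset.sum_apply]
        by_cases hb : b ∈ lowExponents n (2 * d)
        · rw [Finset.sum_eq_single b]
          · simp
          · intro a _ hab
            simp [hab.symm]
          · exact fun h => absurd hb h
        · rw [hz b hb]
          refine (Finset.sum_eq_zero fun a ha => ?_).symm
          have : b ≠ a := fun h => hb (h ▸ ha)
          simp [this]
      conv_lhs => rw [h1]
      rw [map_sum]
      refine Finset.sum_congr rfl fun a _ => ?_
      rw [map_smul, smul_eq_mul, mul_comm]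
    have hnn := hc.nonneg_of_nonneg_sq (rieszFunctional y) (fun q hq => by
      rw [← lowPoly_coeff hq, rieszFunctional_lowPoly_sq]
      exact hpsd _) (p := lowPoly n (2 * d) fun a => f (Pi.single a.1 1))
      (totalDegree_lowPoly_le _ _) (fun x => by
        rw [eval_lowPoly, ← hsum]
        · exact hf _ ⟨1, fun _ => 1, fun _ => monVec n (2 * d) x, by simp, by simp, by simp⟩
        · exact fun a ha => if_neg fun h => ha (mem_lowExponents.2 h))
    rw [rieszFunctional_lowPoly, ← hsum y hsupp] at hnn
    exact absurd hnn (not_le.2 hfy)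

theorem HasSquareMinorants.hasLift (hc : HasSquareMinorants n d) :
    HasLift (PSDCone ((n + d).choose n)) (closure (coneHull (Set.range (monVec n (2 * d))))) := by
  classical
  set N := (n + d).choose n
  let e : Fin N ≃ lowExponents n d :=
    (Fintype.equivFinOfCardEq (by rw [Fintype.card_coe, card_lowExponents])).symm
  let H : Submodule ℝ (Matrix (Fin N) (Fin N) ℝ) :=
    { carrier := {A | ∀ i j i' j', (e i).1 + (e j).1 = (e i').1 + (e j').1 → A i j = A i' j'}
      add_mem' := fun {A B} hA hB i j i' j' h => by
        simp only [Matrix.add_apply, hA i j i' j' h, hB i j i' j' h]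
      zero_mem' := fun _ _ _ _ _ => rfl
      smul_mem' := fun c A hA i j i' j' h => by simp only [Matrix.smul_apply, hA i j i' j' h] }
  let P : (Fin n →₀ ℕ) → Fin N × Fin N → Prop := fun a k => (e k.1).1 + (e k.2).1 = a
  let π : Matrix (Fin N) (Fin N) ℝ →ₗ[ℝ] ((Fin n →₀ ℕ) → ℝ) :=
    LinearMap.pi fun a => if h : ∃ k, P a k then
      LinearMap.proj h.choose.2 ∘ₗ LinearMap.proj h.choose.1 else 0
  have hπ0 : ∀ A a, (¬ ∃ k, P a k) → π A a = 0 := fun A a h => by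
    change (if h : ∃ k, P a k then LinearMap.proj h.choose.2 ∘ₗ LinearMap.proj h.choose.1 else 0 :
      Matrix (Fin N) (Fin N) ℝ →ₗ[ℝ] ℝ) A = 0
    rw [dif_neg h]
    rfl
  have hπ : ∀ A a (h : ∃ k, P a k), π A a = A h.choose.1 h.choose.2 := fun A a h => by
    change (if h : ∃ k, P a k then LinearMap.proj h.choose.2 ∘ₗ LinearMap.proj h.choose.1 else 0 :
      Matrix (Fin N) (Fin N) ℝ →ₗ[ℝ] ℝ) A = _
    rw [dif_pos h]
    rfl
  have hex : ∀ a, (∃ k, P a k) ↔ a ∈ lowExponents n (2 * d) := fun a => by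
    constructor
    · rintro ⟨k, hk⟩
      have := add_mem_lowExponents (e k.1).2 (e k.2).2
      rw [← two_mul] at this
      exact hk ▸ this
    · intro ha
      obtain ⟨b, hb, c, hc, hbc⟩ := exists_add_eq_of_mem_lowExponents ha
      exact ⟨(e.symm ⟨b, hb⟩, e.symm ⟨c, hc⟩), by simpa [P] using hbc⟩
  have hquad : ∀ y : (Fin n →₀ ℕ) → ℝ,
      (Matrix.of fun i j => y ((e i).1 + (e j).1) : Matrix (Fin N) (Fin N) ℝ).PosSemidef ↔
      ∀ c : lowExponents n d → ℝ, 0 ≤ ∑ a, ∑ b, c a * c b * y (a.1 + b.1) := by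
    intro y
    have hform : ∀ c : lowExponents n d → ℝ,
        (c ∘ e) ⬝ᵥ (Matrix.of fun i j => y ((e i).1 + (e j).1)).mulVec (c ∘ e) =
        ∑ a, ∑ b, c a * c b * y (a.1 + b.1) := fun c => by
      simp only [dotProduct, Matrix.mulVec, Matrix.of_apply, Finset.mul_sum, Function.comp_apply]
      rw [← e.sum_comp]
      refine Finset.sum_congr rfl fun i _ => ?_
      rw [← e.sum_comp]
      exact Finset.sum_congr rfl fun j _ => by ring
    rw [Matrix.posSemidef_iff_real]
    constructor
    · rintro ⟨-, h⟩ c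
      rw [← hform]
      exact h _
    · intro h
      refine ⟨by ext i j; simp [add_comm], fun v => ?_⟩
      have := hform (v ∘ e.symm)
      rw [show (v ∘ e.symm) ∘ e = v by ext; simp] at this
      rw [this]
      exact h _
  refine ⟨H.toAffineSubspace, π, Set.ext fun y => ?_⟩
  rw [hc.mem_momentCone_iff, ← hquad]
  constructor
  · rintro ⟨hy, hpsd⟩
    refine ⟨_, ⟨hpsd, ?_⟩, ?_⟩
    · intro i j i' j' h
      simp [h]
    · funext a
      by_cases h : ∃ k, P a k
      · rw [hπ _ _ h]
        exact congrArg y h.choose_spec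
      · rw [hπ0 _ _ h, hy a (fun ha => h ((hex a).2 ha))]
  · rintro ⟨A, ⟨hA, hAH⟩, rfl⟩
    refine ⟨fun a ha => hπ0 _ _ fun h => ha ((hex a).1 h), ?_⟩
    have : (Matrix.of fun i j => π A ((e i).1 + (e j).1) : Matrix (Fin N) (Fin N) ℝ) = A := by
      ext i j
      have h : ∃ k, P ((e i).1 + (e j).1) k := ⟨(i, j), rfl⟩
      rw [Matrix.of_apply, hπ _ _ h]
      exact hAH _ _ _ _ h.choose_spec
    rw [this]
    exact hA

end UpperBound

section Univariate

open Polynomial Filter Topology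

theorem nonneg_of_continuous_of_ne {f : ℝ → ℝ} (hf : Continuous f) (r : ℝ)
    (h : ∀ t, t ≠ r → 0 ≤ f t) : 0 ≤ f r := by
  have hcl : IsClosed {t | 0 ≤ f t} := isClosed_le continuous_const hf
  have hd : closure ({r}ᶜ : Set ℝ) ⊆ {t | 0 ≤ f t} :=
    hcl.closure_subset_iff.2 fun t ht => h t ht
  exact hd (by rw [(dense_compl_singleton r).closure_eq]; trivial)

namespace Polynomial

theorem exists_eq_sq_mul_of_isRoot {p : ℝ[X]} (hp0 : p ≠ 0) (hpos : ∀ y, 0 ≤ p.eval y) {r : ℝ}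
    (hr : p.eval r = 0) : ∃ h : ℝ[X], p = (X - C r) ^ 2 * h ∧ h ≠ 0 ∧ (∀ y, 0 ≤ h.eval y) ∧
      p.natDegree = h.natDegree + 2 := by
  have hder : p.derivative.eval r = 0 := by
    have hmin : IsLocalMin (fun y => p.eval y) r :=
      Eventually.of_forall fun y => by simpa [hr] using hpos y
    simpa using hmin.deriv_eq_zero
  have hmult : 1 < p.rootMultiplicity r :=
    (one_lt_rootMultiplicity_iff_isRoot hp0).2 ⟨hr, hder⟩
  obtain ⟨h, hh⟩ := (le_rootMultiplicity_iff hp0).1 (Nat.succ_le_of_lt hmult)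
  have hh0 : h ≠ 0 := by rintro rfl; exact hp0 (by simpa using hh)
  refine ⟨h, hh, hh0, fun y => ?_, ?_⟩
  · have key : ∀ t, t ≠ r → 0 ≤ h.eval t := fun t ht => by
      have h1 := hpos t
      rw [hh] at h1
      simp only [eval_mul, eval_pow, eval_sub, eval_X, eval_C] at h1
      exact nonneg_of_mul_nonneg_right h1 (sq_pos_of_ne_zero (sub_ne_zero.2 ht))
    by_cases hy : y = r
    · exact hy ▸ nonneg_of_continuous_of_ne h.continuous r key
    · exact key y hy
  · rw [hh, natDegree_mul (pow_ne_zero _ (X_sub_C_ne_zero r)) hh0, natDegree_pow, natDegree_X_sub_C]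
    norm_num
    omega

theorem exists_pos_mul_le {a p : ℝ[X]} (ha : a.natDegree ≤ p.natDegree)
    (hp : ∀ y, 0 < p.eval y) : ∃ ε : ℝ, 0 < ε ∧ ∀ y, ε ^ 2 * a.eval y ≤ p.eval y := by
  have hp0 : p ≠ 0 := by rintro rfl; simpa using hp 0
  have hdeg : a.degree ≤ p.degree := by
    rw [degree_eq_natDegree hp0]
    exact degree_le_natDegree.trans (by exact_mod_cast ha)
  have htop := isBigO_atTop_of_degree_le a p hdeg
  have hbot : (fun y => a.eval y) =O[atBot] fun y => p.eval y := by
    have h1 := isBigO_atTop_of_degree_le (a.comp (-X)) (p.comp (-X)) (by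
      rw [degree_eq_natDegree (p := p.comp (-X)) (by
        intro h
        have := hp 0
        have h2 := congrArg (eval 0) h
        simp at h2
        linarith), natDegree_comp]
      refine degree_le_natDegree.trans ?_
      rw [natDegree_comp]
      simpa using ha)
    simpa [Function.comp_def] using h1.comp_tendsto tendsto_neg_atBot_atTop
  have hco := hbot.sup htop
  rw [← cocompact_eq_atBot_atTop] at hco
  obtain ⟨M, hM⟩ := hco.bound
  obtain ⟨K, hK, hKM⟩ := mem_cocompact.1 hM
  obtain ⟨M', hM'⟩ := hK.exists_bound_of_continuousOn (f := fun y => a.eval y / p.eval y)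
    (a.continuous.div p.continuous fun y => (hp y).ne').continuousOn
  set B := max (max M M') 1
  have hB : 0 < B := lt_of_lt_of_le one_pos (le_max_right _ _)
  have hb : ∀ y, a.eval y ≤ B * p.eval y := fun y => by
    by_cases hy : y ∈ K
    · have h1 := (le_abs_self _).trans (hM' y hy)
      rw [div_le_iff₀ (hp y)] at h1
      exact h1.trans (mul_le_mul_of_nonneg_right ((le_max_right _ _).trans (le_max_left _ _))
        (hp y).le)
    · have h1 : ‖a.eval y‖ ≤ M * ‖p.eval y‖ := hKM hy
      rw [Real.norm_of_nonneg (hp y).le] at h1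
      exact ((le_abs_self _).trans h1).trans (mul_le_mul_of_nonneg_right
        ((le_max_left _ _).trans (le_max_left _ _)) (hp y).le)
  refine ⟨(√B)⁻¹, by positivity, fun y => ?_⟩
  rw [inv_pow, Real.sq_sqrt hB.le, inv_mul_le_iff₀ hB]
  exact hb y

/-- A nonnegative univariate polynomial is a square or dominates the product of a given
quadratic polynomial with a nonzero square. -/
theorem eq_sq_or_exists_mul_sq_le {a : ℝ[X]} (ha : a.natDegree ≤ 2) (N : ℕ) :
    ∀ p : ℝ[X], p.natDegree ≤ 2 * N → (∀ y, 0 ≤ p.eval y) → p ≠ 0 →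
      (∃ c : ℝ[X], c.natDegree ≤ N ∧ p = c ^ 2) ∨
      ∃ g : ℝ[X], g ≠ 0 ∧ g.natDegree + 1 ≤ N ∧ ∀ y, a.eval y * g.eval y ^ 2 ≤ p.eval y := by
  induction N with
  | zero =>
    intro p hdeg hpos _
    left
    rw [eq_C_of_natDegree_le_zero hdeg] at hpos ⊢
    refine ⟨C √(p.coeff 0), by simp, ?_⟩
    rw [← C_pow, Real.sq_sqrt (by simpa using hpos 0)]
  | succ N ih =>
    intro p hdeg hpos hp0
    by_cases hroot : ∃ r, p.eval r = 0
    · obtain ⟨r, hr⟩ := hroot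
      obtain ⟨h, rfl, hh0, hh, hd⟩ := exists_eq_sq_mul_of_isRoot hp0 hpos hr
      rcases ih h (by omega) hh hh0 with ⟨c, hc, rfl⟩ | ⟨g, hg0, hg, hle⟩
      · refine Or.inl ⟨(X - C r) * c, ?_, by ring⟩
        exact natDegree_mul_le.trans (by rw [natDegree_X_sub_C]; omega)
      · refine Or.inr ⟨(X - C r) * g, mul_ne_zero (X_sub_C_ne_zero r) hg0, ?_, fun y => ?_⟩
        · have := natDegree_mul_le (p := X - C r) (q := g)
          rw [natDegree_X_sub_C] at this
          omega
        · have := mul_le_mul_of_nonneg_left (hle y) (sq_nonneg (y - r))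
          simp only [eval_mul, eval_sub, eval_X, eval_C, eval_pow]
          linarith
    push Not at hroot
    have hpos' : ∀ y, 0 < p.eval y := fun y => (hpos y).lt_of_ne (hroot y).symm
    by_cases hle : p.natDegree ≤ 2 * N
    · rcases ih p hle hpos hp0 with ⟨c, hc, h⟩ | ⟨g, hg0, hg, h⟩
      · exact Or.inl ⟨c, by omega, h⟩
      · exact Or.inr ⟨g, hg0, by omega, h⟩
    by_cases hle' : p.natDegree < 2
    · obtain ⟨r, hr⟩ := exists_root_of_degree_eq_one
        ((degree_eq_iff_natDegree_eq_of_pos one_pos).2 (by omega : p.natDegree = 1))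
      exact absurd hr (hroot r)
    obtain ⟨ε, hε, h⟩ := exists_pos_mul_le (a := a) (by omega) hpos'
    exact Or.inr ⟨C ε, C_ne_zero.2 hε.ne', by simp, fun y => by
      rw [eval_C, mul_comm]; exact h y⟩

end Polynomial
end Univariate

section EasyMinorants

theorem exists_sq_le_univariate {N : ℕ} {p : Polynomial ℝ} (hdeg : p.natDegree ≤ 2 * N)
    (hpos : ∀ y, 0 ≤ p.eval y) (hp0 : p ≠ 0) :
    ∃ q : Polynomial ℝ, q ≠ 0 ∧ q.natDegree ≤ N ∧ ∀ y, q.eval y ^ 2 ≤ p.eval y := by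
  rcases Polynomial.eq_sq_or_exists_mul_sq_le (a := 1) (by simp) N p hdeg hpos hp0 with
    ⟨c, hc, rfl⟩ | ⟨g, hg0, hg, h⟩
  · exact ⟨c, by rintro rfl; simp at hp0, hc, fun y => by simp⟩
  · exact ⟨g, hg0, by omega, fun y => by simpa using h y⟩

theorem MvPolynomial.eval_polynomial_aeval {σ : Type*} (x : σ → ℝ)
    (f : MvPolynomial σ ℝ) (q : Polynomial ℝ) :
    eval x (Polynomial.aeval f q) = q.eval (eval x f) := by
  induction q using Polynomial.induction_on' with
  | add p q hp hq => simp [hp, hq]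
  | monomial k a => simp [Polynomial.aeval_monomial, algebraMap_eq]

theorem MvPolynomial.polynomial_eval_aeval {σ : Type*} (t : ℝ)
    (f : σ → Polynomial ℝ) (p : MvPolynomial σ ℝ) :
    (aeval f p).eval t = eval (fun i => (f i).eval t) p := by
  induction p using MvPolynomial.induction_on with
  | C a => simp [Polynomial.algebraMap_eq]
  | add p q hp hq => simp [hp, hq]
  | mul_X p i hp => simp [hp]

theorem MvPolynomial.totalDegree_polynomial_aeval_le {σ : Type*} {f : MvPolynomial σ ℝ}
    (hf : f.totalDegree ≤ 1) (q : Polynomial ℝ) :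
    (Polynomial.aeval f q).totalDegree ≤ q.natDegree := by
  rw [Polynomial.aeval_eq_sum_range]
  refine totalDegree_finsetSum_le fun i hi => (totalDegree_smul_le _ _).trans ?_
  refine (totalDegree_pow _ _).trans ?_
  have := Finset.mem_range.1 hi
  nlinarith

theorem hasSquareMinorants_one_left (d : ℕ) : HasSquareMinorants 1 d := by
  intro p hp hpos hp0
  have hev : ∀ t, (aeval (fun _ => Polynomial.X) p : Polynomial ℝ).eval t =
      eval (fun _ => t) p := fun t => by rw [polynomial_eval_aeval]; simp
  have hx : ∀ x : Fin 1 → ℝ, x = fun _ => x 0 := fun x => funext fun i => by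
    rw [Subsingleton.elim i 0]
  obtain ⟨q, hq0, hq, hle⟩ := exists_sq_le_univariate (N := d)
    (p := aeval (fun _ => Polynomial.X) p)
    ((aeval_natDegree_le p hp (fun _ => Polynomial.X) (n := 1) (fun _ => by simp)).trans
      (by simp))
    (fun y => by rw [hev]; exact hpos _) (fun h => hp0 <| by
      refine MvPolynomial.funext fun x => ?_
      rw [hx x, ← hev, h]; simp)
  refine ⟨Polynomial.aeval (X 0) q, fun h => hq0 (Polynomial.funext fun t => ?_),
    (totalDegree_polynomial_aeval_le (totalDegree_X_le_one 0) q).trans hq, fun x => ?_⟩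
  · have := congrArg (eval fun _ : Fin 1 => t) h
    rw [eval_polynomial_aeval] at this
    simpa using this
  · rw [eval_polynomial_aeval, hx x, ← hev]
    simpa using hle (x 0)

theorem MvPolynomial.derivative_aeval {σ : Type*} [Fintype σ] (f : σ → Polynomial ℝ)
    (p : MvPolynomial σ ℝ) : (aeval f p).derivative =
      ∑ i, aeval f (pderiv i p) * (f i).derivative := by
  induction p using MvPolynomial.induction_on with
  | C a => simp [Polynomial.algebraMap_eq]
  | add p q hp hq => simp [hp, hq, add_mul, Finset.sum_add_distrib]
  | mul_X p i hp =>
    classical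
    have h : ∀ j, aeval f (pderiv j (p * X i)) * (f j).derivative =
        aeval f (pderiv j p) * (f j).derivative * f i +
          if j = i then aeval f p * (f j).derivative else 0 := fun j => by
      rw [pderiv_mul, pderiv_X, map_add, map_mul, map_mul, aeval_X]
      rcases eq_or_ne j i with rfl | hj
      · simp; ring
      · rw [Pi.single_eq_of_ne hj.symm, if_neg hj]; simp; ring
    rw [Finset.sum_congr rfl fun j _ => h j, Finset.sum_add_distrib, map_mul, aeval_X,
      Polynomial.derivative_mul, hp, Finset.sum_mul]
    simp

theorem hasSquareMinorants_one_right (n : ℕ) : HasSquareMinorants n 1 := by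
  intro p hp hpos hp0
  obtain ⟨z, hz⟩ : ∃ z, eval z p ≠ 0 := by
    by_contra! h
    exact hp0 (MvPolynomial.funext fun x => by simpa using h x)
  have hc : 0 < eval z p := (hpos z).lt_of_ne hz.symm
  set c := eval z p
  set l : MvPolynomial (Fin n) ℝ :=
    C c + C (1 / 2) * ∑ i, C (eval z (pderiv i p)) * (X i - C (z i)) with hl
  have hlz : eval z l = c := by simp [hl]
  have key : ∀ x, eval x l ^ 2 ≤ c * eval x p := fun x => by
    set P : Polynomial ℝ := aeval (fun i => Polynomial.C (z i) +
      Polynomial.C (x i - z i) * Polynomial.X) p with hP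
    have hPdeg : P.natDegree ≤ 2 :=
      (aeval_natDegree_le p hp _ (n := 1) (fun i => by compute_degree)).trans (by simp)
    have hPev : ∀ t, P.eval t = eval (fun i => z i + (x i - z i) * t) p := fun t => by
      rw [hP, polynomial_eval_aeval]; simp
    have hP0 : P.coeff 0 = c := by
      rw [Polynomial.coeff_zero_eq_eval_zero, hPev]; simp [c]
    have hP1 : P.coeff 1 = ∑ i, eval z (pderiv i p) * (x i - z i) := by
      have : P.derivative.eval 0 = P.coeff 1 := by
        rw [← Polynomial.coeff_zero_eq_eval_zero, Polynomial.coeff_derivative]; simp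
      rw [← this, hP, derivative_aeval, Polynomial.eval_finsetSum]
      simp [polynomial_eval_aeval]
    have hquad : ∀ t, P.eval t = P.coeff 2 * (t * t) + P.coeff 1 * t + P.coeff 0 := fun t => by
      rw [Polynomial.eval_eq_sum_range' (n := 3) (by omega)]
      simp [Finset.sum_range_succ]; ring
    have hdisc := discrim_le_zero (a := P.coeff 2) (b := P.coeff 1) (c := P.coeff 0) fun t => by
      rw [← hquad, hPev]; exact hpos _
    rw [discrim] at hdisc
    have hx1 : eval x p = P.coeff 2 + P.coeff 1 + P.coeff 0 := by
      have := hquad 1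
      rw [hPev] at this
      simpa using this
    have hlx : eval x l = c + P.coeff 1 / 2 := by
      rw [hP1]; simp [hl]; ring
    rw [hlx, hx1, ← hP0]
    nlinarith
  refine ⟨C (√c)⁻¹ * l, mul_ne_zero (C_ne_zero.2 (by positivity)) ?_, ?_, fun x => ?_⟩
  · intro h
    rw [h] at hlz
    exact hc.ne (by simpa using hlz)
  · rw [← smul_eq_C_mul]
    refine (totalDegree_smul_le _ _).trans ((totalDegree_add _ _).trans (max_le (by simp) ?_))
    rw [← smul_eq_C_mul]
    refine (totalDegree_smul_le _ _).trans (totalDegree_finsetSum_le fun i _ => ?_)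
    rw [← smul_eq_C_mul]
    refine (totalDegree_smul_le _ _).trans ((totalDegree_sub _ _).trans (max_le (totalDegree_X_le_one i) ?_))
    simp
  · rw [eval_mul, eval_C, mul_pow, inv_pow, Real.sq_sqrt hc.le, inv_mul_le_iff₀ hc]
    exact key x

end EasyMinorants

section QuadraticFamily

namespace Polynomial

/-- The polynomial `a x² + 2 b x + c` in `x` dominates the square of a nonzero polynomial
`u x + w` with `deg u ≤ 1` and `deg w ≤ 2`. -/
def HasLinearMinorant (a b c : ℝ[X]) : Prop :=
  ∃ u w : ℝ[X], (u ≠ 0 ∨ w ≠ 0) ∧ u.natDegree ≤ 1 ∧ w.natDegree ≤ 2 ∧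
    ∀ x y, (x * u.eval y + w.eval y) ^ 2 ≤ x ^ 2 * a.eval y + 2 * x * b.eval y + c.eval y

variable {a b c : ℝ[X]}

theorem mul_sub_sq_nonneg
    (h : ∀ x y, 0 ≤ x ^ 2 * a.eval y + 2 * x * b.eval y + c.eval y) (y : ℝ) :
    0 ≤ a.eval y * c.eval y - b.eval y ^ 2 := by
  have := discrim_le_zero (a := a.eval y) (b := 2 * b.eval y) (c := c.eval y) fun x => by
    linarith [h x y]
  rw [discrim] at this
  linarith

theorem leading_nonneg
    (h : ∀ x y, 0 ≤ x ^ 2 * a.eval y + 2 * x * b.eval y + c.eval y) (y : ℝ) :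
    0 ≤ a.eval y := by
  by_contra! ha
  have h0 := h 0 y
  have h1 := h 1 y
  have h2 := mul_sub_sq_nonneg h y
  simp only [ne_eq, OfNat.ofNat_ne_zero, not_false_eq_true, zero_pow, zero_mul, mul_zero,
    add_zero, zero_add] at h0
  have hc : a.eval y * c.eval y ≤ 0 := mul_nonpos_of_nonpos_of_nonneg ha.le h0
  have hb : b.eval y = 0 := by nlinarith
  have hc' : c.eval y = 0 := by
    rw [hb] at h2
    nlinarith
  rw [hb, hc'] at h1
  linarith

theorem HasLinearMinorant.of_leading_eq_zero (hc : c.natDegree ≤ 4)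
    (h : ∀ x y, 0 ≤ x ^ 2 * (0 : ℝ[X]).eval y + 2 * x * b.eval y + c.eval y)
    (hne : b ≠ 0 ∨ c ≠ 0) : HasLinearMinorant 0 b c := by
  have hb : b = 0 := Polynomial.funext fun y => by
    have := mul_sub_sq_nonneg h y
    simp only [eval_zero] at this ⊢
    nlinarith
  subst hb
  obtain ⟨q, hq0, hq, hle⟩ := exists_sq_le_univariate (N := 2) hc
    (fun y => by simpa using h 0 y) (by simpa using hne)
  exact ⟨0, q, Or.inr hq0, by simp, hq, fun x y => by simpa using hle y⟩

theorem HasLinearMinorant.of_leading_eq_sq {s : ℝ[X]} {g : ℝ[X]} (hs0 : s ≠ 0)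
    (hs : s.natDegree ≤ 1) (hg : g.natDegree ≤ 2)
    (h : ∀ x y, 0 ≤ x ^ 2 * (s ^ 2).eval y + 2 * x * (s * g).eval y + c.eval y) :
    HasLinearMinorant (s ^ 2) (s * g) c := by
  have key : ∀ y, s.eval y ≠ 0 → 0 ≤ c.eval y - g.eval y ^ 2 := fun y hy => by
    have := mul_sub_sq_nonneg h y
    simp only [eval_mul, eval_pow] at this
    refine nonneg_of_mul_nonneg_right (a := s.eval y ^ 2) ?_ (sq_pos_of_ne_zero hy)
    linarith
  have key' : ∀ y, 0 ≤ c.eval y - g.eval y ^ 2 := by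
    have hcl : IsClosed {y | 0 ≤ c.eval y - g.eval y ^ 2} :=
      isClosed_le continuous_const (c.continuous.sub (g.continuous.pow 2))
    have hd : Dense ({y | s.eval y = 0}ᶜ) := by
      have hfin : {y | s.eval y = 0}.Finite :=
        (s.roots.toFinset.finite_toSet).subset fun y hy => by
          simpa [hs0] using hy
      simpa [Set.compl_eq_univ_sdiff] using dense_univ.sdiff_finite hfin
    intro y
    have : closure ({y | s.eval y = 0}ᶜ) ⊆ {y | 0 ≤ c.eval y - g.eval y ^ 2} :=
      hcl.closure_subset_iff.2 fun t ht => key t ht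
    exact this (hd y)
  refine ⟨s, g, Or.inl hs0, hs, hg, fun x y => ?_⟩
  have := key' y
  simp only [eval_mul, eval_pow]
  linarith

theorem HasLinearMinorant.of_eq_add_sq {α s t b₀ b₁ h₀ h₁ : ℝ} {h b' h' : ℝ[X]}
    (hα : 0 < α) (ht : 0 < t) (ha : a = C α * ((X - C s) ^ 2 + C (t ^ 2)))
    (hac : a * c = b ^ 2 + h ^ 2)
    (hb : b = ((X - C s) ^ 2 + C (t ^ 2)) * b' + (C b₁ * (X - C s) + C b₀))
    (hh : h = ((X - C s) ^ 2 + C (t ^ 2)) * h' + (C h₁ * (X - C s) + C h₀))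
    (hb' : b'.natDegree ≤ 1) (hh' : h'.natDegree ≤ 1) (h01 : b₀ = t * h₁) (h10 : h₀ = -(t * b₁)) :
    HasLinearMinorant a b c := by
  have hαp : 0 < √α := by positivity
  refine ⟨C √α * (X - C s), C (√α)⁻¹ * ((X - C s) * b' - C t * h' + C b₁),
    Or.inl (mul_ne_zero (C_ne_zero.2 hαp.ne') (X_sub_C_ne_zero s)), ?_, ?_, fun x y => ?_⟩
  · exact (natDegree_C_mul_le _ _).trans (natDegree_X_sub_C s).le
  · refine (natDegree_C_mul_le _ _).trans ?_
    refine natDegree_add_le_of_degree_le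
      ((natDegree_sub_le_of_le (m := 2) (n := 2) ?_ ?_).trans (by simp)) (by simp)
    · exact natDegree_mul_le.trans (by rw [natDegree_X_sub_C]; omega)
    · exact (natDegree_C_mul_le _ _).trans (by omega)
  have hay : a.eval y = α * ((y - s) ^ 2 + t ^ 2) := by simp [ha]
  have hby : b.eval y = ((y - s) ^ 2 + t ^ 2) * b'.eval y + (b₁ * (y - s) + b₀) := by simp [hb]
  have hhy : h.eval y = ((y - s) ^ 2 + t ^ 2) * h'.eval y + (h₁ * (y - s) + h₀) := by simp [hh]
  have hacy : a.eval y * c.eval y = b.eval y ^ 2 + h.eval y ^ 2 := by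
    rw [← eval_mul, hac]; simp
  have hsq : √α ^ 2 = α := Real.sq_sqrt hα.le
  set N := (y - s) ^ 2 + t ^ 2
  have hN : 0 < N := by positivity
  set m := (y - s) * b'.eval y - t * h'.eval y + b₁ with hm
  set m' := (y - s) * h'.eval y + t * b'.eval y + h₁ with hm'
  have h1 : N * (α * (x ^ 2 * a.eval y + 2 * x * b.eval y + c.eval y)) =
      N * ((α * x * (y - s) + m) ^ 2 + (α * x * t + m') ^ 2) := by
    have e1 : b.eval y = (y - s) * m + t * m' := by rw [hby, h01]; ring
    have e2 : h.eval y = (y - s) * m' - t * m := by rw [hhy, h10]; ring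
    rw [e1, e2, hay] at hacy
    rw [e1, hay]
    linear_combination hacy
  have h2 := mul_left_cancel₀ hN.ne' h1
  have h3 : (x * (C √α * (X - C s)).eval y +
      (C (√α)⁻¹ * ((X - C s) * b' - C t * h' + C b₁)).eval y) = (√α)⁻¹ * (α * x * (y - s) + m) := by
    simp only [eval_mul, eval_C, eval_sub, eval_X, eval_add, ← hm]
    field_simp
    rw [hsq]
    ring
  rw [h3, mul_pow, inv_pow, hsq, inv_mul_le_iff₀ hα, h2]
  linarith [sq_nonneg (α * x * t + m')]

theorem exists_eq_quadratic_mul_add (s t : ℝ) {p : ℝ[X]} (hp : p.natDegree ≤ 3) :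
    ∃ (q : ℝ[X]) (r₀ r₁ : ℝ), q.natDegree ≤ 1 ∧
      p = ((X - C s) ^ 2 + C (t ^ 2)) * q + (C r₁ * (X - C s) + C r₀) := by
  set N : ℝ[X] := (X - C s) ^ 2 + C (t ^ 2) with hN
  have hNd : N.natDegree = 2 := by rw [hN]; compute_degree!
  have hNm : N.Monic := by rw [hN]; monicity!
  have hr := natDegree_modByMonic_lt p hNm (fun h => by simp [h] at hNd)
  refine ⟨p /ₘ N, (p %ₘ N).coeff 0 + s * (p %ₘ N).coeff 1, (p %ₘ N).coeff 1, ?_, ?_⟩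
  · rw [natDegree_divByMonic p hNm]; omega
  · have hlin := eq_X_add_C_of_natDegree_le_one (p := p %ₘ N) (by omega)
    conv_lhs => rw [← modByMonic_add_div p N, hlin]
    simp only [C_add, C_mul]
    ring

theorem HasLinearMinorant.of_leading_definite {α s t : ℝ} (hα : 0 < α) (ht : 0 < t)
    (ha : a = C α * ((X - C s) ^ 2 + C (t ^ 2))) (hb : b.natDegree ≤ 3) (hc : c.natDegree ≤ 4)
    (h : ∀ x y, 0 ≤ x ^ 2 * a.eval y + 2 * x * b.eval y + c.eval y) :
    HasLinearMinorant a b c := by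
  have hay : ∀ y, 0 < a.eval y := fun y => by
    simp [ha]; positivity
  have had : a.natDegree ≤ 2 := by rw [ha]; compute_degree
  by_cases hΔ : (a * c - b ^ 2 ≠ 0) ∧ ∃ g : ℝ[X], g ≠ 0 ∧ g.natDegree + 1 ≤ 3 ∧
      ∀ y, a.eval y * g.eval y ^ 2 ≤ (a * c - b ^ 2).eval y
  · obtain ⟨-, g, hg0, hg, hle⟩ := hΔ
    refine ⟨0, g, Or.inr hg0, by simp, by omega, fun x y => ?_⟩
    have h1 := hle y
    simp only [eval_sub, eval_mul, eval_pow] at h1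
    refine le_of_mul_le_mul_left (a := a.eval y) ?_ (hay y)
    simp only [eval_zero, mul_zero, zero_add]
    nlinarith [sq_nonneg (a.eval y * x + b.eval y)]
  have hsq : ∃ e : ℝ[X], e.natDegree ≤ 3 ∧ a * c - b ^ 2 = e ^ 2 := by
    by_cases h0 : a * c - b ^ 2 = 0
    · exact ⟨0, by simp, by simp [h0]⟩
    · refine (eq_sq_or_exists_mul_sq_le had 3 (a * c - b ^ 2) ?_ (fun y => ?_) h0).resolve_right
        fun hg => hΔ ⟨h0, hg⟩
      · refine (natDegree_sub_le_of_le (m := 6) (n := 6) ?_ ?_).trans (by simp)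
        · exact natDegree_mul_le.trans (by omega)
        · exact natDegree_pow_le.trans (by omega)
      · simpa using mul_sub_sq_nonneg h y
  obtain ⟨e, hed, he⟩ := hsq
  have hac : a * c = b ^ 2 + e ^ 2 := by rw [← he]; ring
  obtain ⟨b', b₀, b₁, hb', hbe⟩ := exists_eq_quadratic_mul_add s t hb
  obtain ⟨e', e₀, e₁, he', hee⟩ := exists_eq_quadratic_mul_add s t hed
  set N : ℝ[X] := (X - C s) ^ 2 + C (t ^ 2) with hN
  have hlin : C (2 * (b₀ * b₁ + e₀ * e₁)) * (X - C s) +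
      C (b₀ ^ 2 + e₀ ^ 2 - t ^ 2 * (b₁ ^ 2 + e₁ ^ 2)) = 0 := by
    have hNd : N.natDegree = 2 := by rw [hN]; compute_degree!
    refine eq_zero_of_dvd_of_natDegree_lt (p := N) ?_ ?_
    · refine ⟨C α * c - N * (b' ^ 2 + e' ^ 2) - 2 * b' * (C b₁ * (X - C s) + C b₀) -
        2 * e' * (C e₁ * (X - C s) + C e₀) - C (b₁ ^ 2 + e₁ ^ 2), ?_⟩
      rw [ha, hbe, hee] at hac
      simp only [C_add, C_mul, C_sub, C_pow, hN] at hac ⊢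
      have h2 : (C 2 : ℝ[X]) = 2 := rfl
      rw [h2]
      linear_combination -hac
    · rw [hNd]
      refine lt_of_le_of_lt ?_ one_lt_two
      compute_degree
  have hr0 : b₀ ^ 2 + e₀ ^ 2 - t ^ 2 * (b₁ ^ 2 + e₁ ^ 2) = 0 := by
    simpa using congrArg (eval s) hlin
  have hr1 : b₀ * b₁ + e₀ * e₁ = 0 := by
    have := congrArg (eval (s + 1)) hlin
    simp at this
    linarith
  have hprod : ((b₀ - t * e₁) ^ 2 + (e₀ + t * b₁) ^ 2) *
      ((b₀ + t * e₁) ^ 2 + (e₀ - t * b₁) ^ 2) = 0 := by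
    linear_combination (b₀ ^ 2 + e₀ ^ 2 - t ^ 2 * (b₁ ^ 2 + e₁ ^ 2)) * hr0 +
      (4 * t ^ 2 * (b₀ * b₁ + e₀ * e₁)) * hr1
  rcases mul_eq_zero.1 hprod with h0 | h0
  · refine .of_eq_add_sq hα ht ha hac hbe hee hb' he' ?_ ?_ <;>
      nlinarith [sq_nonneg (b₀ - t * e₁), sq_nonneg (e₀ + t * b₁)]
  · refine .of_eq_add_sq (h := -e) (h' := -e') (h₀ := -e₀) (h₁ := -e₁) hα ht ha
      (by rw [hac]; ring) hbe (by rw [hee, C_neg, C_neg]; ring) hb' (by simpa using he') ?_ ?_ <;>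
      nlinarith [sq_nonneg (b₀ + t * e₁), sq_nonneg (e₀ - t * b₁)]

theorem HasLinearMinorant.of_nonneg (ha : a.natDegree ≤ 2) (hb : b.natDegree ≤ 3)
    (hc : c.natDegree ≤ 4) (hne : a ≠ 0 ∨ b ≠ 0 ∨ c ≠ 0)
    (h : ∀ x y, 0 ≤ x ^ 2 * a.eval y + 2 * x * b.eval y + c.eval y) :
    HasLinearMinorant a b c := by
  by_cases ha0 : a = 0
  · subst ha0
    exact .of_leading_eq_zero hc h (by simpa using hne)
  have hapos := leading_nonneg h
  by_cases hroot : ∃ r, a.eval r = 0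
  · obtain ⟨r, hr⟩ := hroot
    obtain ⟨e, rfl, he0, he, hd⟩ := exists_eq_sq_mul_of_isRoot ha0 hapos hr
    rw [eq_C_of_natDegree_le_zero (p := e) (by omega)] at h he ⊢
    set l := e.coeff 0
    have hl : 0 ≤ l := by simpa using he 0
    have hl0 : l ≠ 0 := fun hl0 => he0 (by
      rw [eq_C_of_natDegree_le_zero (p := e) (by omega)]; simp [l] at hl0; simp [hl0])
    have hlp : 0 < √l := by positivity
    have hs : (X - C r) ^ 2 * C l = (C √l * (X - C r)) ^ 2 := by
      rw [mul_pow, ← C_pow, Real.sq_sqrt hl, mul_comm]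
    have hbr : b.eval r = 0 := by
      have := mul_sub_sq_nonneg h r
      simp at this
      nlinarith
    obtain ⟨g, rfl⟩ := dvd_iff_isRoot.2 hbr
    have hg : (X - C r) * g = C √l * (X - C r) * (C (√l)⁻¹ * g) := by
      have : (C √l : ℝ[X]) * C (√l)⁻¹ = 1 := by rw [← C_mul, mul_inv_cancel₀ hlp.ne', C_1]
      linear_combination (-(X - C r) * g) * this
    have hgd : g.natDegree ≤ 2 := by
      rcases eq_or_ne g 0 with rfl | hg0
      · simp
      · rw [natDegree_mul (X_sub_C_ne_zero r) hg0, natDegree_X_sub_C] at hb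
        omega
    rw [hs, hg] at h ⊢
    refine .of_leading_eq_sq (mul_ne_zero (C_ne_zero.2 hlp.ne') (X_sub_C_ne_zero r)) ?_ ?_ h
    · exact (natDegree_C_mul_le _ _).trans (natDegree_X_sub_C r).le
    · exact (natDegree_C_mul_le _ _).trans hgd
  push Not at hroot
  have hapos' : ∀ y, 0 < a.eval y := fun y => (hapos y).lt_of_ne (hroot y).symm
  have hcase : a.natDegree = 0 ∨ a.natDegree = 2 := by
    by_contra! hcon
    obtain ⟨r, hr⟩ := exists_root_of_degree_eq_one
      ((degree_eq_iff_natDegree_eq_of_pos one_pos).2 (by omega : a.natDegree = 1))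
    exact hroot r hr
  rcases hcase with ha' | ha'
  · rw [eq_C_of_natDegree_le_zero ha'.le] at h ⊢
    have hl : 0 < a.coeff 0 := by
      rw [coeff_zero_eq_eval_zero]; exact hapos' 0
    set l := a.coeff 0
    have hlp : 0 < √l := by positivity
    have hbd : b.natDegree ≤ 2 := by
      by_contra! hb3
      have hb3 : b.natDegree = 3 := by omega
      have hlt : (C l * c).degree < (b ^ 2).degree := by
        have hb0 : b ≠ 0 := by rintro rfl; simp at hb3
        rw [degree_pow, degree_eq_natDegree hb0, hb3]
        refine lt_of_le_of_lt (b := ((4 : ℕ) : WithBot ℕ)) (natDegree_le_iff_degree_le.1 ?_) ?_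
        · exact (natDegree_C_mul_le _ _).trans hc
        · norm_num
      have hlim := tendsto_atBot_of_leadingCoeff_nonpos (C l * c - b ^ 2) (by
        rw [degree_sub_eq_right_of_degree_lt hlt, degree_pow, degree_eq_natDegree (by
          rintro rfl; simp at hb3), hb3]
        decide) (by
        rw [leadingCoeff_sub_of_degree_lt' hlt, leadingCoeff_pow]
        nlinarith [sq_nonneg b.leadingCoeff])
      obtain ⟨y, hy⟩ := (hlim.eventually (Filter.eventually_lt_atBot 0)).exists
      have := mul_sub_sq_nonneg h y
      simp only [eval_sub, eval_mul, eval_C, eval_pow] at hy this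
      linarith
    have hs : (C l : ℝ[X]) = C √l ^ 2 := by rw [← C_pow, Real.sq_sqrt hl.le]
    have hg : b = C √l * (C (√l)⁻¹ * b) := by
      rw [← mul_assoc, ← C_mul, mul_inv_cancel₀ hlp.ne', C_1, one_mul]
    rw [hs, hg] at h ⊢
    exact .of_leading_eq_sq (C_ne_zero.2 hlp.ne') (by simp)
      ((natDegree_C_mul_le _ _).trans hbd) h
  · have hev : ∀ y, a.eval y = a.coeff 2 * (y * y) + a.coeff 1 * y + a.coeff 0 := fun y => by
      rw [Polynomial.eval_eq_sum_range, ha']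
      simp [Finset.sum_range_succ]; ring
    have hα0 : a.coeff 2 ≠ 0 := by
      rw [← ha', coeff_natDegree]; exact leadingCoeff_ne_zero.2 ha0
    have hdisc : discrim (a.coeff 2) (a.coeff 1) (a.coeff 0) < 0 :=
      discrim_lt_zero hα0 fun y => by rw [← hev]; exact hapos' y
    rw [discrim] at hdisc
    have hα : 0 < a.coeff 2 := by
      have := hapos' 0
      rw [hev] at this
      by_contra! hneg
      nlinarith [sq_nonneg (a.coeff 1)]
    set α := a.coeff 2
    set T := (4 * α * a.coeff 0 - a.coeff 1 ^ 2) / (4 * α ^ 2) with hT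
    have hTp : 0 < T := div_pos (by linarith) (by positivity)
    refine .of_leading_definite (s := -a.coeff 1 / (2 * α)) (t := √T) hα (by positivity) ?_ hb hc h
    refine Polynomial.funext fun y => ?_
    rw [hev, Real.sq_sqrt hTp.le, hT]
    simp
    field_simp
    ring

end Polynomial

end QuadraticFamily

section PlaneQuartics

/-- The value at `(x, y)` of the bivariate quartic with coefficients `c i j`. -/
def quarticEval (c : ℕ → ℕ → ℝ) (x y : ℝ) : ℝ :=
  c 0 0 + (c 1 0 * x + c 0 1 * y) + (c 2 0 * x ^ 2 + c 1 1 * x * y + c 0 2 * y ^ 2) +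
    (c 3 0 * x ^ 3 + c 2 1 * x ^ 2 * y + c 1 2 * x * y ^ 2 + c 0 3 * y ^ 3) +
    (c 4 0 * x ^ 4 + c 3 1 * x ^ 3 * y + c 2 2 * x ^ 2 * y ^ 2 + c 1 3 * x * y ^ 3 + c 0 4 * y ^ 4)

/-- The value at `(x, y, z)` of the homogenization of the quartic with coefficients `c i j`. -/
def quarticForm (c : ℕ → ℕ → ℝ) (x y z : ℝ) : ℝ :=
  c 0 0 * z ^ 4 + (c 1 0 * x + c 0 1 * y) * z ^ 3 +
    (c 2 0 * x ^ 2 + c 1 1 * x * y + c 0 2 * y ^ 2) * z ^ 2 +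
    (c 3 0 * x ^ 3 + c 2 1 * x ^ 2 * y + c 1 2 * x * y ^ 2 + c 0 3 * y ^ 3) * z +
    (c 4 0 * x ^ 4 + c 3 1 * x ^ 3 * y + c 2 2 * x ^ 2 * y ^ 2 + c 1 3 * x * y ^ 3 + c 0 4 * y ^ 4)

/-- The value at `(x, y)` of the bivariate quadratic polynomial with coefficients `e i j`. -/
def conicEval (e : ℕ → ℕ → ℝ) (x y : ℝ) : ℝ :=
  e 0 0 + e 1 0 * x + e 0 1 * y + e 2 0 * x ^ 2 + e 1 1 * x * y + e 0 2 * y ^ 2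

variable {c : ℕ → ℕ → ℝ}

theorem continuous_quarticEval_left (c : ℕ → ℕ → ℝ) (y : ℝ) :
    Continuous fun x => quarticEval c x y := by
  unfold quarticEval; fun_prop

theorem continuous_conicEval_left (c : ℕ → ℕ → ℝ) (y : ℝ) :
    Continuous fun x => conicEval c x y := by
  unfold conicEval; fun_prop

theorem Polynomial.coeff_one_eq_zero_of_nonneg {p : Polynomial ℝ} (hpos : ∀ y, 0 ≤ p.eval y)
    (h0 : p.eval 0 = 0) : p.coeff 1 = 0 := by
  have hmin : IsLocalMin (fun y => p.eval y) 0 :=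
    Filter.Eventually.of_forall fun y => by simpa [h0] using hpos y
  have := hmin.deriv_eq_zero
  rw [Polynomial.deriv, ← Polynomial.coeff_zero_eq_eval_zero, Polynomial.coeff_derivative] at this
  simpa using this

theorem exists_conicEval_sq_le_of_infinite_zero (hpos : ∀ x y, 0 ≤ quarticEval c x y)
    (hne : ∃ x y, quarticEval c x y ≠ 0) (h4 : c 4 0 = 0) :
    ∃ e, (∃ x y, conicEval e x y ≠ 0) ∧ ∀ x y, conicEval e x y ^ 2 ≤ quarticEval c x y := by
  have hcub : ∀ y, c 3 0 + c 3 1 * y = 0 := fun y => by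
    set P : Polynomial ℝ := Polynomial.C (c 3 0 + c 3 1 * y) * Polynomial.X +
      Polynomial.C (c 2 0 + c 2 1 * y + c 2 2 * y ^ 2) * Polynomial.X ^ 2 +
      Polynomial.C (c 1 0 + c 1 1 * y + c 1 2 * y ^ 2 + c 1 3 * y ^ 3) * Polynomial.X ^ 3 +
      Polynomial.C (c 0 0 + c 0 1 * y + c 0 2 * y ^ 2 + c 0 3 * y ^ 3 + c 0 4 * y ^ 4) *
        Polynomial.X ^ 4 with hP
    have key : ∀ t, t ≠ 0 → 0 ≤ P.eval t := fun t ht => by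
      have : P.eval t = t ^ 4 * quarticEval c t⁻¹ y := by
        simp only [hP, quarticEval, h4, Polynomial.eval_add, Polynomial.eval_mul,
          Polynomial.eval_C, Polynomial.eval_X, Polynomial.eval_pow]
        field_simp
        ring
      rw [this]
      exact mul_nonneg (by positivity) (hpos _ _)
    have key' : ∀ t, 0 ≤ P.eval t := fun t => by
      by_cases ht : t = 0
      · exact ht ▸ nonneg_of_continuous_of_ne P.continuous 0 key
      · exact key t ht
    have := Polynomial.coeff_one_eq_zero_of_nonneg key' (by simp [hP])
    simp only [hP, Polynomial.coeff_add, Polynomial.coeff_C_mul, Polynomial.coeff_X_one,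
      Polynomial.coeff_X_pow] at this
    simpa using this
  have h30 : c 3 0 = 0 := by simpa using hcub 0
  have h31 : c 3 1 = 0 := by simpa [h30] using hcub 1
  set a : Polynomial ℝ := Polynomial.C (c 2 0) + Polynomial.C (c 2 1) * Polynomial.X +
    Polynomial.C (c 2 2) * Polynomial.X ^ 2 with ha
  set b : Polynomial ℝ := Polynomial.C (c 1 0 / 2) + Polynomial.C (c 1 1 / 2) * Polynomial.X +
    Polynomial.C (c 1 2 / 2) * Polynomial.X ^ 2 +
    Polynomial.C (c 1 3 / 2) * Polynomial.X ^ 3 with hb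
  set f : Polynomial ℝ := Polynomial.C (c 0 0) + Polynomial.C (c 0 1) * Polynomial.X +
    Polynomial.C (c 0 2) * Polynomial.X ^ 2 + Polynomial.C (c 0 3) * Polynomial.X ^ 3 +
    Polynomial.C (c 0 4) * Polynomial.X ^ 4 with hf
  have hq : ∀ x y, quarticEval c x y = x ^ 2 * a.eval y + 2 * x * b.eval y + f.eval y :=
    fun x y => by
      simp only [ha, hb, hf, quarticEval, h4, h30, h31, Polynomial.eval_add, Polynomial.eval_mul,
        Polynomial.eval_C, Polynomial.eval_X, Polynomial.eval_pow]
      ring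
  have had : a.natDegree ≤ 2 := by rw [ha]; compute_degree
  have hbd : b.natDegree ≤ 3 := by rw [hb]; compute_degree
  have hfd : f.natDegree ≤ 4 := by rw [hf]; compute_degree
  obtain ⟨u, w, huw, hu, hw, hle⟩ := Polynomial.HasLinearMinorant.of_nonneg (a := a) (b := b)
    (c := f) had hbd hfd (by
      by_contra! h
      obtain ⟨x, y, hxy⟩ := hne
      rw [hq, h.1, h.2.1, h.2.2] at hxy
      simp at hxy) fun x y => by rw [← hq]; exact hpos x y
  let e : ℕ → ℕ → ℝ := fun i j => if i = 0 then w.coeff j else if i = 1 then u.coeff j else 0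
  have he : ∀ x y, conicEval e x y = x * u.eval y + w.eval y := fun x y => by
    rw [Polynomial.eval_eq_sum_range' (n := 2) (by omega : u.natDegree < 2),
      Polynomial.eval_eq_sum_range' (n := 3) (by omega : w.natDegree < 3)]
    simp [conicEval, e, Finset.sum_range_succ]
    ring
  refine ⟨e, ?_, fun x y => by rw [he, hq]; exact hle x y⟩
  by_contra! h
  simp only [he] at h
  have hw0 : w = 0 := Polynomial.funext fun y => by simpa using h 0 y
  have hu0 : u = 0 := Polynomial.funext fun y => by simpa [hw0] using h 1 y
  simp [hw0, hu0] at huw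

/-- Exchange of the roles of the first coordinate and of the homogenizing coordinate. -/
theorem exists_conicEval_sq_le_of_zero (hpos : ∀ x y, 0 ≤ quarticEval c x y)
    (hne : ∃ x y, quarticEval c x y ≠ 0) (h0 : c 0 0 = 0) :
    ∃ e, (∃ x y, conicEval e x y ≠ 0) ∧ ∀ x y, conicEval e x y ^ 2 ≤ quarticEval c x y := by
  let c' : ℕ → ℕ → ℝ := fun i j => c (4 - i - j) j
  have hc' : ∀ x y, x ≠ 0 → quarticEval c' x y = x ^ 4 * quarticEval c x⁻¹ (y * x⁻¹) :=
    fun x y hx => by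
      simp only [c', quarticEval]
      field_simp
      ring
  obtain ⟨e, ⟨x₀, y₀, he0⟩, hle⟩ := exists_conicEval_sq_le_of_infinite_zero (c := c') (fun x y => by
      have key : ∀ t, t ≠ 0 → 0 ≤ quarticEval c' t y := fun t ht => by
        rw [hc' t y ht]
        exact mul_nonneg (by positivity) (hpos _ _)
      by_cases hx : x = 0
      · exact hx ▸ nonneg_of_continuous_of_ne (continuous_quarticEval_left c' y) 0 key
      · exact key x hx) (by
      by_contra! h
      have key : ∀ x y, x ≠ 0 → quarticEval c x y = 0 := fun x y hx => by
        have := hc' x⁻¹ (y * x⁻¹) (inv_ne_zero hx)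
        rw [h, inv_inv, mul_assoc, inv_mul_cancel₀ hx, mul_one] at this
        exact (mul_eq_zero.1 this.symm).resolve_left (by positivity)
      obtain ⟨x, y, hxy⟩ := hne
      by_cases hx : x = 0
      · have h1 := nonneg_of_continuous_of_ne (continuous_quarticEval_left c y).neg 0
          fun t ht => by simp [key t y ht]
        rw [hx] at hxy
        exact hxy (le_antisymm (by simpa using h1) (hpos 0 y))
      · exact hxy (key x y hx)) (by simpa [c'] using h0)
  let e' : ℕ → ℕ → ℝ := fun i j => e (2 - i - j) j
  have he' : ∀ x y, x ≠ 0 → conicEval e' x y = x ^ 2 * conicEval e x⁻¹ (y * x⁻¹) :=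
    fun x y hx => by
      simp only [e', conicEval]
      field_simp
      ring
  refine ⟨e', ?_, fun x y => ?_⟩
  · by_contra! h
    have key : ∀ x y, x ≠ 0 → conicEval e x y = 0 := fun x y hx => by
      have := he' x⁻¹ (y * x⁻¹) (inv_ne_zero hx)
      rw [h, inv_inv, mul_assoc, inv_mul_cancel₀ hx, mul_one] at this
      exact (mul_eq_zero.1 this.symm).resolve_left (by positivity)
    by_cases hx : x₀ = 0
    · have h1 := nonneg_of_continuous_of_ne ((continuous_conicEval_left e y₀).pow 2).neg 0
        fun t ht => by simp [key t y₀ ht]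
      rw [hx] at he0
      have : conicEval e 0 y₀ ^ 2 ≤ 0 := by simpa using h1
      exact he0 (by nlinarith)
    · exact he0 (key x₀ y₀ hx)
  · have key : ∀ t, t ≠ 0 → 0 ≤ quarticEval c t y - conicEval e' t y ^ 2 := fun t ht => by
      have h1 := hc' t⁻¹ (y * t⁻¹) (inv_ne_zero ht)
      rw [inv_inv, mul_assoc, inv_mul_cancel₀ ht, mul_one] at h1
      have h2 : quarticEval c t y = t ^ 4 * quarticEval c' t⁻¹ (y * t⁻¹) := by
        rw [h1]; field_simp
      have h3 := hle t⁻¹ (y * t⁻¹)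
      rw [he' t y ht, h2]
      have h4 : 0 ≤ t ^ 4 := by positivity
      nlinarith [mul_le_mul_of_nonneg_left h3 h4]
    rw [← sub_nonneg]
    by_cases hx : x = 0
    · exact hx ▸ nonneg_of_continuous_of_ne
        ((continuous_quarticEval_left c y).sub ((continuous_conicEval_left e' y).pow 2)) 0 key
    · exact key x hx

theorem quarticForm_eq (x y : ℝ) {z : ℝ} (hz : z ≠ 0) :
    quarticForm c x y z = z ^ 4 * quarticEval c (x / z) (y / z) := by
  simp only [quarticForm, quarticEval]
  field_simp

theorem exists_pos_le_quarticEval (hpos : ∀ x y, 0 ≤ quarticEval c x y)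
    (hzero : ∀ x y z, quarticForm c x y z = 0 → x = 0 ∧ y = 0 ∧ z = 0) :
    ∃ ε : ℝ, 0 < ε ∧ ∀ x y, ε ≤ quarticEval c x y := by
  have hnn : ∀ x y z, 0 ≤ quarticForm c x y z := fun x y z => by
    have key : ∀ t, t ≠ 0 → 0 ≤ quarticForm c x y t := fun t ht => by
      rw [quarticForm_eq x y ht]
      exact mul_nonneg (by positivity) (hpos _ _)
    by_cases hz : z = 0
    · exact hz ▸ nonneg_of_continuous_of_ne (by unfold quarticForm; fun_prop) 0 key
    · exact key z hz
  have hcont : Continuous fun v : ℝ × ℝ × ℝ => quarticForm c v.1 v.2.1 v.2.2 := by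
    unfold quarticForm; fun_prop
  obtain ⟨v, hv, hmin⟩ := (isCompact_sphere (0 : ℝ × ℝ × ℝ) 1).exists_isMinOn
    ⟨(1, 0, 0), by simp [Prod.norm_def]⟩ hcont.continuousOn
  have hv0 : 0 < quarticForm c v.1 v.2.1 v.2.2 := by
    refine (hnn _ _ _).lt_of_ne fun h => ?_
    obtain ⟨h1, h2, h3⟩ := hzero _ _ _ h.symm
    have : v = 0 := Prod.ext h1 (Prod.ext h2 h3)
    simp [this] at hv
  refine ⟨_, hv0, fun x y => ?_⟩
  set r := ‖((x, y, 1) : ℝ × ℝ × ℝ)‖ with hr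
  have hr1 : 1 ≤ r := by
    simp [hr, Prod.norm_def]
  have hr0 : r ≠ 0 := by positivity
  have h1 := isMinOn_iff.1 hmin (r⁻¹ • (x, y, 1)) (by
    simp only [mem_sphere_zero_iff_norm, norm_smul, norm_inv, ← hr]
    rw [Real.norm_of_nonneg (by positivity), inv_mul_cancel₀ hr0])
  have h2 : quarticEval c x y = r ^ 4 * quarticForm c (r⁻¹ * x) (r⁻¹ * y) (r⁻¹ * 1) := by
    rw [quarticForm_eq _ _ (by positivity)]
    field_simp
  rw [h2]
  have h3 : 1 ≤ r ^ 4 := one_le_pow₀ hr1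
  refine h1.trans ?_
  have h4 := hnn (r⁻¹ * x) (r⁻¹ * y) (r⁻¹ * 1)
  simp only [Prod.smul_mk, smul_eq_mul]
  nlinarith

end PlaneQuartics

section TernaryQuartics

theorem eval_eq_quarticEval {p : MvPolynomial (Fin 2) ℝ} (hp : p.totalDegree ≤ 4)
    (x : Fin 2 → ℝ) : eval x p =
      quarticEval (fun i j => coeff (Finsupp.single 0 i + Finsupp.single 1 j) p) (x 0) (x 1) := by
  classical
  set φ : ℕ × ℕ → (Fin 2 →₀ ℕ) := fun ij => Finsupp.single 0 ij.1 + Finsupp.single 1 ij.2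
  have hφ0 : ∀ ij, φ ij 0 = ij.1 := fun ij => by simp [φ]
  have hφ1 : ∀ ij, φ ij 1 = ij.2 := fun ij => by simp [φ]
  have hinj : Function.Injective φ := fun a b h =>
    Prod.ext (by rw [← hφ0, h, hφ0]) (by rw [← hφ1, h, hφ1])
  have hsum : ∀ a : Fin 2 →₀ ℕ, (a.sum fun _ e => e) = a 0 + a 1 := fun a => by
    rw [Finsupp.sum_fintype _ _ fun _ => rfl, Fin.sum_univ_two]
  have hsub : p.support ⊆ (Finset.range 5 ×ˢ Finset.range 5).image φ := fun a ha => by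
    have h1 := (le_totalDegree ha).trans hp
    rw [hsum] at h1
    refine Finset.mem_image.2 ⟨(a 0, a 1), by simp; omega, ?_⟩
    ext i; fin_cases i
    · simpa using hφ0 (a 0, a 1)
    · simpa using hφ1 (a 0, a 1)
  have hzero : ∀ i j, 4 < i + j → coeff (φ (i, j)) p = 0 := fun i j hij => by
    refine coeff_eq_zero_of_totalDegree_lt (hp.trans_lt ?_)
    have := hsum (φ (i, j))
    rw [hφ0, hφ1, Finsupp.sum] at this
    rwa [this]
  have hz : ∀ i j, 4 < i + j → coeff (Finsupp.single 0 i + Finsupp.single 1 j) p = 0 := hzero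
  rw [eval_eq', Finset.sum_subset hsub fun a _ ha => by
    rw [notMem_support_iff.1 ha, zero_mul], Finset.sum_image hinj.injOn, Finset.sum_product]
  simp only [Fin.prod_univ_two, hφ0, hφ1]
  simp only [Finset.sum_range_succ, Finset.sum_range_zero, φ]
  rw [hz 1 4 (by norm_num), hz 2 3 (by norm_num), hz 2 4 (by norm_num), hz 3 2 (by norm_num),
    hz 3 3 (by norm_num), hz 3 4 (by norm_num), hz 4 1 (by norm_num), hz 4 2 (by norm_num),
    hz 4 3 (by norm_num), hz 4 4 (by norm_num)]
  simp only [quarticEval]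
  ring

theorem exists_sq_le_of_exists_conicEval {p : MvPolynomial (Fin 2) ℝ}
    (h : ∃ e, (∃ x y, conicEval e x y ≠ 0) ∧
      ∀ x : Fin 2 → ℝ, conicEval e (x 0) (x 1) ^ 2 ≤ eval x p) :
    ∃ q : MvPolynomial (Fin 2) ℝ, q ≠ 0 ∧ q.totalDegree ≤ 2 ∧ ∀ x, eval x q ^ 2 ≤ eval x p := by
  obtain ⟨e, ⟨x₀, y₀, hxy⟩, hle⟩ := h
  set q : MvPolynomial (Fin 2) ℝ := C (e 0 0) + e 1 0 • X 0 + e 0 1 • X 1 +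
    e 2 0 • (X 0 * X 0) + e 1 1 • (X 0 * X 1) + e 0 2 • (X 1 * X 1) with hq
  have hev : ∀ x, eval x q = conicEval e (x 0) (x 1) := fun x => by
    simp only [hq, conicEval, smul_eq_C_mul, eval_add, eval_mul, eval_C, eval_X]
    ring
  have h1 : ∀ i : Fin 2, (X i : MvPolynomial (Fin 2) ℝ).totalDegree ≤ 1 := totalDegree_X_le_one
  have hX : ∀ i j : Fin 2, (X i * X j : MvPolynomial (Fin 2) ℝ).totalDegree ≤ 2 := fun i j =>
    (totalDegree_mul _ _).trans (add_le_add (h1 i) (h1 j))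
  refine ⟨q, fun h0 => hxy ?_, ?_, fun x => by rw [hev]; exact hle x⟩
  · have := hev ![x₀, y₀]
    rw [h0] at this
    simpa using this.symm
  · have hadd : ∀ {f g : MvPolynomial (Fin 2) ℝ}, f.totalDegree ≤ 2 → g.totalDegree ≤ 2 →
        (f + g).totalDegree ≤ 2 := fun hf hg => (totalDegree_add _ _).trans (max_le hf hg)
    have hsm : ∀ (t : ℝ) {f : MvPolynomial (Fin 2) ℝ}, f.totalDegree ≤ 2 →
        (t • f).totalDegree ≤ 2 := fun t f hf => (totalDegree_smul_le _ _).trans hf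
    have h2 : ∀ i : Fin 2, (X i : MvPolynomial (Fin 2) ℝ).totalDegree ≤ 2 := fun i =>
      (h1 i).trans one_le_two
    exact hadd (hadd (hadd (hadd (hadd (by simp) (hsm _ (h2 _))) (hsm _ (h2 _)))
      (hsm _ (hX _ _))) (hsm _ (hX _ _))) (hsm _ (hX _ _))

theorem exists_sq_le_of_aeval {p : MvPolynomial (Fin 2) ℝ} {f g : Fin 2 → MvPolynomial (Fin 2) ℝ}
    (hg : ∀ i, (g i).totalDegree ≤ 1)
    (hfg : ∀ x, (fun i => eval (fun j => eval x (g j)) (f i)) = x)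
    (hgf : ∀ x, (fun i => eval (fun j => eval x (f j)) (g i)) = x)
    (h : ∃ q : MvPolynomial (Fin 2) ℝ, q ≠ 0 ∧ q.totalDegree ≤ 2 ∧
      ∀ x, eval x q ^ 2 ≤ eval x (aeval f p)) :
    ∃ q : MvPolynomial (Fin 2) ℝ, q ≠ 0 ∧ q.totalDegree ≤ 2 ∧ ∀ x, eval x q ^ 2 ≤ eval x p := by
  obtain ⟨q, hq0, hq, hle⟩ := h
  refine ⟨aeval g q, fun h0 => hq0 (MvPolynomial.funext fun x => ?_),
    (totalDegree_aeval_le_of_le_one hg q).trans hq, fun x => ?_⟩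
  · have := congrArg (eval fun j => eval x (f j)) h0
    rw [eval_aeval_eq, hgf] at this
    simpa using this
  · have := hle fun j => eval x (g j)
    rw [eval_aeval_eq, hfg] at this
    rwa [eval_aeval_eq]

theorem hasSquareMinorants_two_two : HasSquareMinorants 2 2 := by
  intro p hp hpos hp0
  have hne : ∃ x, eval x p ≠ 0 := by
    by_contra! h
    exact hp0 (MvPolynomial.funext fun x => by simpa using h x)
  set c : ℕ → ℕ → ℝ := fun i j => coeff (Finsupp.single 0 i + Finsupp.single 1 j) p with hc
  have hev : ∀ x, eval x p = quarticEval c (x 0) (x 1) := eval_eq_quarticEval hp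
  have hcpos : ∀ x y, 0 ≤ quarticEval c x y := fun x y => by
    simpa [hev] using hpos ![x, y]
  by_cases hzero : ∀ x y z, quarticForm c x y z = 0 → x = 0 ∧ y = 0 ∧ z = 0
  · obtain ⟨ε, hε, hle⟩ := exists_pos_le_quarticEval hcpos hzero
    refine ⟨C √ε, C_ne_zero.2 (by positivity), by simp, fun x => ?_⟩
    rw [eval_C, Real.sq_sqrt hε.le, hev]
    exact hle _ _
  push Not at hzero
  obtain ⟨x₀, y₀, z₀, h0, hxyz⟩ := hzero
  by_cases hz : z₀ = 0
  · subst hz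
    have hr : x₀ ^ 2 + y₀ ^ 2 ≠ 0 := fun h =>
      hxyz (by nlinarith) (by nlinarith) rfl
    set r := x₀ ^ 2 + y₀ ^ 2 with hr_def
    set f : Fin 2 → MvPolynomial (Fin 2) ℝ :=
      ![x₀ • X 0 - y₀ • X 1, y₀ • X 0 + x₀ • X 1] with hf
    set g : Fin 2 → MvPolynomial (Fin 2) ℝ :=
      ![(x₀ / r) • X 0 + (y₀ / r) • X 1, (x₀ / r) • X 1 - (y₀ / r) • X 0] with hg
    have hsm : ∀ (t : ℝ) (i : Fin 2), (t • X i : MvPolynomial (Fin 2) ℝ).totalDegree ≤ 1 :=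
      fun t i => (totalDegree_smul_le _ _).trans (totalDegree_X_le_one i)
    have hfd : ∀ i, (f i).totalDegree ≤ 1 := by
      intro i; fin_cases i
      · exact (totalDegree_sub _ _).trans (max_le (hsm _ _) (hsm _ _))
      · exact (totalDegree_add _ _).trans (max_le (hsm _ _) (hsm _ _))
    have hgd : ∀ i, (g i).totalDegree ≤ 1 := by
      intro i; fin_cases i
      · exact (totalDegree_add _ _).trans (max_le (hsm _ _) (hsm _ _))
      · exact (totalDegree_sub _ _).trans (max_le (hsm _ _) (hsm _ _))
    have hfe : ∀ x, (fun j => eval x (f j)) = ![x₀ * x 0 - y₀ * x 1, y₀ * x 0 + x₀ * x 1] :=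
      fun x => by ext j; fin_cases j <;> simp [hf, smul_eq_C_mul]
    have hge : ∀ x, (fun j => eval x (g j)) =
        ![x₀ / r * x 0 + y₀ / r * x 1, x₀ / r * x 1 - y₀ / r * x 0] :=
      fun x => by ext j; fin_cases j <;> simp [hg, smul_eq_C_mul]
    refine exists_sq_le_of_aeval (f := f) (g := g) hgd (fun x => ?_) (fun x => ?_) ?_
    · rw [hge, hfe]
      ext j; fin_cases j <;> simp <;> field_simp <;> rw [hr_def] <;> ring
    · rw [hfe, hge]
      ext j; fin_cases j <;> simp <;> field_simp <;> rw [hr_def] <;> ring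
    have hev' := eval_eq_quarticEval ((totalDegree_aeval_le_of_le_one hfd p).trans hp)
    set c' : ℕ → ℕ → ℝ :=
      fun i j => coeff (Finsupp.single 0 i + Finsupp.single 1 j) (aeval f p) with hc'
    have hcc : ∀ x y, quarticEval c' x y =
        quarticEval c (x₀ * x - y₀ * y) (y₀ * x + x₀ * y) := fun x y => by
      have h1 := hev' ![x, y]
      rw [eval_aeval_eq, hfe, hev] at h1
      simpa using h1.symm
    have h40 : c' 4 0 = 0 := by
      have e := fun s : ℝ => hcc s 0
      have e0 := e 0
      have e1 := e 1
      have e2 := e 2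
      have e3 := e (-1)
      have e4 := e (-2)
      simp only [quarticEval] at e0 e1 e2 e3 e4
      simp only [quarticForm] at h0
      linear_combination (1 / 24) * (e2 - 4 * e1 + 6 * e0 - 4 * e3 + e4) + h0
    obtain ⟨e, he0, hle⟩ := exists_conicEval_sq_le_of_infinite_zero (c := c')
      (fun x y => by rw [hcc]; exact hcpos _ _) (by
        obtain ⟨x, hx⟩ := hne
        refine ⟨x₀ / r * x 0 + y₀ / r * x 1, x₀ / r * x 1 - y₀ / r * x 0, ?_⟩
        rw [hcc]
        rw [hev] at hx
        convert hx using 2 <;> field_simp <;> rw [hr_def] <;> ring) h40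
    exact exists_sq_le_of_exists_conicEval ⟨e, he0, fun x => by rw [hev']; exact hle _ _⟩
  · set f : Fin 2 → MvPolynomial (Fin 2) ℝ := ![X 0 + C (x₀ / z₀), X 1 + C (y₀ / z₀)] with hf
    set g : Fin 2 → MvPolynomial (Fin 2) ℝ := ![X 0 - C (x₀ / z₀), X 1 - C (y₀ / z₀)] with hg
    have hfd : ∀ i, (f i).totalDegree ≤ 1 := by
      intro i
      fin_cases i <;>
        exact (totalDegree_add _ _).trans (max_le (totalDegree_X_le_one _) (by simp))
    have hgd : ∀ i, (g i).totalDegree ≤ 1 := by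
      intro i
      fin_cases i <;>
        exact (totalDegree_sub _ _).trans (max_le (totalDegree_X_le_one _) (by simp))
    have hfe : ∀ x, (fun j => eval x (f j)) = ![x 0 + x₀ / z₀, x 1 + y₀ / z₀] :=
      fun x => by ext j; fin_cases j <;> simp [hf]
    have hge : ∀ x, (fun j => eval x (g j)) = ![x 0 - x₀ / z₀, x 1 - y₀ / z₀] :=
      fun x => by ext j; fin_cases j <;> simp [hg]
    refine exists_sq_le_of_aeval (f := f) (g := g) hgd (fun x => ?_) (fun x => ?_) ?_
    · rw [hge, hfe]
      ext j; fin_cases j <;> simp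
    · rw [hfe, hge]
      ext j; fin_cases j <;> simp
    have hev' := eval_eq_quarticEval ((totalDegree_aeval_le_of_le_one hfd p).trans hp)
    set c' : ℕ → ℕ → ℝ :=
      fun i j => coeff (Finsupp.single 0 i + Finsupp.single 1 j) (aeval f p) with hc'
    have hcc : ∀ x y, quarticEval c' x y = quarticEval c (x + x₀ / z₀) (y + y₀ / z₀) :=
      fun x y => by
        have h1 := hev' ![x, y]
        rw [eval_aeval_eq, hfe, hev] at h1
        simpa using h1.symm
    have h00 : c' 0 0 = 0 := by
      have h1 := hcc 0 0
      rw [quarticForm_eq _ _ hz] at h0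
      rw [zero_add, zero_add, (mul_eq_zero.1 h0).resolve_left (by positivity)] at h1
      simpa [quarticEval] using h1
    obtain ⟨e, he0, hle⟩ := exists_conicEval_sq_le_of_zero (c := c')
      (fun x y => by rw [hcc]; exact hcpos _ _) (by
        obtain ⟨x, hx⟩ := hne
        refine ⟨x 0 - x₀ / z₀, x 1 - y₀ / z₀, ?_⟩
        rwa [hcc, sub_add_cancel, sub_add_cancel, ← hev]) h00
    exact exists_sq_le_of_exists_conicEval ⟨e, he0, fun x => by rw [hev']; exact hle _ _⟩

end TernaryQuartics

section Main

theorem HasLift.psdTuple_one {V : Type*} [AddCommGroup V] [Module ℝ V] {k : ℕ} {S : Set V}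
    (h : HasLift (PSDCone k) S) : HasLift (PSDTuple k 1) S := by
  obtain ⟨H, f, rfl⟩ := h
  set e : (Fin 1 → Matrix (Fin k) (Fin k) ℝ) →ₗ[ℝ] Matrix (Fin k) (Fin k) ℝ := LinearMap.proj 0
  refine ⟨H.comap e.toAffineMap, f ∘ₗ e, ?_⟩
  ext v
  constructor
  · rintro ⟨A, ⟨hA, hAH⟩, rfl⟩
    exact ⟨fun _ => A, ⟨fun _ => hA, hAH⟩, rfl⟩
  · rintro ⟨A, ⟨hA, hAH⟩, rfl⟩
    exact ⟨A 0, ⟨hA 0, hAH⟩, rfl⟩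

theorem hasSquareMinorants_of_not {n d : ℕ} (hn : 1 ≤ n) (hd : 1 ≤ d)
    (h : ¬ (2 ≤ n ∧ 2 ≤ d ∧ (n, d) ≠ (2, 2))) : HasSquareMinorants n d := by
  rcases hn.eq_or_lt with rfl | hn
  · exact hasSquareMinorants_one_left d
  rcases hd.eq_or_lt with rfl | hd
  · exact hasSquareMinorants_one_right n
  have : (n, d) = (2, 2) := by
    by_contra hne
    exact h ⟨hn, hd, hne⟩
  obtain ⟨rfl, rfl⟩ := Prod.mk.inj this
  exact hasSquareMinorants_two_two

end Main

/-- Corollary 2.12: if `n,d ≥ 2` and `(n,d) ≠ (2,2)` then the moment cone `M_{n,2d}` has no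
semidefinite extended formulation; otherwise `sxdeg(M_{n,2d}) = sxc(M_{n,2d}) = C(n+d,n)`. -/
theorem stmt_7 (n d : ℕ) (hn : 1 ≤ n) (hd : 1 ≤ d) :
    ((2 ≤ n ∧ 2 ≤ d ∧ (n, d) ≠ (2, 2)) →
      (∀ k m : ℕ, ¬ HasLift (PSDTuple k m)
        (closure (coneHull (Set.range (monVec n (2 * d)))))) ∧
      sxdeg (closure (coneHull (Set.range (monVec n (2 * d))))) = ⊤ ∧
      sxc (closure (coneHull (Set.range (monVec n (2 * d))))) = ⊤) ∧
    (¬ (2 ≤ n ∧ 2 ≤ d ∧ (n, d) ≠ (2, 2)) →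
      sxdeg (closure (coneHull (Set.range (monVec n (2 * d))))) = (Nat.choose (n + d) n : ℕ∞) ∧
      sxc (closure (coneHull (Set.range (monVec n (2 * d))))) = (Nat.choose (n + d) n : ℕ∞)) := by
  refine ⟨fun h => ⟨not_hasLift h, ?_, ?_⟩, fun h => ?_⟩
  · refine sInf_eq_top.2 ?_
    rintro _ ⟨k, m, rfl, hl⟩
    exact absurd hl (not_hasLift h k m)
  · refine sInf_eq_top.2 ?_
    rintro _ ⟨k, rfl, hl⟩
    exact absurd hl.psdTuple_one (not_hasLift h k 1)
  have hl := (hasSquareMinorants_of_not hn hd h).hasLift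
  refine ⟨le_antisymm (sInf_le ⟨_, 1, rfl, hl.psdTuple_one⟩) (le_sInf ?_),
    le_antisymm (sInf_le ⟨_, rfl, hl⟩) (le_sInf ?_)⟩
  · rintro _ ⟨k, m, rfl, hk⟩
    exact_mod_cast choose_le_of_hasLift hk
  · rintro _ ⟨k, rfl, hk⟩
    exact_mod_cast choose_le_of_hasLift hk.psdTuple_one
end
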